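/- arXiv:1602.01253 — 3 statements merged into one kernel-verified Lean document; each statement's English description precedes it below -/
import Mathlib

section
/- Let M ⪯ N be models of a complete NIP first-order L-theory, with N sufficiently saturated (e.g., |M|⁺-saturated). Let φ(x,y) be an L-formula with parameters from M and let b be a tuple from N. Assume φ(x,b) does not divide over M. Then there exist an L-formula ψ(y) with parameters from M satisfied by b and a finite set A_ψ of tuples from N (of the sort of x) such that for every tuple b′ from M with M ⊨ ψ(b′), there is some a ∈ A_ψ with N ⊨ φ(a, b′). -/
open FirstOrder FirstOrder.Language

universe u v w

namespace DistalPaper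

variable (L : FirstOrder.Language.{u, v})

def SameTypeOver {N : Type w} [L.Structure N] (A : Set N) {γ : Type*} (b b' : γ → N) : Prop :=
  ∀ (p : ℕ) (φ : L.Formula (γ ⊕ Fin p)) (m : Fin p → N), (∀ i, m i ∈ A) →
    (φ.Realize (Sum.elim b m) ↔ φ.Realize (Sum.elim b' m))

def IsIndiscernibleOver {N : Type w} [L.Structure N] (A : Set N) {I : Type*} [LinearOrder I]
    {γ : Type*} (b : I → γ → N) : Prop :=
  ∀ (m : ℕ) (i j : Fin m → I), StrictMono i → StrictMono j →
    SameTypeOver L A (fun q : Fin m × γ => b (i q.1) q.2) (fun q : Fin m × γ => b (j q.1) q.2)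

def IsConsistentFamily {N : Type w} [L.Structure N] {α γ ι : Type*}
    (φ : L.Formula (α ⊕ γ)) (b : ι → γ → N) : Prop :=
  ∀ s : Finset ι, ∃ a : α → N, ∀ i ∈ s, φ.Realize (Sum.elim a (b i))

structure ElemExt (N : Type w) [L.Structure N] where
  Carrier : Type max u v w
  [str : L.Structure Carrier]
  emb : N ↪ₑ[L] Carrier

attribute [instance] ElemExt.str

def Divides {N : Type w} [L.Structure N] (A : Set N) {α γ : Type*}
    (φ : L.Formula (α ⊕ γ)) (b : γ → N) : Prop :=
  ∃ (E : ElemExt L N) (c : ℕ → γ → E.Carrier),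
    IsIndiscernibleOver L (⇑E.emb '' A) c ∧
    SameTypeOver L (⇑E.emb '' A) (c 0) (⇑E.emb ∘ b) ∧
    ¬ IsConsistentFamily L φ c

/-- The formula `φ(x, b)` forks over `A`: in some elementary extension it implies a finite
disjunction of formulas, each of which divides over (the image of) `A`. -/
def Forks {N : Type w} [L.Structure N] (A : Set N) {α γ : Type*}
    (φ : L.Formula (α ⊕ γ)) (b : γ → N) : Prop :=
  ∃ (E : ElemExt L N) (k m : ℕ) (ψ : Fin k → L.Formula (α ⊕ Fin m))
    (c : Fin k → Fin m → E.Carrier),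
    (∀ i, Divides L (⇑E.emb '' A) (ψ i) (c i)) ∧
    ∀ a : α → E.Carrier, φ.Realize (Sum.elim a (⇑E.emb ∘ b)) →
      ∃ i, (ψ i).Realize (Sum.elim a (c i))

/-- The complete type of the tuple `bs` over the parameter set `P` does not fork over `A`:
no formula with parameters from `P` satisfied by `bs` forks over `A`. -/
def TypeDoesNotForkOver {N : Type w} [L.Structure N] (A P : Set N) {β : Type*}
    (bs : β → N) : Prop :=
  ∀ (p : ℕ) (φ : L.Formula (β ⊕ Fin p)) (c : Fin p → N), (∀ i, c i ∈ P) →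
    φ.Realize (Sum.elim bs c) → ¬ Forks L A φ c

/-- `tp(a / A ∪ bs)` is strictly non-forking over `A`: it extends to a complete type `p`
over a monster model (an elementary extension `E` of `N`, realized by `a'` in a further
elementary extension `F`) such that `p` does not fork over `A` and, for the realization
`a'` of `p`, `tp(bs / A a')` does not fork over `A`. -/
def StrictlyNonForkingOver {N : Type w} [L.Structure N] (A : Set N) {α β : Type*}
    (a : α → N) (bs : β → N) : Prop :=
  ∃ (E : ElemExt L N) (F : ElemExt L E.Carrier) (a' : α → F.Carrier),
    SameTypeOver L ((⇑F.emb ∘ ⇑E.emb) '' (A ∪ Set.range bs)) a' (⇑F.emb ∘ ⇑E.emb ∘ a) ∧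
    TypeDoesNotForkOver L ((⇑F.emb ∘ ⇑E.emb) '' A) (Set.range ⇑F.emb) a' ∧
    TypeDoesNotForkOver L ((⇑F.emb ∘ ⇑E.emb) '' A)
      (((⇑F.emb ∘ ⇑E.emb) '' A) ∪ Set.range a') (⇑F.emb ∘ ⇑E.emb ∘ bs)

/-- `b` is a strict Morley sequence over `A` for the complete type (over `A`) of the
tuple `q`: an `A`-indiscernible sequence of realizations of `tp(q/A)` such that each
`tp(b (n+1) / A, b 0, ..., b n)` is strictly non-forking over `A`. -/
def IsStrictMorleySequence {N : Type w} [L.Structure N] (A : Set N) {γ : Type*}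
    (q : γ → N) (b : ℕ → γ → N) : Prop :=
  IsIndiscernibleOver L A b ∧
  (∀ n, SameTypeOver L A (b n) q) ∧
  ∀ n : ℕ, StrictlyNonForkingOver L A (b (n + 1)) (fun p : Fin (n + 1) × γ => b ↑p.1 p.2)

/-- `N` (equivalently, its complete theory) is NIP: no formula `φ(x, y)` has the
independence property in any model of `Th(N)`. -/
def IsNIP (N : Type w) [L.Structure N] : Prop :=
  ∀ (nx ny : ℕ) (φ : L.Formula (Fin nx ⊕ Fin ny)),
    ¬ ∃ (K : Theory.ModelType.{u, v, max u v w} (L.completeTheory N))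
        (a : ℕ → Fin nx → K) (bS : Set ℕ → Fin ny → K),
        ∀ (i : ℕ) (S : Set ℕ), φ.Realize (Sum.elim (a i) (bS S)) ↔ i ∈ S

/-- `N` is distal: it is NIP and, in every elementary extension, for every indiscernible
sequence `(b i)_{i ∈ ℤ}` and parameter set `A`, if the sequence with `b 0` omitted is
indiscernible over `A`, then the whole sequence is indiscernible over `A`. -/
def IsDistal (N : Type w) [L.Structure N] : Prop :=
  IsNIP L N ∧
  ∀ (E : ElemExt L N) (m : ℕ) (b : ℤ → Fin m → E.Carrier) (A : Set E.Carrier),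
    IsIndiscernibleOver L (∅ : Set E.Carrier) b →
    IsIndiscernibleOver L A (fun i : {i : ℤ // i ≠ 0} => b ↑i) →
    IsIndiscernibleOver L A b

/-- `N` is `κ`-saturated: every finitely satisfiable family of formulas in finitely many
free variables with parameters from a set of size `< κ` is realized in `N`. -/
def IsSaturated (κ : Cardinal.{w}) (N : Type w) [L.Structure N] : Prop :=
  ∀ (A : Set N), Cardinal.mk A < κ →
    ∀ (n : ℕ) (ι : Type max u v w) (p : ι → ℕ) (φ : ∀ i, L.Formula (Fin n ⊕ Fin (p i)))
      (c : ∀ i, Fin (p i) → N), (∀ i j, c i j ∈ A) →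
      (∀ s : Finset ι, ∃ a : Fin n → N, ∀ i ∈ s, (φ i).Realize (Sum.elim a (c i))) →
      ∃ a : Fin n → N, ∀ i, (φ i).Realize (Sum.elim a (c i))

/-- The complete type of `a` over the parameter set `P` (with `A ⊆ P`) extends to a
complete type over all of `N` which is `A`-invariant; the extension is encoded by a
realization `a'` in an elementary extension of `N`. -/
def ExtendsToInvariantType {N : Type w} [L.Structure N] (A P : Set N) {α : Type*}
    (a : α → N) : Prop :=
  ∃ (E : ElemExt L N) (a' : α → E.Carrier),
    SameTypeOver L (⇑E.emb '' P) a' (⇑E.emb ∘ a) ∧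
    ∀ (p : ℕ) (φ : L.Formula (α ⊕ Fin p)) (c c' : Fin p → N),
      SameTypeOver L A c c' →
      (φ.Realize (Sum.elim a' (⇑E.emb ∘ c)) ↔ φ.Realize (Sum.elim a' (⇑E.emb ∘ c')))

/-- Two sequences have the same Ehrenfeucht–Mostowski type over `A`: increasing tuples
of the same length from either sequence have the same type over `A`. -/
def SameEMTypeOver {N : Type w} [L.Structure N] (A : Set N) {I J : Type*}
    [LinearOrder I] [LinearOrder J] {γ : Type*} (b : I → γ → N) (d : J → γ → N) : Prop :=
  ∀ (m : ℕ) (i : Fin m → I) (j : Fin m → J), StrictMono i → StrictMono j →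
    SameTypeOver L A (fun q : Fin m × γ => b (i q.1) q.2) (fun q : Fin m × γ => d (j q.1) q.2)

/-- Insert the tuple `d` at position `0` into a sequence indexed by the nonzero integers. -/
def insertAtZero {X γ : Type*} (d : γ → X) (ds : {i : ℤ // i ≠ 0} → γ → X) : ℤ → γ → X :=
  fun i => if h : i = 0 then d else ds ⟨i, h⟩


section Helpers

variable {L}

open Filter

theorem exists_ultrapower {N : Type w} [L.Structure N] [Nonempty N] {I : Type}
    (Γ : Set (L.Formula (I ⊕ N)))
    (h : ∀ s : Finset (L.Formula (I ⊕ N)), (∀ θ ∈ s, θ ∈ Γ) →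
      ∃ v : I → N, ∀ θ ∈ s, θ.Realize (Sum.elim v id)) :
    ∃ (E : ElemExt L N) (v : I → E.Carrier), ∀ θ ∈ Γ, θ.Realize (Sum.elim v E.emb) := by
  classical
  have h' : ∀ s : Finset Γ, ∃ v : I → N, ∀ θ ∈ s, (θ : L.Formula (I ⊕ N)).Realize
      (Sum.elim v id) := by
    intro s
    obtain ⟨v, hv⟩ := h (s.image Subtype.val) (by
      intro θ hθ
      obtain ⟨x, _, rfl⟩ := Finset.mem_image.1 hθ
      exact x.2)
    exact ⟨v, fun θ hθ => hv _ (Finset.mem_image_of_mem _ hθ)⟩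
  choose V hV using h'
  let U : Ultrafilter (Finset Γ) := Ultrafilter.of atTop
  have key0 : ∀ {β : Type} (φ : L.Formula β) (x : β → N),
      φ.Realize (fun i => ((fun _ => x i : (s : Finset Γ) → N) :
        (U : Filter (Finset Γ)).Product (fun _ => N))) ↔ φ.Realize x := by
    intro β φ x
    rw [Ultraproduct.realize_formula_cast φ (fun i (_ : Finset Γ) => x i)]
    simp
  let emb : N ↪ₑ[L] (U : Filter (Finset Γ)).Product (fun _ => N) :=
    { toFun := fun n => ((fun _ => n : (s : Finset Γ) → N) :
        (U : Filter (Finset Γ)).Product (fun _ => N))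
      map_formula' := fun n φ x => key0 φ x }
  refine ⟨⟨(U : Filter (Finset Γ)).Product (fun _ => N), emb⟩,
    fun i => ((fun s => V s i : (s : Finset Γ) → N) :
        (U : Filter (Finset Γ)).Product (fun _ => N)), ?_⟩
  intro θ hθ
  have e : (Sum.elim (fun i => ((fun s => V s i : (s : Finset Γ) → N) :
        (U : Filter (Finset Γ)).Product (fun _ => N))) emb) =
      fun q : I ⊕ N => (((Sum.elim (fun i s => V s i) (fun n _ => n) :
        I ⊕ N → (Finset Γ → N)) q : Finset Γ → N) :
        (U : Filter (Finset Γ)).Product (fun _ => N)) := by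
    funext q
    cases q <;> rfl
  refine (congrArg (fun z => θ.Realize z) e).mpr
    ((Ultraproduct.realize_formula_cast θ _).2 ?_)
  have : ∀ᶠ s : Finset Γ in (U : Filter (Finset Γ)), {⟨θ, hθ⟩} ≤ s :=
    (Ultrafilter.of_le atTop) (eventually_ge_atTop _)
  filter_upwards [this] with s hs
  have := hV s ⟨θ, hθ⟩ (hs (by simp))
  convert! this using 1
  funext q
  cases q <;> rfl

/-- Only finitely many parameters occur in a formula. -/
theorem exists_finite_params {α : Type} {β : Type w} (θ : L.Formula (α ⊕ β)) :
    ∃ (p : ℕ) (θ' : L.Formula (α ⊕ Fin p)) (f : Fin p → β),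
      ∀ (K : Type w) [L.Structure K] (v : α → K) (g : β → K),
        θ'.Realize (Sum.elim v (g ∘ f)) ↔ θ.Realize (Sum.elim v g) := by
  classical
  let T : Finset β := θ.freeVarFinset.toRight
  let e := T.equivFin
  refine ⟨T.card, θ.restrictFreeVar (fun x => match x with
    | ⟨Sum.inl a, _⟩ => Sum.inl a
    | ⟨Sum.inr b, hb⟩ => Sum.inr (e ⟨b, by simpa [T] using hb⟩)), fun i => (e.symm i : β), ?_⟩
  intro K _ v g
  apply BoundedFormula.realize_restrictFreeVar
  rintro ⟨a | b, h⟩ <;> simp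

/-- The combinatorial core. -/
theorem combi_aux {X Y : Type*} (R : X → Y → Prop) (P : Y → Prop)
    (hP : ∀ y, P y → ∃ x, R x y)
    (hB : ∀ n : ℕ, ∃ B : Finset Y, (∀ y ∈ B, P y) ∧
      ∀ A : Finset X, A.card ≤ n → ∃ y ∈ B, ∀ x ∈ A, ¬ R x y)
    (f : Finset Y → X) (hf : ∀ K : Finset Y, (∃ x, ∀ y ∈ K, R x y) → ∀ y ∈ K, R (f K) y)
    (m : ℕ) : ∀ k : ℕ, ∃ B : Finset Y, (∀ y ∈ B, P y) ∧
      ∀ S : Finset Y, S.card ≤ k → (∀ y ∈ S, P y) → ∃ b : Fin m → Y,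
        Function.Injective b ∧ (∀ i, b i ∈ B) ∧
        ∀ K : Finset Y, (∀ y ∈ K, y ∈ S ∨ ∃ i, y = b i) → ∀ i, b i ∉ K → ¬ R (f K) (b i) := by
  classical
  induction m with
  | zero =>
    intro k
    exact ⟨∅, by simp, fun S _ _ => ⟨Fin.elim0, fun i => i.elim0, fun i => i.elim0,
      fun K _ i => i.elim0⟩⟩
  | succ m ih =>
    intro k
    obtain ⟨B', hB'P, hB'⟩ := ih (k + 1)
    obtain ⟨B1, hB1P, hB1⟩ := hB (2 ^ (k + B'.card))
    refine ⟨B1 ∪ B', ?_, ?_⟩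
    · intro y hy
      rcases Finset.mem_union.1 hy with h | h
      · exact hB1P y h
      · exact hB'P y h
    intro S hSk hSP
    obtain ⟨b1, hb1, hav⟩ := hB1 ((S ∪ B').powerset.image f) (by
      refine Finset.card_image_le.trans ?_
      rw [Finset.card_powerset]
      apply Nat.pow_le_pow_right (by norm_num)
      exact (Finset.card_union_le _ _).trans (by omega))
    have hav' : ∀ K ⊆ S ∪ B', ¬ R (f K) b1 := fun K hK =>
      hav _ (Finset.mem_image_of_mem _ (Finset.mem_powerset.2 hK))
    have hnot : b1 ∉ S ∪ B' := by
      intro hmem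
      refine hav' {b1} (by simpa using hmem) (hf {b1} ?_ b1 (by simp))
      obtain ⟨x, hx⟩ := hP b1 (hB1P _ hb1)
      exact ⟨x, by simpa using hx⟩
    obtain ⟨b, hinj, hbB, hb⟩ := hB' (insert b1 S)
      ((Finset.card_insert_le _ _).trans (by omega)) (by
        intro y hy
        rcases Finset.mem_insert.1 hy with rfl | h
        · exact hB1P _ hb1
        · exact hSP y h)
    refine ⟨Fin.cons b1 b, ?_, ?_, ?_⟩
    · rw [Fin.cons_injective_iff]
      refine ⟨?_, hinj⟩
      rintro ⟨i, rfl⟩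
      exact hnot (Finset.mem_union_right _ (hbB i))
    · intro i
      refine Fin.cases ?_ (fun i => ?_) i
      · simpa using Or.inl hb1
      · simpa using Or.inr (hbB i)
    · intro K hK i
      refine Fin.cases ?_ (fun i => ?_) i
      · intro hi
        rw [Fin.cons_zero] at hi ⊢
        apply hav'
        intro y hy
        rcases hK y hy with h | ⟨j, rfl⟩
        · exact Finset.mem_union_left _ h
        · revert hy
          refine Fin.cases ?_ (fun j => ?_) j
          · intro hy; exact absurd hy hi
          · intro _; exact Finset.mem_union_right _ (by simpa using hbB j)
      · intro hi
        rw [Fin.cons_succ] at hi ⊢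
        apply hb K _ i hi
        intro y hy
        rcases hK y hy with h | ⟨j, rfl⟩
        · exact Or.inl (Finset.mem_insert_of_mem h)
        · refine Fin.cases ?_ (fun j => ?_) j
          · simp
          · exact Or.inr ⟨j, by simp⟩

theorem combi {X Y : Type*} (R : X → Y → Prop) (P : Y → Prop)
    (hP : ∀ y, P y → ∃ x, R x y)
    (hB : ∀ n : ℕ, ∃ B : Finset Y, (∀ y ∈ B, P y) ∧
      ∀ A : Fin n → X, ∃ y ∈ B, ∀ i, ¬ R (A i) y)
    (m : ℕ) : ∃ b : Fin m → Y, (∀ i, P (b i)) ∧ ∀ K : Finset (Fin m),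
      (∃ x, ∀ i ∈ K, R x (b i)) → ∃ x, (∀ i ∈ K, R x (b i)) ∧ ∀ i ∉ K, ¬ R x (b i) := by
  classical
  have hX : Nonempty X := by
    obtain ⟨B, hBP, hB⟩ := hB 0
    obtain ⟨y, hy, _⟩ := hB Fin.elim0
    exact ⟨(hP y (hBP y hy)).choose⟩
  have hf : ∀ K : Finset Y, ∃ z, (∃ x, ∀ y ∈ K, R x y) → ∀ y ∈ K, R z y := by
    intro K
    by_cases h : ∃ x, ∀ y ∈ K, R x y
    · exact ⟨h.choose, fun _ => h.choose_spec⟩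
    · exact ⟨hX.some, fun h' => absurd h' h⟩
  choose f hf using hf
  obtain ⟨B, hBP, h⟩ := combi_aux R P hP (by
    intro n
    obtain ⟨B, hBP, hB⟩ := hB n
    refine ⟨B, hBP, fun A hA => ?_⟩
    obtain ⟨y, hy, hyA⟩ := hB (fun i => if h : (i : ℕ) < A.card
      then (A.equivFin.symm ⟨i, h⟩ : X) else hX.some)
    refine ⟨y, hy, fun x hx => ?_⟩
    have := hyA ⟨A.equivFin ⟨x, hx⟩, lt_of_lt_of_le (Fin.is_lt _) hA⟩
    simpa using this) f hf m 0
  obtain ⟨b, hinj, hbB, hb⟩ := h ∅ (by simp) (by simp)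
  refine ⟨b, fun i => hBP _ (hbB i), fun K hK => ⟨f (K.image b), ?_, ?_⟩⟩
  · intro i hi
    apply hf _ _ _ (Finset.mem_image_of_mem _ hi)
    obtain ⟨x, hx⟩ := hK
    refine ⟨x, fun y hy => ?_⟩
    obtain ⟨j, hj, rfl⟩ := Finset.mem_image.1 hy
    exact hx j hj
  · intro i hi
    apply hb
    · intro y hy
      obtain ⟨j, hj, rfl⟩ := Finset.mem_image.1 hy
      exact Or.inr ⟨j, rfl⟩
    · intro h
      obtain ⟨j, hj, hji⟩ := Finset.mem_image.1 h
      exact hi (hinj hji ▸ hj)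

/-- Iterated nonprincipal ultrafilters on finite tuples of naturals. -/
noncomputable def iterUF : (n : ℕ) → Ultrafilter (Fin n → ℕ)
  | 0 => pure Fin.elim0
  | n + 1 => (hyperfilter ℕ).bind fun i => (iterUF n).map (Fin.cons i)

theorem iterUF_zero (P : (Fin 0 → ℕ) → Prop) :
    (∀ᶠ v in iterUF 0, P v) ↔ P Fin.elim0 := by
  simp [iterUF]

theorem iterUF_succ {n : ℕ} (P : (Fin (n + 1) → ℕ) → Prop) :
    (∀ᶠ v in iterUF (n + 1), P v) ↔
      ∀ᶠ i in hyperfilter ℕ, ∀ᶠ w in iterUF n, P (Fin.cons i w) := by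
  rfl

theorem iterUF_strictMono (n : ℕ) : ∀ k : ℕ,
    ∀ᶠ v : Fin n → ℕ in iterUF n, StrictMono v ∧ ∀ i, k < v i := by
  induction n with
  | zero =>
    intro k
    rw [iterUF_zero]
    exact ⟨fun i => i.elim0, fun i => i.elim0⟩
  | succ n ih =>
    intro k
    rw [iterUF_succ]
    have : ∀ᶠ i in (hyperfilter ℕ : Filter ℕ), k < i :=
      (Nat.hyperfilter_le_atTop) (eventually_gt_atTop k)
    filter_upwards [this] with i hi
    filter_upwards [ih i] with w hw
    refine ⟨?_, ?_⟩
    · intro a b hab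
      induction a using Fin.cases with
      | zero =>
        induction b using Fin.cases with
        | zero => exact absurd hab (lt_irrefl _)
        | succ b => simpa using hw.2 b
      | succ a =>
        induction b using Fin.cases with
        | zero => exact absurd hab (by simp)
        | succ b => simpa using hw.1 (by simpa using hab)
    · intro a
      induction a using Fin.cases with
      | zero => simpa using hi
      | succ a => simpa using hi.trans (hw.2 a)

theorem iterUF_comp (n' : ℕ) : ∀ (n : ℕ) (j : Fin n → Fin n'), StrictMono j →
    ∀ P : (Fin n → ℕ) → Prop,
      (∀ᶠ v in iterUF n', P (v ∘ j)) ↔ ∀ᶠ v in iterUF n, P v := by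
  induction n' with
  | zero =>
    intro n j hj P
    have : n = 0 := by
      rcases n with _ | n
      · rfl
      · exact (j 0).elim0
    subst this
    rw [iterUF_zero, iterUF_zero]
    rw [Subsingleton.elim (Fin.elim0 ∘ j) Fin.elim0]
  | succ n' ih =>
    intro n j hj P
    by_cases h0 : ∃ a, j a = 0
    · obtain ⟨a, ha⟩ := h0
      rcases n with _ | n
      · exact a.elim0
      have hj0 : j 0 = 0 := by
        have : j 0 ≤ j a := hj.monotone (Fin.zero_le _)
        rw [ha] at this
        exact Fin.le_zero_iff.1 this
      have hne : ∀ i : Fin n, j i.succ ≠ 0 := fun i => by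
        have := hj (Fin.succ_pos i)
        rw [hj0] at this
        exact this.ne'
      let j' : Fin n → Fin n' := fun i => (j i.succ).pred (hne i)
      have hj' : StrictMono j' := fun a b hab => by
        simpa [j'] using hj (Fin.succ_lt_succ_iff.2 hab)
      rw [iterUF_succ, iterUF_succ]
      refine eventually_congr (Eventually.of_forall fun i => ?_)
      rw [← ih n j' hj']
      refine eventually_congr (Eventually.of_forall fun w => ?_)
      have : (Fin.cons i w : Fin (n' + 1) → ℕ) ∘ j = Fin.cons i (w ∘ j') := by
        funext a
        induction a using Fin.cases with
        | zero => simp [hj0]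
        | succ a =>
          have : j a.succ = (j' a).succ := by simp [j']
          simp [this]
      rw [this]
    · push Not at h0
      let j' : Fin n → Fin n' := fun i => (j i).pred (h0 i)
      have hj' : StrictMono j' := fun a b hab => by
        simpa [j'] using hj hab
      rw [iterUF_succ, ← ih n j' hj']
      have : ∀ i : ℕ, ∀ w : Fin n' → ℕ, (Fin.cons i w : Fin (n' + 1) → ℕ) ∘ j = w ∘ j' := by
        intro i w
        funext a
        have : j a = (j' a).succ := by simp [j']
        simp [this]
      simp only [this]
      simp

theorem extract {N : Type w} [L.Structure N] [Nonempty N] {γ : Type} (b : ℕ → γ → N) :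
    ∃ (E : ElemExt L N) (c : ℕ → γ → E.Carrier),
      IsIndiscernibleOver L (Set.range E.emb) c ∧
      ∀ (n : ℕ) (θ : L.Formula ((Fin n × γ) ⊕ N)),
        (∀ v : Fin n → ℕ, StrictMono v →
          θ.Realize (Sum.elim (fun q => b (v q.1) q.2) id)) →
        ∀ j : Fin n → ℕ, StrictMono j →
          θ.Realize (Sum.elim (fun q => c (j q.1) q.2) E.emb) := by
  classical
  let Γ : Set (L.Formula ((ℕ × γ) ⊕ N)) := {θ' | ∃ (n : ℕ) (θ : L.Formula ((Fin n × γ) ⊕ N))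
    (j : Fin n → ℕ), StrictMono j ∧
      (∀ᶠ v : Fin n → ℕ in iterUF n, θ.Realize (Sum.elim (fun q => b (v q.1) q.2) id)) ∧
      θ' = θ.relabel (Sum.map (Prod.map j id) id)}
  obtain ⟨E, c', hc'⟩ := exists_ultrapower Γ (by
    intro s hs
    let ev : (n : ℕ) → (Fin n → ℕ) → (ℕ × γ → N) := fun n w q =>
      if h : q.1 < n then b (w ⟨q.1, h⟩) q.2 else b 0 q.2
    have h1 : ∀ θ' ∈ s, ∀ᶠ n' in atTop, ∀ᶠ w in iterUF n',
        θ'.Realize (Sum.elim (ev n' w) id) := by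
      intro θ' hθ'
      obtain ⟨n, θ, j, hj, hev, rfl⟩ := hs θ' hθ'
      have hb : ∀ᶠ n' in atTop, ∀ i, j i < n' :=
        eventually_all.2 fun i => eventually_gt_atTop _
      filter_upwards [hb] with n' hn'
      have := (iterUF_comp n' n (fun i => ⟨j i, hn' i⟩) (fun a b hab => hj hab) _).2 hev
      filter_upwards [this] with w hw
      rw [Formula.realize_relabel]
      convert! hw using 1
      funext q
      rcases q with ⟨i, g⟩ | x
      · simp [ev, hn' i]
      · rfl
    have h2 := (eventually_all_finset s).2 h1
    obtain ⟨n', hn'⟩ := h2.exists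
    obtain ⟨w, hw⟩ := ((eventually_all_finset s).2 hn').exists
    exact ⟨ev n' w, hw⟩)
  have hG : ∀ (n : ℕ) (θ : L.Formula ((Fin n × γ) ⊕ N)) (j : Fin n → ℕ), StrictMono j →
      (∀ᶠ v : Fin n → ℕ in iterUF n, θ.Realize (Sum.elim (fun q => b (v q.1) q.2) id)) →
      θ.Realize (Sum.elim (fun q => c' (j q.1, q.2)) E.emb) := by
    intro n θ j hj hev
    have := hc' _ ⟨n, θ, j, hj, hev, rfl⟩
    rw [Formula.realize_relabel] at this
    convert! this using 1
    funext q
    rcases q with ⟨i, g⟩ | x <;> rfl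
  refine ⟨E, fun i g => c' (i, g), ?_, ?_⟩
  · intro m i j hi hj p φ mm hmm
    choose e he using hmm
    have hr : ∀ v : Fin m × γ → E.Carrier, φ.Realize (Sum.elim v mm) ↔
        (φ.relabel (Sum.map id e)).Realize (Sum.elim v E.emb) := by
      intro v
      rw [Formula.realize_relabel]
      have : Sum.elim v mm = Sum.elim v E.emb ∘ Sum.map id e := by
        funext q
        rcases q with q | q
        · rfl
        · exact (he q).symm
      rw [this]
    rw [hr, hr]
    set θ := φ.relabel (Sum.map (id : Fin m × γ → Fin m × γ) e) with hθ
    rcases Ultrafilter.em (iterUF m) (fun v =>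
      θ.Realize (Sum.elim (fun q => b (v q.1) q.2) id)) with h | h
    · exact ⟨fun _ => hG m θ j hj h, fun _ => hG m θ i hi h⟩
    · have h1 := hG m θ.not j hj (by simpa only [Formula.realize_not] using h)
      have h2 := hG m θ.not i hi (by simpa only [Formula.realize_not] using h)
      rw [Formula.realize_not] at h1 h2
      exact ⟨fun h => absurd h h2, fun h => absurd h h1⟩
  · intro n θ hθ j hj
    refine hG n θ j hj ?_
    filter_upwards [iterUF_strictMono n 0] with v hv
    exact hθ v hv.1

/-- The formula saying that some `x` satisfies `φ` on `pos` and `¬ φ` on `neg`. -/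
noncomputable def traceFormula {nx : ℕ} {γ : Type} (φ : L.Formula (Fin nx ⊕ γ)) (m : ℕ)
    (pos neg : Finset (Fin m)) : L.Formula (Fin m × γ) :=
  Formula.iExs (Fin nx)
    ((Formula.iInf fun i : pos => φ.relabel (Sum.elim Sum.inr fun g => Sum.inl ((i : Fin m), g))) ⊓
     (Formula.iInf fun i : neg =>
      (φ.relabel (Sum.elim Sum.inr fun g => Sum.inl ((i : Fin m), g))).not))

theorem realize_traceFormula {nx : ℕ} {γ : Type} (φ : L.Formula (Fin nx ⊕ γ)) (m : ℕ)
    (pos neg : Finset (Fin m)) {N : Type w} [L.Structure N] (v : Fin m × γ → N) :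
    (traceFormula φ m pos neg).Realize v ↔ ∃ a : Fin nx → N,
      (∀ i ∈ pos, φ.Realize (Sum.elim a fun g => v (i, g))) ∧
      ∀ i ∈ neg, ¬ φ.Realize (Sum.elim a fun g => v (i, g)) := by
  have h : ∀ (a : Fin nx → N) (i : Fin m),
      (φ.relabel (Sum.elim Sum.inr fun g => Sum.inl (i, g)) :
        L.Formula ((Fin m × γ) ⊕ Fin nx)).Realize (Sum.elim v a) ↔
      φ.Realize (Sum.elim a fun g => v (i, g)) := by
    intro a i
    rw [Formula.realize_relabel]
    have : (Sum.elim v a ∘ Sum.elim Sum.inr fun g => Sum.inl (i, g)) =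
      Sum.elim a fun g => v (i, g) := by
      funext q
      cases q <;> rfl
    rw [this]
  simp only [traceFormula, Formula.realize_iExs, Formula.realize_inf, Formula.realize_iInf,
    Formula.realize_not, h, Subtype.forall]

theorem consistent_of_not_divides {N : Type w} [L.Structure N] (A : Set N) {α γ : Type}
    (φ : L.Formula (α ⊕ γ)) (b : γ → N) (h : ¬ Divides L A φ b) :
    ∃ a : α → N, φ.Realize (Sum.elim a b) := by
  let _ : L.Structure (ULift.{max u v w} N) := Equiv.inducedStructure Equiv.ulift.symm
  let e : N ≃[L] ULift.{max u v w} N := Equiv.inducedStructureEquiv Equiv.ulift.symm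
  let E : ElemExt L N := ⟨ULift.{max u v w} N, e.toElementaryEmbedding⟩
  by_contra hcon
  apply h
  refine ⟨E, fun _ => E.emb ∘ b, ?_, ?_, ?_⟩
  · intro m i j _ _ p φ mm _
    exact Iff.rfl
  · intro p φ mm _
    exact Iff.rfl
  · intro hc
    obtain ⟨a, ha⟩ := hc {0}
    have ha := ha 0 (by simp)
    apply hcon
    refine ⟨fun i => (a i).down, ?_⟩
    rw [← E.emb.map_formula]
    convert! ha using 1
    funext q
    cases q <;> rfl

theorem nip_contra {N : Type w} [L.Structure N] (hNIP : IsNIP L N) (E : ElemExt L N)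
    [Nonempty E.Carrier] {nx ny np : ℕ} (φ : L.Formula (Fin nx ⊕ (Fin ny ⊕ Fin np)))
    (c : ℕ → (Fin ny ⊕ Fin np) → E.Carrier)
    (hc : ∀ (m : ℕ) (K : Finset (Fin m)), ∃ a : Fin nx → E.Carrier,
      (∀ i ∈ K, φ.Realize (Sum.elim a (c i))) ∧
      ∀ i ∉ K, ¬ φ.Realize (Sum.elim a (c i))) : False := by
  classical
  let F : ℕ → Set ℕ → L.Formula ((Set ℕ × Fin nx) ⊕ E.Carrier) := fun i S =>
    φ.relabel (Sum.map (Prod.mk S) (c i))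
  let Γ : Set (L.Formula ((Set ℕ × Fin nx) ⊕ E.Carrier)) :=
    {θ | ∃ i S, θ = if i ∈ S then F i S else (F i S).not}
  have hF : ∀ (K : Type (max u v w)) [L.Structure K] (v : Set ℕ × Fin nx → K)
      (g : E.Carrier → K) (i : ℕ) (S : Set ℕ),
      (F i S).Realize (Sum.elim v g) ↔
        φ.Realize (Sum.elim (fun k => v (S, k)) (g ∘ c i)) := by
    intro K _ v g i S
    rw [Formula.realize_relabel]
    have : Sum.elim v g ∘ Sum.map (Prod.mk S) (c i) =
        Sum.elim (fun k => v (S, k)) (g ∘ c i) := by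
      funext q
      cases q <;> rfl
    rw [this]
  obtain ⟨E3, v, hv⟩ := exists_ultrapower Γ (by
    intro s hs
    choose! i S hiS using hs
    let m := s.sup i + 1
    choose a ha ha' using hc m
    refine ⟨fun q => a (Finset.univ.filter fun l : Fin m => (l : ℕ) ∈ q.1) q.2, ?_⟩
    intro θ hθ
    have hlt : i θ < m := Nat.lt_succ_of_le (Finset.le_sup hθ)
    rw [hiS θ hθ]
    split_ifs with h
    · rw [hF]
      exact ha (Finset.univ.filter fun l : Fin m => (l : ℕ) ∈ S θ) ⟨i θ, hlt⟩ (by simpa using h)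
    · rw [Formula.realize_not, hF]
      exact ha' (Finset.univ.filter fun l : Fin m => (l : ℕ) ∈ S θ) ⟨i θ, hlt⟩ (by simpa using h))
  have hfin : ∀ i S, φ.Realize (Sum.elim (fun k => v (S, k)) (E3.emb ∘ c i)) ↔ i ∈ S := by
    intro i S
    have := hv _ ⟨i, S, rfl⟩
    split_ifs at this with h
    · rw [hF] at this
      exact ⟨fun _ => h, fun _ => this⟩
    · rw [Formula.realize_not, hF] at this
      exact ⟨fun h' => absurd h' this, fun h' => absurd h' h⟩
  have hne : Nonempty E3.Carrier := ⟨E3.emb (Classical.arbitrary _)⟩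
  have hmod : E3.Carrier ⊨ L.completeTheory N := by
    rw [← E3.emb.theory_model_iff, ← E.emb.theory_model_iff]
    infer_instance
  refine hNIP (ny + np) nx (φ.relabel (Sum.elim Sum.inr (Sum.inl ∘ finSumFinEquiv)))
    ⟨Theory.ModelType.of (L.completeTheory N) E3.Carrier,
      fun i l => E3.emb (c i (finSumFinEquiv.symm l)), fun S k => v (S, k), ?_⟩
  intro i S
  rw [Formula.realize_relabel, ← hfin i S]
  apply iff_of_eq
  congr 1
  funext q
  cases q <;> simp

theorem exists_finite_avoiding {N : Type w} [L.Structure N]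
    (M : L.ElementarySubstructure N)
    (hsat : IsSaturated L (Order.succ (Cardinal.mk M)) N)
    {nx ny np : ℕ} (φ : L.Formula (Fin nx ⊕ (Fin ny ⊕ Fin np))) (mp : Fin np → M)
    (P : (Fin ny → M) → Prop) (n : ℕ)
    (h : ∀ as : Fin n → Fin nx → N, ∃ b' : Fin ny → M, P b' ∧ ∀ i, ¬ φ.Realize
      (Sum.elim (as i) (Sum.elim (fun l => (b' l : N)) fun l => (mp l : N)))) :
    ∃ B : Finset (Fin ny → M), (∀ y ∈ B, P y) ∧ ∀ as : Fin n → Fin nx → N, ∃ b' ∈ B,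
      ∀ i, ¬ φ.Realize
        (Sum.elim (as i) (Sum.elim (fun l => (b' l : N)) fun l => (mp l : N))) := by
  classical
  by_contra hcon
  push Not at hcon
  let Φ : L.Formula (Fin (n * nx) ⊕ Fin (ny + np)) :=
    Formula.iSup fun i : Fin n => φ.relabel
      (Sum.map (fun k => finProdFinEquiv (i, k)) finSumFinEquiv)
  let C : (Fin ny → M) → Fin (ny + np) → N := fun b' l =>
    (Sum.elim (fun l => (b' l : N)) fun l => (mp l : N)) (finSumFinEquiv.symm l)
  have hΦ : ∀ (a : Fin (n * nx) → N) (b' : Fin ny → M), Φ.Realize (Sum.elim a (C b')) ↔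
      ∃ i : Fin n, φ.Realize (Sum.elim (fun k => a (finProdFinEquiv (i, k)))
        (Sum.elim (fun l => (b' l : N)) fun l => (mp l : N))) := by
    intro a b'
    simp only [Φ, Formula.realize_iSup, Formula.realize_relabel]
    apply exists_congr
    intro i
    apply iff_of_eq
    congr 1
    funext q
    cases q <;> simp [C]
  obtain ⟨a, ha⟩ := hsat (M : Set N) (Order.lt_succ _) (n * nx)
    (ULift.{max u v w} {b' // P b'}) (fun _ => ny + np) (fun _ => Φ) (fun b' => C b'.down.1)
    (by
      intro i j
      simp only [C]
      rcases finSumFinEquiv.symm j with l | l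
      · exact (i.down.1 l).2
      · exact (mp l).2)
    (by
      intro s
      obtain ⟨as, has⟩ := hcon (s.image fun b' => b'.down.1) (by
        intro y hy
        obtain ⟨b', _, rfl⟩ := Finset.mem_image.1 hy
        exact b'.down.2)
      refine ⟨fun q => as (finProdFinEquiv.symm q).1 (finProdFinEquiv.symm q).2, ?_⟩
      intro i hi
      rw [hΦ]
      obtain ⟨l, hl⟩ := has _ (Finset.mem_image_of_mem _ hi)
      exact ⟨l, by simpa using hl⟩)
  obtain ⟨b', hb', hav⟩ := h (fun i k => a (finProdFinEquiv (i, k)))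
  obtain ⟨i, hi⟩ := (hΦ a b').1 (ha ⟨⟨b', hb'⟩⟩)
  exact hav i hi

end Helpers

/-- Proposition 2.2 of the paper. Let `M ⪯ N` be models of a complete NIP
theory with `N` sufficiently saturated (`|M|⁺`-saturated). Let `φ(x, y)` be an `L`-formula
with parameters `mp` from `M` and let `b` be a tuple from `N`. If `φ(x, b)` does not divide
over `M`, then there are an `L`-formula `ψ(y)` with parameters `mp'` from `M`, satisfied by
`b`, and a finite set `{as 0, ..., as (j-1)}` of `|x|`-tuples from `N` such that every tuple
`b'` from `M` satisfying `ψ` satisfies `φ(as i, b')` for some `i`. -/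
theorem statement2 {L : FirstOrder.Language.{u, v}} {N : Type w} [L.Structure N]
    (M : L.ElementarySubstructure N) (hNIP : IsNIP L N)
    (hsat : IsSaturated L (Order.succ (Cardinal.mk M)) N)
    (nx ny np : ℕ) (φ : L.Formula (Fin nx ⊕ (Fin ny ⊕ Fin np))) (mp : Fin np → M)
    (b : Fin ny → N)
    (hndiv : ¬ Divides L (M : Set N) φ (Sum.elim b fun i => ((mp i : N)))) :
    ∃ (np' : ℕ) (ψ : L.Formula (Fin ny ⊕ Fin np')) (mp' : Fin np' → M)
      (j : ℕ) (as : Fin j → Fin nx → N),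
      ψ.Realize (Sum.elim b fun i => ((mp' i : N))) ∧
      ∀ b' : Fin ny → M, ψ.Realize (Sum.elim b' mp') →
        ∃ i, φ.Realize (Sum.elim (as i) (Sum.elim (fun l => ((b' l : N))) fun l => ((mp l : N)))) := by
  classical
  obtain ⟨a0, ha0⟩ := consistent_of_not_divides _ φ _ hndiv
  rcases isEmpty_or_nonempty N with hN | hN
  · refine ⟨0, ⊤, Fin.elim0, 1, fun _ => a0, by simp, fun b' _ => ⟨0, ?_⟩⟩
    have : (fun l => (b' l : N)) = b := funext fun l => isEmptyElim (b l)
    rw [this]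
    exact ha0
  by_contra hcon
  push Not at hcon
  let bm : (Fin ny → M) → (Fin ny ⊕ Fin np) → N := fun b' =>
    Sum.elim (fun l => (b' l : N)) fun l => (mp l : N)
  let bb : (Fin ny ⊕ Fin np) → N := Sum.elim b fun l => (mp l : N)
  -- negation of the conclusion for formulas with arbitrary parameters in `M`
  have hneg : ∀ θ : L.Formula ((Fin ny ⊕ Fin np) ⊕ M),
      θ.Realize (Sum.elim bb fun x => (x : N)) →
      ∀ (n : ℕ) (as : Fin n → Fin nx → N), ∃ b' : Fin ny → M,
        θ.Realize (Sum.elim (bm b') fun x => (x : N)) ∧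
        ∀ i, ¬ φ.Realize (Sum.elim (as i) (bm b')) := by
    intro θ hθ n as
    obtain ⟨p, ψ, f, hψ⟩ := exists_finite_params
      (θ.relabel (Sum.elim (Sum.map id mp) Sum.inr) : L.Formula (Fin ny ⊕ M))
    have hr : ∀ y : Fin ny → N, ψ.Realize (Sum.elim y fun i => (f i : N)) ↔
        θ.Realize (Sum.elim (Sum.elim y fun l => (mp l : N)) fun x => (x : N)) := by
      intro y
      have h1 := hψ N y (fun x => (x : N))
      rw [Formula.realize_relabel] at h1
      refine h1.trans (iff_of_eq ?_)
      congr 1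
      funext q
      rcases q with (q | q) | q <;> rfl
    obtain ⟨b', hb', hav⟩ := hcon p ψ f n as ((hr b).2 hθ)
    refine ⟨b', ?_, hav⟩
    rw [← M.subtype.map_formula] at hb'
    refine (hr _).1 ?_
    convert! hb' using 1
    funext q
    cases q <;> rfl
  let ex : L.Formula ((Fin ny ⊕ Fin np) ⊕ M) :=
    Formula.iExs (Fin nx) (φ.relabel (Sum.elim Sum.inr (Sum.inl ∘ Sum.inl)))
  have hex : ∀ y : (Fin ny ⊕ Fin np) → N, ex.Realize (Sum.elim y fun x => (x : N)) ↔
      ∃ a : Fin nx → N, φ.Realize (Sum.elim a y) := by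
    intro y
    simp only [ex, Formula.realize_iExs, Formula.realize_relabel]
    apply exists_congr
    intro a
    apply iff_of_eq
    congr 1
    funext q
    cases q <;> rfl
  -- long sequences in `M` all of whose consistent patterns are exactly realized
  have hseq : ∀ θ : L.Formula ((Fin ny ⊕ Fin np) ⊕ M),
      θ.Realize (Sum.elim bb fun x => (x : N)) → ∀ m : ℕ,
      ∃ y : Fin m → (Fin ny ⊕ Fin np) → N,
        (∀ i, θ.Realize (Sum.elim (y i) fun x => (x : N))) ∧
        ∀ K : Finset (Fin m), (∃ a, ∀ i ∈ K, φ.Realize (Sum.elim a (y i))) →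
          ∃ a, (∀ i ∈ K, φ.Realize (Sum.elim a (y i))) ∧
            ∀ i ∉ K, ¬ φ.Realize (Sum.elim a (y i)) := by
    intro θ hθ m
    obtain ⟨y, hy, hK⟩ := combi (fun (a : Fin nx → N) (b' : Fin ny → M) =>
        φ.Realize (Sum.elim a (bm b')))
      (fun b' => (θ ⊓ ex).Realize (Sum.elim (bm b') fun x => (x : N)))
      (fun b' hb' => (hex _).1 (Formula.realize_inf.1 hb').2)
      (fun n => exists_finite_avoiding M hsat φ mp _ n
        (hneg (θ ⊓ ex) (Formula.realize_inf.2 ⟨hθ, (hex _).2 ⟨a0, ha0⟩⟩) n)) m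
    exact ⟨fun i => bm (y i), fun i => (Formula.realize_inf.1 (hy i)).1, hK⟩
  let Θ : (m : ℕ) → Finset (Fin m) → L.Formula (Fin m × (Fin ny ⊕ Fin np)) := fun m K =>
    (traceFormula φ m K ∅).imp (traceFormula φ m K Kᶜ)
  -- first elementary extension: an infinite such sequence in `tp(b/M)`
  let Γ : Set (L.Formula ((ℕ × (Fin ny ⊕ Fin np)) ⊕ N)) :=
    {θ' | (∃ (i : ℕ) (θ : L.Formula ((Fin ny ⊕ Fin np) ⊕ M)),
        θ.Realize (Sum.elim bb fun x => (x : N)) ∧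
        θ' = θ.relabel (Sum.map (Prod.mk i) fun x : M => (x : N))) ∨
      ∃ (m : ℕ) (K : Finset (Fin m)),
        θ' = (Θ m K).relabel (fun q => Sum.inl ((q.1 : ℕ), q.2))}
  let ev : (m : ℕ) → (Fin m → (Fin ny ⊕ Fin np) → N) → ℕ × (Fin ny ⊕ Fin np) → N :=
    fun m y q => if h : q.1 < m then y ⟨q.1, h⟩ q.2 else bb q.2
  have hfin : ∀ s : Finset (L.Formula ((ℕ × (Fin ny ⊕ Fin np)) ⊕ N)), (∀ θ ∈ s, θ ∈ Γ) →
      ∃ θ : L.Formula ((Fin ny ⊕ Fin np) ⊕ M), θ.Realize (Sum.elim bb fun x => (x : N)) ∧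
        ∃ m0 : ℕ, ∀ m, m0 ≤ m → ∀ y : Fin m → (Fin ny ⊕ Fin np) → N,
          (∀ i, θ.Realize (Sum.elim (y i) fun x => (x : N))) →
          (∀ K : Finset (Fin m), (∃ a, ∀ i ∈ K, φ.Realize (Sum.elim a (y i))) →
            ∃ a, (∀ i ∈ K, φ.Realize (Sum.elim a (y i))) ∧
              ∀ i ∉ K, ¬ φ.Realize (Sum.elim a (y i))) →
          ∀ θ' ∈ s, θ'.Realize (Sum.elim (ev m y) id) := by
    intro s
    induction s using Finset.induction_on with
    | empty => intro _; exact ⟨⊤, by simp, 0, by simp⟩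
    | insert θ0 s hn ih =>
      intro hs
      obtain ⟨θ, hθ, m0, h⟩ := ih fun θ hθ => hs θ (Finset.mem_insert_of_mem hθ)
      rcases hs θ0 (Finset.mem_insert_self _ _) with ⟨i, θ1, hθ1, rfl⟩ | ⟨m1, K, rfl⟩
      · refine ⟨θ ⊓ θ1, Formula.realize_inf.2 ⟨hθ, hθ1⟩, m0, fun m hm y hy hK θ' hθ' => ?_⟩
        rcases Finset.mem_insert.1 hθ' with rfl | hθ'
        · rw [Formula.realize_relabel]
          by_cases hi : i < m
          · have := (Formula.realize_inf.1 (hy ⟨i, hi⟩)).2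
            convert! this using 1
            funext q
            cases q <;> simp [ev, hi]
          · convert! hθ1 using 1
            funext q
            cases q <;> simp [ev, hi]
        · exact h m hm y (fun i => (Formula.realize_inf.1 (hy i)).1) hK θ' hθ'
      · refine ⟨θ, hθ, max m0 m1, fun m hm y hy hK θ' hθ' => ?_⟩
        rcases Finset.mem_insert.1 hθ' with rfl | hθ'
        · have hm1 : m1 ≤ m := (le_max_right _ _).trans hm
          rw [Formula.realize_relabel, Formula.realize_imp, realize_traceFormula,
            realize_traceFormula]
          have e : ∀ i : Fin m1, (fun g => (Sum.elim (ev m y) id ∘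
              fun q : Fin m1 × (Fin ny ⊕ Fin np) => Sum.inl ((q.1 : ℕ), q.2)) (i, g)) =
              y (Fin.castLE hm1 i) := by
            intro i
            funext g
            have : (i : ℕ) < m := i.2.trans_le hm1
            simp [ev, this]
            rfl
          simp only [e]
          rintro ⟨a, ha, -⟩
          obtain ⟨a', ha', hna'⟩ := hK (K.image (Fin.castLE hm1)) ⟨a, by
            intro i hi
            obtain ⟨j, hj, rfl⟩ := Finset.mem_image.1 hi
            exact ha j hj⟩
          refine ⟨a', fun i hi => ha' _ (Finset.mem_image_of_mem _ hi), fun i hi => hna' _ ?_⟩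
          intro hmem
          obtain ⟨j, hj, hji⟩ := Finset.mem_image.1 hmem
          rw [Fin.castLE_inj] at hji
          subst hji
          exact (Finset.mem_compl.1 hi) hj
        · exact h m ((le_max_left _ _).trans hm) y hy hK θ' hθ'
  obtain ⟨E1, d, hd⟩ := exists_ultrapower Γ (by
    intro s hs
    obtain ⟨θ, hθ, m0, h⟩ := hfin s hs
    obtain ⟨y, hy, hK⟩ := hseq θ hθ m0
    exact ⟨ev m0 y, h m0 le_rfl y hy hK⟩)
  have hd1 : ∀ (i : ℕ) (θ : L.Formula ((Fin ny ⊕ Fin np) ⊕ M)),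
      θ.Realize (Sum.elim bb fun x => (x : N)) →
      θ.Realize (Sum.elim (fun g => d (i, g)) fun x => E1.emb (x : N)) := by
    intro i θ hθ
    have := hd _ (Or.inl ⟨i, θ, hθ, rfl⟩)
    rw [Formula.realize_relabel] at this
    convert! this using 1
    funext q
    cases q <;> rfl
  have hd2 : ∀ (m : ℕ) (K : Finset (Fin m)),
      (∃ a : Fin nx → E1.Carrier, ∀ i ∈ K, φ.Realize (Sum.elim a fun g => d ((i : ℕ), g))) →
      ∃ a : Fin nx → E1.Carrier, (∀ i ∈ K, φ.Realize (Sum.elim a fun g => d ((i : ℕ), g))) ∧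
        ∀ i ∉ K, ¬ φ.Realize (Sum.elim a fun g => d ((i : ℕ), g)) := by
    intro m K ⟨a, ha⟩
    have := hd _ (Or.inr ⟨m, K, rfl⟩)
    rw [Formula.realize_relabel, Formula.realize_imp, realize_traceFormula,
            realize_traceFormula] at this
    obtain ⟨a', h1, h2⟩ := this ⟨a, ha, by simp⟩
    exact ⟨a', h1, fun i hi => h2 i (Finset.mem_compl.2 hi)⟩
  -- second elementary extension: an indiscernible such sequence
  have hE1 : Nonempty E1.Carrier := ⟨E1.emb (Classical.arbitrary _)⟩
  obtain ⟨E2, c, hind, hc⟩ := extract (L := L) (fun i g => d (i, g))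
  let E : ElemExt L N := ⟨E2.Carrier, E2.emb.comp E1.emb⟩
  have hemb : ∀ x, E.emb x = E2.emb (E1.emb x) := fun x => rfl
  have hE : Nonempty E.Carrier := ⟨E.emb (Classical.arbitrary _)⟩
  have hctype : ∀ θ : L.Formula ((Fin ny ⊕ Fin np) ⊕ M),
      θ.Realize (Sum.elim bb fun x => (x : N)) →
      θ.Realize (Sum.elim (c 0) fun x => E.emb (x : N)) := by
    intro θ hθ
    have := hc 1 (θ.relabel (Sum.map (Prod.mk 0) fun x : M => E1.emb (x : N))) (by
      intro v hv
      rw [Formula.realize_relabel]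
      convert! hd1 (v 0) θ hθ using 1
      funext q
      cases q <;> rfl) (fun _ => 0) (fun a b hab => absurd hab (by
        rw [Subsingleton.elim a b]; exact lt_irrefl _))
    rw [Formula.realize_relabel] at this
    convert! this using 1
    funext q
    cases q <;> rfl
  have hcons : IsConsistentFamily L φ c := by
    by_contra hnc
    apply hndiv
    refine ⟨E, c, ?_, ?_, hnc⟩
    · intro m i j hi hj p θ mm hmm
      refine hind m i j hi hj p θ mm fun k => ?_
      obtain ⟨x, _, hx⟩ := hmm k
      exact ⟨E1.emb x, hx⟩
    · intro p θ mm hmm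
      choose e he he' using hmm
      let θ1 : L.Formula ((Fin ny ⊕ Fin np) ⊕ M) :=
        θ.relabel (Sum.map id fun k => (⟨e k, he k⟩ : M))
      have h1 : θ1.Realize (Sum.elim (c 0) fun x => E.emb (x : N)) ↔
          θ.Realize (Sum.elim (c 0) mm) := by
        rw [Formula.realize_relabel]
        apply iff_of_eq
        congr 1
        funext q
        rcases q with q | q
        · rfl
        · exact he' q
      have h2 : θ1.Realize (Sum.elim bb fun x => (x : N)) ↔
          θ.Realize (Sum.elim (E.emb ∘ bb) mm) := by
        rw [← E.emb.map_formula, Formula.realize_relabel]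
        apply iff_of_eq
        congr 1
        funext q
        rcases q with q | q
        · rfl
        · exact he' q
      refine Iff.trans ?_ h2
      rw [← h1]
      refine ⟨fun h => ?_, hctype θ1⟩
      by_contra hn
      have := hctype θ1.not (Formula.realize_not.2 hn)
      exact Formula.realize_not.1 this h
  -- all patterns are realized along the indiscernible sequence, contradicting NIP
  refine nip_contra hNIP E φ c fun m K => ?_
  have := hc m ((Θ m K).relabel Sum.inl) (by
    intro v hv
    rw [Formula.realize_relabel, Formula.realize_imp, realize_traceFormula,
            realize_traceFormula]
    rintro ⟨a, ha, -⟩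
    obtain ⟨m', hm'⟩ : ∃ m', ∀ i, v i < m' :=
      ⟨Finset.univ.sup v + 1, fun i => Nat.lt_succ_of_le (Finset.le_sup (Finset.mem_univ i))⟩
    obtain ⟨a', ha', hna'⟩ := hd2 m' (K.image fun i => ⟨v i, hm' i⟩) ⟨a, by
      intro i hi
      obtain ⟨j, hj, rfl⟩ := Finset.mem_image.1 hi
      exact ha j hj⟩
    refine ⟨a', fun i hi => ha' ⟨v i, hm' i⟩ (Finset.mem_image_of_mem _ hi),
      fun i hi => hna' ⟨v i, hm' i⟩ ?_⟩
    intro hmem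
    obtain ⟨j, hj, hji⟩ := Finset.mem_image.1 hmem
    have : j = i := hv.injective (by simpa using hji)
    subst this
    exact (Finset.mem_compl.1 hi) hj) (fun i => i) (fun a b hab => hab)
  rw [Formula.realize_relabel, Formula.realize_imp, realize_traceFormula,
            realize_traceFormula] at this
  obtain ⟨a, ha⟩ := hcons (Finset.range m)
  obtain ⟨a', h1, h2⟩ := this ⟨a, fun i _ => ha i (Finset.mem_range.2 i.2), by simp⟩
  exact ⟨a', h1, fun i hi => h2 i (Finset.mem_compl.2 hi)⟩

end DistalPaper
end

section
/- Let N be a distal L-structure. Then for every L-formula φ(x,y) with parameters from N there exist an L-formula θ(x,z) with parameters from N and a natural number k with |z| = k·|y| such that: for all sets B, C of |y|-tuples from N and every |x|-tuple a from N, if |C| ≥ 2, B ⊆ C, B is finite, and N ⊨ φ(a,b) for all b ∈ B, then there is some c ∈ C^k (a concatenation of k tuples from C) such that N ⊨ θ(a,c) and for all b ∈ B, N ⊨ ∀x (θ(x,c) → φ(x,b)). -/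
open FirstOrder FirstOrder.Language

universe u v w

namespace DistalPaper

variable (L : FirstOrder.Language.{u, v})

/-- Finite minimax (approximate form), via Hahn-Banach. -/
theorem minimax_approx {F X : Type*} [Fintype F] [Fintype X] [Nonempty F] [Nonempty X]
    (A : F → X → ℝ) (v v' : ℝ) (hv : v' < v)
    (H : ∀ w : X → ℝ, (∀ x, 0 ≤ w x) → ∑ x, w x = 1 → ∃ c, v ≤ ∑ x, w x * A c x) :
    ∃ ν : F → ℝ, (∀ c, 0 ≤ ν c) ∧ ∑ c, ν c = 1 ∧ ∀ x, v' ≤ ∑ c, ν c * A c x := by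
  classical
  by_contra hcon
  push Not at hcon
  let O : Set (X → ℝ) := {u | ∃ ν : F → ℝ, (∀ c, 0 ≤ ν c) ∧ ∑ c, ν c = 1 ∧
    ∀ x, u x < ∑ c, ν c * A c x}
  have hO : IsOpen O := by
    have : O = ⋃ ν ∈ {ν : F → ℝ | (∀ c, 0 ≤ ν c) ∧ ∑ c, ν c = 1},
        ⋂ x, {u : X → ℝ | u x < ∑ c, ν c * A c x} := by
      ext u
      simp only [O, Set.mem_ofPred_eq, Set.mem_iUnion, Set.mem_iInter, exists_prop]
      constructor
      · rintro ⟨ν, h1, h2, h3⟩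
        exact ⟨ν, ⟨h1, h2⟩, h3⟩
      · rintro ⟨ν, ⟨h1, h2⟩, h3⟩
        exact ⟨ν, h1, h2, h3⟩
    rw [this]
    refine isOpen_biUnion fun ν _ => isOpen_iInter_of_finite fun x => ?_
    exact isOpen_lt (continuous_apply x) continuous_const
  have hC : Convex ℝ O := by
    rintro u ⟨ν, h1, h2, h3⟩ u' ⟨ν', h1', h2', h3'⟩ a b ha hb hab
    refine ⟨fun c => a * ν c + b * ν' c, fun c => ?_, ?_, fun x => ?_⟩
    · have := h1 c; have := h1' c; positivity
    · rw [Finset.sum_add_distrib, ← Finset.mul_sum, ← Finset.mul_sum, h2, h2']; simpa using hab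
    · have e : ∑ c, (a * ν c + b * ν' c) * A c x
          = a * ∑ c, ν c * A c x + b * ∑ c, ν' c * A c x := by
        rw [Finset.mul_sum, Finset.mul_sum, ← Finset.sum_add_distrib]
        exact Finset.sum_congr rfl fun c _ => by ring
      rw [e]
      simp only [Pi.add_apply, Pi.smul_apply, smul_eq_mul]
      have k1 := h3 x
      have k2 := h3' x
      rcases eq_or_lt_of_le ha with h0 | h0
      · subst h0
        have : b = 1 := by linarith
        subst this; simpa using k2
      · have := mul_lt_mul_of_pos_left k1 h0
        have := mul_le_mul_of_nonneg_left k2.le hb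
        linarith
  have hnot : (fun _ => v' : X → ℝ) ∉ O := by
    rintro ⟨ν, h1, h2, h3⟩
    obtain ⟨x, hx⟩ := hcon ν h1 h2
    exact absurd (h3 x) (not_lt.mpr hx.le)
  obtain ⟨f, hf⟩ := geometric_hahn_banach_open_point hC hO hnot
  have hrow : ∀ (c : F) (δ : ℝ), 0 < δ → ∀ u : X → ℝ, (∀ x, u x ≤ A c x - δ) → u ∈ O := by
    intro c δ hδ u hu
    refine ⟨fun c' => if c' = c then 1 else 0, fun c' => by dsimp only; split_ifs <;> norm_num, by simp, ?_⟩
    intro x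
    simp only [ite_mul, one_mul, zero_mul, Finset.sum_ite_eq', Finset.mem_univ, if_true]
    linarith [hu x]
  let e : X → X → ℝ := fun x => Pi.single x 1
  have hexp : ∀ u : X → ℝ, f u = ∑ x, u x * f (e x) := by
    intro u
    conv_lhs => rw [pi_eq_sum_univ' u]
    rw [map_sum]
    refine Finset.sum_congr rfl fun x _ => ?_
    rw [map_smul, smul_eq_mul]
  obtain ⟨c0⟩ := ‹Nonempty F›
  have hpos : ∀ x, 0 ≤ f (e x) := by
    intro x
    by_contra hneg
    push Not at hneg
    set u0 : X → ℝ := fun y => A c0 y - 1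
    obtain ⟨n, hn⟩ := exists_nat_gt ((f (fun _ => v') - f u0) / (- f (e x)))
    have hmem : u0 - (n : ℝ) • e x ∈ O := by
      refine hrow c0 1 one_pos _ fun y => ?_
      simp only [Pi.sub_apply, Pi.smul_apply, smul_eq_mul, u0]
      have : 0 ≤ (n : ℝ) * e x y := by
        refine mul_nonneg (Nat.cast_nonneg _) ?_
        simp only [e, Pi.single_apply]; split_ifs <;> norm_num
      linarith
    have := hf _ hmem
    rw [map_sub, map_smul, smul_eq_mul] at this
    rw [div_lt_iff₀ (by linarith)] at hn
    linarith
  set s := ∑ x, f (e x) with hs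
  have hs0 : 0 ≤ s := Finset.sum_nonneg fun x _ => hpos x
  have hfv : ∀ t : ℝ, f (fun _ => t) = t * s := by
    intro t
    rw [hexp, hs, Finset.mul_sum]
  have hspos : 0 < s := by
    rcases eq_or_lt_of_le hs0 with h | h
    · exfalso
      have hz : ∀ x, f (e x) = 0 := by
        intro x
        exact (Finset.sum_eq_zero_iff_of_nonneg (fun x _ => hpos x)).1 (hs.symm.trans h.symm) x
          (Finset.mem_univ x)
      have := hf _ (hrow c0 1 one_pos (fun x => A c0 x - 1) fun x => le_rfl)
      rw [hexp, hexp] at this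
      simp [hz] at this
    · exact h
  obtain ⟨c, hc⟩ := H (fun x => f (e x) / s) (fun x => div_nonneg (hpos x) hs0)
    (by rw [← Finset.sum_div, ← hs, div_self hspos.ne'])
  have h1 := hf _ (hrow c (v - v') (by linarith) (fun x => A c x - (v - v')) fun x => le_rfl)
  have h2 : f (fun x => A c x - (v - v')) = f (A c) - (v - v') * s := by
    rw [← hfv, ← map_sub]; rfl
  rw [h2, hfv] at h1
  have h3 : v * s ≤ f (A c) := by
    rw [hexp]
    have : ∑ x, f (e x) / s * A c x = (∑ x, A c x * f (e x)) / s := by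
      rw [Finset.sum_div]; exact Finset.sum_congr rfl fun x _ => by ring
    rw [this, le_div_iff₀ hspos] at hc
    exact hc
  nlinarith

/-- The family `S` shatters a `d`-tuple of points. -/
def ShatTuple {X ι : Type*} (S : ι → Set X) (d : ℕ) : Prop :=
  ∃ x : Fin d → X, ∀ T : Set (Fin d), ∃ i, ∀ j, x j ∈ S i ↔ j ∈ T

theorem sauer_trace {X ι : Type*} (S : ι → Set X) (d : ℕ) (hd : ¬ ShatTuple S d)
    {P : Type*} [Fintype P] [DecidableEq P] (z : P → X) (𝒜 : Finset (Finset P))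
    (h𝒜 : ∀ T ∈ 𝒜, ∃ i, ∀ p, p ∈ T ↔ z p ∈ S i) :
    𝒜.card ≤ (d + 1) * (Fintype.card P + 1) ^ d := by
  classical
  have hvc : 𝒜.vcDim ≤ d := by
    unfold Finset.vcDim
    refine Finset.sup_le fun s hs => ?_
    rw [Finset.mem_shatterer] at hs
    by_contra hlt
    push Not at hlt
    obtain ⟨s', hs', hcard⟩ := Finset.exists_subset_card_eq hlt.le
    have hs2 := hs.mono_right hs'
    apply hd
    let e : Fin d ≃ s' := (Fintype.equivFinOfCardEq (by simpa using hcard)).symm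
    refine ⟨fun j => z (e j), fun T => ?_⟩
    obtain ⟨u, hu, hut⟩ := hs2 (t := s'.filter fun p => ∃ j ∈ T, (e j : P) = p)
      (Finset.filter_subset _ _)
    obtain ⟨i, hi⟩ := h𝒜 u hu
    refine ⟨i, fun j => ?_⟩
    rw [← hi]
    have h1 : (e j : P) ∈ u ↔ (e j : P) ∈ s' ∩ u := by
      simp
    rw [h1, hut]
    simp only [Finset.mem_filter, Finset.coe_mem, true_and]
    constructor
    · rintro ⟨j', hj', he⟩
      have : j' = j := e.injective (Subtype.ext he)
      exact this ▸ hj'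
    · intro h
      exact ⟨j, h, rfl⟩
  refine (Finset.card_le_card_shatterer 𝒜).trans (Finset.card_shatterer_le_sum_vcDim.trans ?_)
  refine (Finset.sum_le_sum_of_subset (Finset.Iic_subset_Iic.2 hvc)).trans ?_
  have : ∀ k ∈ Finset.Iic d, (Fintype.card P).choose k ≤ (Fintype.card P + 1) ^ d := by
    intro k hk
    rw [Finset.mem_Iic] at hk
    calc (Fintype.card P).choose k ≤ (Fintype.card P) ^ k := Nat.choose_le_pow _ _
      _ ≤ (Fintype.card P + 1) ^ k := Nat.pow_le_pow_left (Nat.le_succ _) _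
      _ ≤ _ := Nat.pow_le_pow_right (Nat.succ_pos _) hk
  refine (Finset.sum_le_card_nsmul _ _ _ this).trans ?_
  simp

/-- Swap counting for one trace. -/
theorem swap_count (m t : ℕ) (T : Finset (Fin m × Bool)) :
    2 ^ t * (Finset.univ.filter fun σ : Fin m → Bool =>
      (∀ j, (j, σ j) ∉ T) ∧ t ≤ (Finset.univ.filter fun j => (j, !σ j) ∈ T).card).card ≤ 2 ^ m := by
  classical
  set Z := Finset.univ.filter fun σ : Fin m → Bool =>
      (∀ j, (j, σ j) ∉ T) ∧ t ≤ (Finset.univ.filter fun j => (j, !σ j) ∈ T).card with hZ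
  rcases Z.eq_empty_or_nonempty with h | ⟨σ0, h0⟩
  · rw [h]; simp
  · have h0' := (Finset.mem_filter.1 h0).2
    set Q := Finset.univ.filter fun j => (j, !σ0 j) ∈ T with hQ
    have hagree : ∀ σ ∈ Z, ∀ j ∈ Q, σ j = σ0 j := by
      intro σ hσ j hj
      have h1 := (Finset.mem_filter.1 hσ).2.1 j
      have h2 := (Finset.mem_filter.1 hj).2
      by_contra hne
      have : σ j = !σ0 j := by
        cases h3 : σ j <;> cases h4 : σ0 j <;> simp_all
      rw [this] at h1
      exact h1 h2
    have hinj : Z.card ≤ Fintype.card ({j // j ∉ Q} → Bool) := by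
      rw [← Finset.card_univ]
      refine Finset.card_le_card_of_injOn (fun σ j => σ j) (fun _ _ => Finset.mem_coe.2 (Finset.mem_univ _)) ?_
      intro σ hσ σ' hσ' he
      funext j
      by_cases hj : j ∈ Q
      · rw [hagree σ hσ j hj, hagree σ' hσ' j hj]
      · exact congrFun he ⟨j, hj⟩
    have hcard : Fintype.card ({j // j ∉ Q} → Bool) = 2 ^ (m - Q.card) := by
      rw [Fintype.card_fun, Fintype.card_bool, Fintype.card_subtype_compl]
      simp
    have hQm : Q.card ≤ m := by simpa using Finset.card_le_univ Q
    calc 2 ^ t * Z.card ≤ 2 ^ Q.card * 2 ^ (m - Q.card) :=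
          Nat.mul_le_mul (Nat.pow_le_pow_right (by norm_num) h0'.2) (hinj.trans hcard.le)
      _ = 2 ^ m := by rw [← pow_add, Nat.add_sub_cancel' hQm]

/-- Symmetrization upper bound. -/
theorem sym_upper {X ι : Type*} [Fintype X] (S : ι → Set X) (d : ℕ) (hd : ¬ ShatTuple S d)
    (w : X → ℝ) (hw : ∀ x, 0 ≤ w x) (hw1 : ∑ x, w x = 1) (m t : ℕ)
    (Bad : (Fin m → Bool → X) → Prop) [DecidablePred Bad]
    (hBad : ∀ z, Bad z → ∃ i, (∀ j, z j false ∉ S i) ∧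
      ∃ Q : Finset (Fin m), t ≤ Q.card ∧ ∀ j ∈ Q, z j true ∈ S i) :
    2 ^ t * ∑ z : Fin m → Bool → X, (if Bad z then ∏ j, ∏ b, w (z j b) else 0)
      ≤ (d + 1) * (2 * m + 1) ^ d := by
  classical
  set V : (Fin m → Bool → X) → ℝ := fun z => ∏ j, ∏ b, w (z j b) with hV
  have hVpos : ∀ z, 0 ≤ V z := fun z => Finset.prod_nonneg fun j _ => Finset.prod_nonneg fun b _ => hw _
  have hVsum : ∑ z, V z = 1 := by
    have h1 : ∑ u : Bool → X, ∏ b, w (u b) = 1 := by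
      have := Finset.prod_univ_sum (fun _ : Bool => (Finset.univ : Finset X)) (fun _ x => w x)
      simp only [hw1, Finset.prod_const_one, Fintype.piFinset_univ] at this
      exact this.symm
    have := Finset.prod_univ_sum (fun _ : Fin m => (Finset.univ : Finset (Bool → X)))
      (fun _ u => ∏ b, w (u b))
    simp only [h1, Finset.prod_const_one, Fintype.piFinset_univ] at this
    exact this.symm
  let sw : (Fin m → Bool) → (Fin m → Bool → X) ≃ (Fin m → Bool → X) := fun σ =>
    Function.Involutive.toPerm (fun z j b => z j (xor (σ j) b)) (by
      intro z; funext j b; simp)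
  have hsw : ∀ σ z, V (sw σ z) = V z := by
    intro σ z
    refine Finset.prod_congr rfl fun j _ => ?_
    change ∏ b, w (z j (xor (σ j) b)) = ∏ b, w (z j b)
    cases σ j
    · simp
    · simp [mul_comm]
  have hinv : ∀ σ, ∑ z, (if Bad z then V z else 0) = ∑ z, (if Bad (sw σ z) then V z else 0) := by
    intro σ
    rw [← Equiv.sum_comp (sw σ)]
    simp only [hsw]
  have hcount : ∀ z, (2 : ℝ) ^ t * ((Finset.univ.filter fun σ => Bad (sw σ z)).card : ℝ)
      ≤ ((d + 1) * (2 * m + 1) ^ d) * 2 ^ m := by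
    intro z
    let 𝒜 : Finset (Finset (Fin m × Bool)) := Finset.univ.filter fun T =>
      ∃ i, ∀ p, p ∈ T ↔ z p.1 p.2 ∈ S i
    have hA := sauer_trace S d hd (fun p : Fin m × Bool => z p.1 p.2) 𝒜
      (fun T hT => (Finset.mem_filter.1 hT).2)
    have hsub : (Finset.univ.filter fun σ => Bad (sw σ z)) ⊆ 𝒜.biUnion fun T =>
        Finset.univ.filter fun σ : Fin m → Bool =>
        (∀ j, (j, σ j) ∉ T) ∧ t ≤ (Finset.univ.filter fun j => (j, !σ j) ∈ T).card := by
      intro σ hσ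
      obtain ⟨i, h1, Q, hQ, h2⟩ := hBad _ (Finset.mem_filter.1 hσ).2
      rw [Finset.mem_biUnion]
      refine ⟨Finset.univ.filter fun p => z p.1 p.2 ∈ S i, ?_, ?_⟩
      · exact Finset.mem_filter.2 ⟨Finset.mem_univ _, i, fun p => by simp⟩
      · refine Finset.mem_filter.2 ⟨Finset.mem_univ _, fun j => ?_, hQ.trans ?_⟩
        · have : z j (xor (σ j) false) ∉ S i := h1 j
          simpa using this
        · refine Finset.card_le_card fun j hj => ?_
          have : z j (xor (σ j) true) ∈ S i := h2 j hj
          simpa using this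
    have hN : 2 ^ t * (Finset.univ.filter fun σ => Bad (sw σ z)).card
        ≤ ((d + 1) * (2 * m + 1) ^ d) * 2 ^ m := by
      calc _ ≤ 2 ^ t * ∑ T ∈ 𝒜, (Finset.univ.filter fun σ : Fin m → Bool =>
            (∀ j, (j, σ j) ∉ T) ∧ t ≤ (Finset.univ.filter fun j => (j, !σ j) ∈ T).card).card :=
            Nat.mul_le_mul_left _ ((Finset.card_le_card hsub).trans Finset.card_biUnion_le)
        _ ≤ 𝒜.card * 2 ^ m := by
            rw [Finset.mul_sum]
            exact (Finset.sum_le_card_nsmul _ _ _ fun T _ => swap_count m t T).trans (by simp)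
        _ ≤ _ := by
            refine Nat.mul_le_mul_right _ (hA.trans ?_)
            simp [mul_comm]
    exact_mod_cast hN
  have hmain : (2 : ℝ) ^ m * (2 ^ t * ∑ z, (if Bad z then V z else 0))
      ≤ 2 ^ m * ((d + 1) * (2 * m + 1) ^ d) := by
    calc (2 : ℝ) ^ m * (2 ^ t * ∑ z, (if Bad z then V z else 0))
        = 2 ^ t * ∑ σ : Fin m → Bool, ∑ z, (if Bad (sw σ z) then V z else 0) := by
          simp only [← hinv]
          simp; ring
      _ = ∑ z, V z * (2 ^ t * ((Finset.univ.filter fun σ => Bad (sw σ z)).card : ℝ)) := by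
          rw [Finset.sum_comm, Finset.mul_sum]
          refine Finset.sum_congr rfl fun z _ => ?_
          rw [← Finset.sum_filter, Finset.sum_const, nsmul_eq_mul]
          ring
      _ ≤ ∑ z, V z * (((d + 1) * (2 * m + 1) ^ d) * 2 ^ m) :=
          Finset.sum_le_sum fun z _ => mul_le_mul_of_nonneg_left (hcount z) (hVpos z)
      _ = _ := by rw [← Finset.sum_mul, hVsum]; ring
  exact le_of_mul_le_mul_left hmain (by positivity)

/-- Reverse Markov. -/
theorem rev_markov {X : Type*} [Fintype X] (w : X → ℝ) (hw : ∀ x, 0 ≤ w x) (hw1 : ∑ x, w x = 1)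
    (S : Set X) [DecidablePred (· ∈ S)] (ε : ℝ) (hS : ε ≤ ∑ x, if x ∈ S then w x else 0) (m t : ℕ) :
    ε * m - t ≤ m * ∑ y : Fin m → X,
      if t ≤ (Finset.univ.filter fun j => y j ∈ S).card then ∏ j, w (y j) else 0 := by
  classical
  have hsum : ∑ y : Fin m → X, ∏ j, w (y j) = 1 := by
    have := Finset.prod_univ_sum (fun _ : Fin m => (Finset.univ : Finset X)) (fun _ x => w x)
    simp only [hw1, Finset.prod_const_one, Fintype.piFinset_univ] at this
    exact this.symm
  have hone : ∀ j : Fin m, ∑ y : Fin m → X, (if y j ∈ S then ∏ k, w (y k) else 0)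
      = ∑ x, if x ∈ S then w x else 0 := by
    intro j
    have := Finset.prod_univ_sum (fun _ : Fin m => (Finset.univ : Finset X))
      (fun k x => if k = j then (if x ∈ S then w x else 0) else w x)
    rw [Fintype.piFinset_univ] at this
    have h2 : ∏ k : Fin m, ∑ x, (if k = j then (if x ∈ S then w x else 0) else w x)
        = ∑ x, if x ∈ S then w x else 0 := by
      rw [Finset.prod_eq_single j]
      · simp
      · intro k _ hk; simp [hk, hw1]
      · simp
    rw [h2] at this
    rw [this]
    refine Finset.sum_congr rfl fun y _ => ?_
    split_ifs with h
    · refine Finset.prod_congr rfl fun k _ => ?_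
      by_cases hk : k = j
      · subst hk; simp [h]
      · simp [hk]
    · symm
      exact Finset.prod_eq_zero (Finset.mem_univ j) (by simp [h])
  have hE : ε * m ≤ ∑ y : Fin m → X, ((Finset.univ.filter fun j => y j ∈ S).card : ℝ) * ∏ j, w (y j) := by
    calc ε * m ≤ ∑ j : Fin m, ∑ y : Fin m → X, (if y j ∈ S then ∏ k, w (y k) else 0) := by
          simp only [hone]
          simp only [Finset.sum_const, Finset.card_univ, Fintype.card_fin, nsmul_eq_mul]
          rw [mul_comm]
          exact mul_le_mul_of_nonneg_left hS (Nat.cast_nonneg _)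
      _ = _ := by
          rw [Finset.sum_comm]
          refine Finset.sum_congr rfl fun y _ => ?_
          rw [← Finset.sum_filter, Finset.sum_const, nsmul_eq_mul]
  have hU : ∑ y : Fin m → X, ((Finset.univ.filter fun j => y j ∈ S).card : ℝ) * ∏ j, w (y j)
      ≤ ∑ y : Fin m → X, (m * (if t ≤ (Finset.univ.filter fun j => y j ∈ S).card
          then ∏ j, w (y j) else 0) + t * ∏ j, w (y j)) := by
    refine Finset.sum_le_sum fun y _ => ?_
    have hp : 0 ≤ ∏ j, w (y j) := Finset.prod_nonneg fun j _ => hw _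
    split_ifs with h
    · have : ((Finset.univ.filter fun j => y j ∈ S).card : ℝ) ≤ m := by
        have := Finset.card_le_univ (Finset.univ.filter fun j => y j ∈ S)
        rw [Fintype.card_fin] at this
        exact_mod_cast this
      nlinarith [mul_le_mul_of_nonneg_right this hp, mul_nonneg (Nat.cast_nonneg (α := ℝ) t) hp]
    · have : ((Finset.univ.filter fun j => y j ∈ S).card : ℝ) ≤ t := by
        exact_mod_cast (not_le.1 h).le
      nlinarith [mul_le_mul_of_nonneg_right this hp]
  rw [Finset.sum_add_distrib, ← Finset.mul_sum, ← Finset.mul_sum, hsum] at hU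
  linarith

theorem num_choice (d : ℕ) (ε : ℝ) (hε : 0 < ε) : ∃ m t : ℕ, 0 < m ∧ (t : ℝ) ≤ ε / 2 * m ∧
    ((d : ℝ) + 1) * (2 * m + 1) ^ d < 2 ^ t * (ε / 2) := by
  obtain ⟨k, hk⟩ := exists_nat_gt (2 / ε)
  have hk0 : (0 : ℝ) < k := lt_trans (by positivity) hk
  have hlim := tendsto_pow_const_mul_const_pow_of_abs_lt_one d (r := (1 / 2 : ℝ)) (by norm_num [abs_of_pos])
  have hpos : 0 < (ε / 2) / ((d + 1) * (3 * k) ^ d) := by positivity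
  obtain ⟨t, ht, ht1⟩ := ((hlim.eventually (gt_mem_nhds hpos)).and (Filter.eventually_ge_atTop 1)).exists
  have ht1' : (1 : ℝ) ≤ t := by exact_mod_cast ht1
  have hk1 : (1 : ℝ) ≤ k := by
    have : 0 < k := by exact_mod_cast hk0
    exact_mod_cast this
  refine ⟨t * k, t, ?_, ?_, ?_⟩
  · have : 0 < k := by exact_mod_cast hk0
    positivity
  · push_cast
    rw [div_lt_iff₀ hε] at hk
    nlinarith
  · push_cast
    rw [lt_div_iff₀ (by positivity)] at ht
    have h1 : (2 * ((t : ℝ) * k) + 1) ^ d ≤ (3 * k * t) ^ d := by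
      refine pow_le_pow_left₀ (by positivity) ?_ d
      nlinarith
    have h2 : (2 : ℝ) ^ t * (1 / 2) ^ t = 1 := by rw [← mul_pow]; norm_num
    calc ((d : ℝ) + 1) * (2 * (t * k) + 1) ^ d ≤ (d + 1) * (3 * k * t) ^ d := by gcongr
      _ = 2 ^ t * ((t : ℝ) ^ d * (1 / 2) ^ t * ((d + 1) * (3 * k) ^ d)) := by
          rw [mul_pow (3 * (k : ℝ)) t d]
          calc _ = ((2 : ℝ) ^ t * (1 / 2) ^ t) * (((d : ℝ) + 1) * ((3 * k) ^ d * t ^ d)) := by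
                rw [h2, one_mul]
            _ = _ := by ring
      _ < _ := by gcongr

open Classical in
theorem exists_net (d : ℕ) (ε : ℝ) (hε : 0 < ε) : ∃ m : ℕ,
    ∀ (X : Type*) (ι : Type*) [Fintype X] (S : ι → Set X), ¬ ShatTuple S d →
    ∀ w : X → ℝ, (∀ x, 0 ≤ w x) → ∑ x, w x = 1 →
    ∃ x : Fin m → X, ∀ i, (ε ≤ ∑ y, if y ∈ S i then w y else 0) → ∃ j, x j ∈ S i := by
  obtain ⟨m, t, hm, hmt, hlt⟩ := num_choice d ε hε
  refine ⟨m, fun X ι _ S hd w hw hw1 => ?_⟩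
  by_contra hcon
  push Not at hcon
  choose c hc1 hc2 using hcon
  let Bad : (Fin m → Bool → X) → Prop := fun z =>
    t ≤ (Finset.univ.filter fun j => z j true ∈ S (c fun j => z j false)).card
  have hup := sym_upper S d hd w hw hw1 m t Bad (by
    intro z hz
    exact ⟨c fun j => z j false, fun j => hc2 (fun j => z j false) j, _, hz,
      fun j hj => (Finset.mem_filter.1 hj).2⟩)
  have hsum : ∑ y : Fin m → X, ∏ j, w (y j) = 1 := by
    have := Finset.prod_univ_sum (fun _ : Fin m => (Finset.univ : Finset X)) (fun _ x => w x)
    simp only [hw1, Finset.prod_const_one, Fintype.piFinset_univ] at this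
    exact this.symm
  let E : ((Fin m → X) × (Fin m → X)) ≃ (Fin m → Bool → X) :=
    { toFun := fun p j b => if b then p.2 j else p.1 j
      invFun := fun z => (fun j => z j false, fun j => z j true)
      left_inv := fun p => by simp
      right_inv := fun z => by funext j b; cases b <;> simp }
  have hlow : ε / 2 ≤ ∑ z : Fin m → Bool → X, (if Bad z then ∏ j, ∏ b, w (z j b) else 0) := by
    rw [← Equiv.sum_comp E, Fintype.sum_prod_type]
    have hx : ∀ x : Fin m → X, (∏ j, w (x j)) * (ε / 2) ≤ ∑ y : Fin m → X,
        (if Bad (E (x, y)) then ∏ j, ∏ b, w (E (x, y) j b) else 0) := by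
      intro x
      have h1 := rev_markov w hw hw1 (S (c x)) ε (hc1 x) m t
      have hm' : (0 : ℝ) < m := by exact_mod_cast hm
      have h2 : ε / 2 ≤ ∑ y : Fin m → X,
          if t ≤ (Finset.univ.filter fun j => y j ∈ S (c x)).card then ∏ j, w (y j) else 0 := by
        nlinarith
      have h3 : ∀ y : Fin m → X, (if Bad (E (x, y)) then ∏ j, ∏ b, w (E (x, y) j b) else 0)
          = (∏ j, w (x j)) * (if t ≤ (Finset.univ.filter fun j => y j ∈ S (c x)).card
              then ∏ j, w (y j) else 0) := by
        intro y
        have hb : Bad (E (x, y)) ↔ t ≤ (Finset.univ.filter fun j => y j ∈ S (c x)).card := by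
          simp [Bad, E]
        have hp : ∏ j, ∏ b, w (E (x, y) j b) = (∏ j, w (x j)) * ∏ j, w (y j) := by
          rw [← Finset.prod_mul_distrib]
          refine Finset.prod_congr rfl fun j _ => ?_
          simp [E, mul_comm]
        rw [hp]
        by_cases h : t ≤ (Finset.univ.filter fun j => y j ∈ S (c x)).card
        · rw [if_pos h, if_pos (hb.2 h)]
        · rw [if_neg h, if_neg (fun h' => h (hb.1 h')), mul_zero]
      simp only [h3]
      rw [← Finset.mul_sum]
      exact mul_le_mul_of_nonneg_left h2 (Finset.prod_nonneg fun j _ => hw _)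
    calc ε / 2 = ∑ x : Fin m → X, (∏ j, w (x j)) * (ε / 2) := by
          rw [← Finset.sum_mul, hsum, one_mul]
      _ ≤ _ := Finset.sum_le_sum fun x _ => hx x
  have : (2 : ℝ) ^ t * (ε / 2) ≤ (d + 1) * (2 * m + 1) ^ d := by
    refine le_trans ?_ hup
    gcongr
  linarith

theorem cover_lemma (d r : ℕ) : ∃ n : ℕ, ∀ e : ℕ, ∃ T : ℕ,
    ∀ (F X : Type*) [Finite F] [Finite X] [Nonempty F] [Nonempty X] (R : F → X → Prop),
    ¬ ShatTuple (fun c : Fin r → F => {x | ∃ j, R (c j) x}) d →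
    ¬ ShatTuple (fun x : X => {c | R c x}) e →
    (∀ x : Fin n → X, ∃ c : Fin r → F, ∀ i, ∃ j, R (c j) (x i)) →
    ∀ T' ≥ T, ∃ c : Fin T' → F, ∀ x, ∃ i, R (c i) x := by
  classical
  obtain ⟨n, hn⟩ := exists_net d (1 / 2) (by norm_num)
  refine ⟨n, fun e => ?_⟩
  obtain ⟨T, hT⟩ := exists_net e (1 / (4 * (r + 1))) (by positivity)
  refine ⟨T, fun F X _ _ _ _ R hd he hcov T' hT' => ?_⟩
  have := Fintype.ofFinite F
  have := Fintype.ofFinite X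
  have hd' : ¬ ShatTuple (fun c : Fin r → F => {x | ¬ ∃ j, R (c j) x}) d := by
    rintro ⟨x, hx⟩
    refine hd ⟨x, fun U => ?_⟩
    obtain ⟨i, hi⟩ := hx Uᶜ
    refine ⟨i, fun j => ?_⟩
    have := not_congr (hi j)
    simpa using this
  have hgame : ∀ w : X → ℝ, (∀ x, 0 ≤ w x) → ∑ x, w x = 1 →
      ∃ c, (1 / (2 * (r + 1)) : ℝ) ≤ ∑ x, w x * (if R c x then 1 else 0) := by
    intro w hw hw1
    obtain ⟨x, hx⟩ := hn X (Fin r → F) _ hd' w hw hw1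
    obtain ⟨c, hc⟩ := hcov x
    have h1 : ∑ y, (if ¬ ∃ j, R (c j) y then w y else 0) < 1 / 2 := by
      by_contra hge
      push Not at hge
      have hge' : (1 / 2 : ℝ) ≤ ∑ y, (if y ∈ {x | ¬ ∃ j, R (c j) x} then w y else 0) := by
        simpa using hge
      obtain ⟨i, hi⟩ := hx c (by convert hge')
      exact hi (hc i)
    have h2 : ∑ y, (if ¬ ∃ j, R (c j) y then w y else 0) + ∑ y, (if ∃ j, R (c j) y then w y else 0)
        = 1 := by
      rw [← Finset.sum_add_distrib, ← hw1]
      refine Finset.sum_congr rfl fun y _ => ?_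
      by_cases h : ∃ j, R (c j) y <;> simp [h]
    have h3 : ∑ y, (if ∃ j, R (c j) y then w y else 0)
        ≤ ∑ j, ∑ y, w y * (if R (c j) y then 1 else 0) := by
      rw [Finset.sum_comm]
      refine Finset.sum_le_sum fun y _ => ?_
      have hnn : ∀ j ∈ (Finset.univ : Finset (Fin r)), 0 ≤ w y * (if R (c j) y then (1 : ℝ) else 0) := by
        intro j _
        refine mul_nonneg (hw y) ?_
        split_ifs <;> norm_num
      split_ifs with h
      · obtain ⟨j, hj⟩ := h
        refine le_trans ?_ (Finset.single_le_sum hnn (Finset.mem_univ j))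
        simp [hj]
      · exact Finset.sum_nonneg hnn
    by_contra hno
    push Not at hno
    have h4 : ∑ j, ∑ y, w y * (if R (c j) y then 1 else 0)
        ≤ ∑ j : Fin r, (1 / (2 * (r + 1)) : ℝ) := Finset.sum_le_sum fun j _ => (hno (c j)).le
    have h5 : ∑ j : Fin r, (1 / (2 * (r + 1)) : ℝ) < 1 / 2 := by
      rw [Finset.sum_const, Finset.card_univ, Fintype.card_fin, nsmul_eq_mul, mul_one_div,
        div_lt_div_iff₀ (by positivity) (by norm_num)]
      linarith
    linarith
  obtain ⟨ν, hν, hν1, hνx⟩ := minimax_approx (fun (c : F) (x : X) => if R c x then (1 : ℝ) else 0)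
    (1 / (2 * (r + 1))) (1 / (4 * (r + 1)))
    (by apply one_div_lt_one_div_of_lt <;> [positivity; linarith [(Nat.cast_nonneg r : (0 : ℝ) ≤ r)] ])
    hgame
  obtain ⟨c, hc⟩ := hT F X _ he ν hν hν1
  refine ⟨fun i => if h : (i : ℕ) < T then c ⟨i, h⟩ else Classical.arbitrary F, fun x => ?_⟩
  obtain ⟨j, hj⟩ := hc x (by
    have := hνx x
    simp only [mul_ite, mul_one, mul_zero] at this
    convert this
    exact Iff.rfl)
  refine ⟨⟨j, lt_of_lt_of_le j.2 hT'⟩, ?_⟩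
  simpa using hj

section ModelPart

variable {L}

/-- Compactness, in the form of an ultrapower. -/
theorem compact_ext {N : Type w} [L.Structure N] [Nonempty N] {Γ : Type} {ι : Type max u v}
    (F : ι → L.Formula Γ)
    (H : ∀ s : Finset ι, ∃ x : Γ → N, ∀ i ∈ s, (F i).Realize x) :
    ∃ (E : ElemExt L N) (x : Γ → E.Carrier), ∀ i, (F i).Realize x := by
  classical
  choose x hx using H
  let U : Ultrafilter (Finset ι) := Ultrafilter.of Filter.atTop
  have hU : (U : Filter (Finset ι)) ≤ Filter.atTop := Ultrafilter.of_le _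
  let P : Type max u v w := (U : Filter (Finset ι)).Product fun _ => N
  let E : ElemExt L N :=
    { Carrier := P
      str := inferInstanceAs (L.Structure ((U : Filter (Finset ι)).Product fun _ => N))
      emb :=
        { toFun := fun n => ((fun _ => n : Finset ι → N) : (U : Filter (Finset ι)).Product fun _ => N)
          map_formula' := by
            intro n φ y
            have := Ultraproduct.realize_formula_cast (u := U) (M := fun _ : Finset ι => N) φ
              (fun i _ => y i)
            refine Iff.trans this ?_
            simp } }
  refine ⟨E, fun g => ((fun s => x s g : Finset ι → N) : (U : Filter (Finset ι)).Product fun _ => N),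
    fun i => ?_⟩
  refine (Ultraproduct.realize_formula_cast (u := U) (M := fun _ : Finset ι => N) (F i)
    (fun g s => x s g)).2 ?_
  have : ∀ᶠ s in (Filter.atTop : Filter (Finset ι)), ({i} : Finset ι) ≤ s := Filter.eventually_ge_atTop _
  filter_upwards [hU this] with s hs
  exact hx s i (hs (Finset.mem_singleton_self i))

theorem nip_bound {N : Type w} [L.Structure N] [Nonempty N] (hN : IsNIP L N)
    {α β : Type} [Finite α] [Finite β] (φ : L.Formula (α ⊕ β)) :
    ∃ d, ¬ ShatTuple (fun b : β → N => {a : α → N | φ.Realize (Sum.elim a b)}) d := by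
  classical
  obtain ⟨nx, ⟨ea⟩⟩ := Finite.exists_equiv_fin α
  obtain ⟨ny, ⟨eb⟩⟩ := Finite.exists_equiv_fin β
  by_contra hcon
  push Not at hcon
  let Γ : Type := (ℕ × α) ⊕ (Set ℕ × β)
  let G : ℕ → Set ℕ → L.Formula Γ := fun i S =>
    φ.relabel (Sum.elim (fun x => Sum.inl (i, x)) (fun y => Sum.inr (S, y)))
  have hG : ∀ (M : Type (max u v w)) [L.Structure M] (x : Γ → M) i S, (G i S).Realize x ↔
      φ.Realize (Sum.elim (fun a => x (Sum.inl (i, a))) (fun b => x (Sum.inr (S, b)))) := by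
    intro M _ x i S
    simp only [G, Formula.realize_relabel]
    rw [Sum.comp_elim]; rfl
  have hG' : ∀ (x : Γ → N) i S, (G i S).Realize x ↔
      φ.Realize (Sum.elim (fun a => x (Sum.inl (i, a))) (fun b => x (Sum.inr (S, b)))) := by
    intro x i S
    simp only [G, Formula.realize_relabel]
    rw [Sum.comp_elim]; rfl
  obtain ⟨E, x, hx⟩ := compact_ext (N := N) (ι := ULift.{max u v} (ℕ × Set ℕ))
    (fun p => if p.down.1 ∈ p.down.2 then G p.down.1 p.down.2 else (G p.down.1 p.down.2).not) (by
      intro s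
      obtain ⟨D, hD⟩ : ∃ D : ℕ, ∀ p ∈ s, p.down.1 < D := by
        refine ⟨s.sup (fun p => p.down.1) + 1, fun p hp => Nat.lt_succ_of_le ?_⟩
        exact Finset.le_sup (f := fun p : ULift.{max u v} (ℕ × Set ℕ) => p.down.1) hp
      obtain ⟨a, ha⟩ := hcon D
      choose b hb using ha
      refine ⟨Sum.elim (fun p => if h : p.1 < D then a ⟨p.1, h⟩ p.2 else Classical.arbitrary N)
        (fun p => b {j | (j : ℕ) ∈ p.1} p.2), fun p hp => ?_⟩
      have h1 := hD p hp
      have h2 := hb {j | (j : ℕ) ∈ p.down.2} ⟨p.down.1, h1⟩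
      have h3 : (G p.down.1 p.down.2).Realize (Sum.elim
          (fun p : ℕ × α => if h : p.1 < D then a ⟨p.1, h⟩ p.2 else Classical.arbitrary N)
          (fun p : Set ℕ × β => b {j | (j : ℕ) ∈ p.1} p.2)) ↔ p.down.1 ∈ p.down.2 := by
        rw [hG']
        simp only [Sum.elim_inl, Sum.elim_inr, h1, dif_pos]
        exact h2
      split_ifs with h
      · exact h3.2 h
      · rw [Formula.realize_not, h3]; exact h)
  have : Nonempty E.Carrier := (inferInstance : Nonempty N).map E.emb
  have hmod : E.Carrier ⊨ L.completeTheory N := by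
    have := E.emb.elementarilyEquivalent
    rw [Theory.model_iff]
    intro ψ hψ
    exact (this.realize_sentence ψ).1 hψ
  refine hN nx ny (φ.relabel (Sum.map ea eb))
    ⟨Theory.ModelType.of (L.completeTheory N) E.Carrier,
      fun i q => x (Sum.inl (i, ea.symm q)), fun S q => x (Sum.inr (S, eb.symm q)), fun i S => ?_⟩
  have h := hx ⟨(i, S)⟩
  simp only at h
  rw [Formula.realize_relabel]
  have e : (Sum.elim (fun q => x (Sum.inl (i, ea.symm q))) (fun q => x (Sum.inr (S, eb.symm q))))
      ∘ Sum.map ea eb = Sum.elim (fun a => x (Sum.inl (i, a))) (fun b => x (Sum.inr (S, b))) := by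
    funext q; cases q <;> simp
  refine Iff.trans (iff_of_eq (congrArg φ.Realize e)) ?_
  refine Iff.trans (hG E.Carrier x i S).symm ?_
  split_ifs at h with h'
  · exact iff_of_true h h'
  · exact iff_of_false h h'

end ModelPart
section PowPart

variable {Y : Type*}

def ncons (b : Y) (s : ℕ → Y) : ℕ → Y
  | 0 => b
  | k + 1 => s k

def napp (n : ℕ) (s t : ℕ → Y) : ℕ → Y := fun k => if k < n then s k else t (k - n)

theorem napp_succ (n : ℕ) (b : Y) (s t : ℕ → Y) :
    napp (n + 1) (ncons b s) t = ncons b (napp n s t) := by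
  funext k
  cases k with
  | zero => simp [napp, ncons]
  | succ k => simp [napp, ncons]

variable [Nonempty Y]

noncomputable def upow (U : Ultrafilter Y) : ℕ → Ultrafilter (ℕ → Y)
  | 0 => pure (fun _ => Classical.arbitrary Y)
  | n + 1 => U.bind (fun b => (upow U n).map (ncons b))

theorem upow_succ (U : Ultrafilter Y) (n : ℕ) (P : (ℕ → Y) → Prop) :
    (∀ᶠ s in (upow U (n + 1) : Filter (ℕ → Y)), P s) ↔
      ∀ᶠ b in (U : Filter Y), ∀ᶠ s in (upow U n : Filter (ℕ → Y)), P (ncons b s) := Iff.rfl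

theorem upow_add (U : Ultrafilter Y) (n m : ℕ) (P : (ℕ → Y) → Prop) :
    (∀ᶠ s in (upow U (n + m) : Filter (ℕ → Y)), P s) ↔
      ∀ᶠ s in (upow U n : Filter (ℕ → Y)), ∀ᶠ t in (upow U m : Filter (ℕ → Y)), P (napp n s t) := by
  induction n generalizing P with
  | zero =>
    have : ∀ s t : ℕ → Y, napp 0 s t = t := fun s t => by funext k; simp [napp]
    simp only [this, Filter.eventually_const, Nat.zero_add]
  | succ n ih =>
    rw [Nat.add_right_comm, upow_succ, upow_succ]
    refine Filter.eventually_congr (Filter.Eventually.of_forall fun b => ?_)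
    rw [ih]
    simp only [napp_succ]

theorem upow_mem (U : Ultrafilter Y) (A : Set Y) (hA : A ∈ U) (n : ℕ) :
    ∀ᶠ s in (upow U n : Filter (ℕ → Y)), ∀ k < n, s k ∈ A := by
  induction n with
  | zero => exact Filter.Eventually.of_forall fun s k hk => absurd hk (Nat.not_lt_zero k)
  | succ n ih =>
    rw [upow_succ]
    have : ∀ᶠ b in (U : Filter Y), b ∈ A := hA
    filter_upwards [this] with b hb
    filter_upwards [ih] with s hs k hk
    cases k with
    | zero => exact hb
    | succ k => exact hs k (by omega)

theorem upow_sub (U : Ultrafilter Y) (n m : ℕ) (i : Fin m → ℕ) (hi : StrictMono i)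
    (hn : ∀ q, i q < n) (P : (Fin m → Y) → Prop) :
    (∀ᶠ s in (upow U n : Filter (ℕ → Y)), P (fun q => s (i q))) ↔
      ∀ᶠ s in (upow U m : Filter (ℕ → Y)), P (fun q => s q) := by
  induction n generalizing m with
  | zero =>
    cases m with
    | zero =>
      have : ∀ f g : Fin 0 → Y, f = g := fun f g => Subsingleton.elim _ _
      have h1 : ∀ s : ℕ → Y, P (fun q => s (i q)) ↔ P Fin.elim0 := fun s => by
        rw [this (fun q => s (i q))]
      have h2 : ∀ s : ℕ → Y, P (fun q => s q) ↔ P Fin.elim0 := fun s => by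
        rw [this (fun q => s q)]
      simp only [h1, h2]
    | succ m => exact absurd (hn 0) (Nat.not_lt_zero _)
  | succ n ih =>
    cases m with
    | zero =>
      have : ∀ f g : Fin 0 → Y, f = g := fun f g => Subsingleton.elim _ _
      have h1 : ∀ s : ℕ → Y, P (fun q => s (i q)) ↔ P Fin.elim0 := fun s => by
        rw [this (fun q => s (i q))]
      have h2 : ∀ s : ℕ → Y, P (fun q => s q) ↔ P Fin.elim0 := fun s => by
        rw [this (fun q => s q)]
      simp only [h1, h2, Filter.eventually_const]
    | succ m =>
      by_cases h0 : i 0 = 0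
      · have hpos : ∀ q : Fin m, 0 < i q.succ := fun q => by
          have := hi (Fin.succ_pos q); omega
        let j : Fin m → ℕ := fun q => i q.succ - 1
        have hj : ∀ q, i q.succ = j q + 1 := fun q => by have := hpos q; simp only [j]; omega
        have hjm : StrictMono j := fun a b hab => by
          have h1 := hi (Fin.succ_lt_succ_iff.2 hab)
          rw [hj, hj] at h1; omega
        rw [upow_succ, upow_succ]
        refine Filter.eventually_congr (Filter.Eventually.of_forall fun b => ?_)
        have e1 : ∀ s : ℕ → Y, (fun q => ncons b s (i q)) =
            (Fin.cons b (fun q => s (j q)) : Fin (m + 1) → Y) := fun s => by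
          funext q
          refine Fin.cases ?_ (fun q => ?_) q
          · simp [h0, ncons]
          · simp [hj, ncons]
        have e2 : ∀ s : ℕ → Y, (fun q : Fin (m + 1) => ncons b s q) =
            (Fin.cons b (fun q : Fin m => s q) : Fin (m + 1) → Y) := fun s => by
          funext q
          refine Fin.cases ?_ (fun q => ?_) q
          · simp [ncons]
          · simp [ncons]
        simp only [e1, e2]
        exact ih m j hjm (fun q => by have := hn q.succ; rw [hj] at this; omega)
          (fun f => P (Fin.cons b f))
      · have hpos : ∀ q : Fin (m + 1), 0 < i q := fun q => by
          have := hi.monotone (Fin.zero_le q); omega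
        let j : Fin (m + 1) → ℕ := fun q => i q - 1
        have hj : ∀ q, i q = j q + 1 := fun q => by have := hpos q; simp only [j]; omega
        have hjm : StrictMono j := fun a b hab => by
          have h1 := hi hab
          rw [hj, hj] at h1; omega
        rw [upow_succ]
        have e1 : ∀ (b : Y) (s : ℕ → Y), (fun q => ncons b s (i q)) = (fun q => s (j q)) :=
          fun b s => by funext q; simp [hj, ncons]
        simp only [e1, Filter.eventually_const]
        exact ih (m + 1) j hjm (fun q => by have := hn q; rw [hj] at this; omega) P

theorem upow_indisc (U : Ultrafilter Y) (n m : ℕ) (i j : Fin m → ℕ) (hi : StrictMono i)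
    (hj : StrictMono j) (hni : ∀ q, i q < n) (hnj : ∀ q, j q < n) (P : (Fin m → Y) → Prop) :
    ∀ᶠ s in (upow U n : Filter (ℕ → Y)), (P (fun q => s (i q)) ↔ P (fun q => s (j q))) := by
  have h1 := upow_sub U n m i hi hni P
  have h2 := upow_sub U n m j hj hnj P
  by_cases h : ∀ᶠ s in (upow U m : Filter (ℕ → Y)), P (fun q => s q)
  · filter_upwards [h1.2 h, h2.2 h] with s a b
    exact iff_of_true a b
  · have h1' := (Ultrafilter.eventually_not.2 (mt h1.1 h))
    have h2' := (Ultrafilter.eventually_not.2 (mt h2.1 h))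
    filter_upwards [h1', h2'] with s a b
    exact iff_of_false a b

theorem upow_one (U : Ultrafilter Y) (n k : ℕ) (hk : k < n) (P : Y → Prop)
    (h : ∀ᶠ b in (U : Filter Y), P b) : ∀ᶠ s in (upow U n : Filter (ℕ → Y)), P (s k) := by
  filter_upwards [upow_mem U {b | P b} h n] with s hs
  exact hs k hk

/-- The local covering statement. -/
theorem local_cover {X : Type*} (n : ℕ) (φ : X → Y → Prop) (θ η : X → (Fin (2 * n + 1) → Y) → Prop)
    (h1 : ∀ x (s s' : Fin (2 * n + 1) → Y), (∀ k : Fin (2 * n + 1), (k : ℕ) ≠ n → s k = s' k) →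
      η x s → θ x s' → ∀ k : Fin (2 * n + 1), (k : ℕ) = n → φ x (s k))
    (h2 : ∀ U : Ultrafilter Y, ∀ᶠ s in (upow U (2 * n + 1) : Filter (ℕ → Y)),
      ∀ x, η x (fun k => s k))
    (h3 : ∀ (U : Ultrafilter Y) x, (∀ᶠ b in (U : Filter Y), φ x b) →
      ∀ᶠ s in (upow U (2 * n + 1) : Filter (ℕ → Y)), θ x (fun k => s k))
    (A : Set Y) (a : X) (ha : ∀ b ∈ A, φ a b) :
    ∃ r : ℕ, ∀ A₀ : Finset Y, (∀ b ∈ A₀, b ∈ A) → ∃ c : Fin r → Fin (2 * n + 1) → Y,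
      (∀ j k, c j k ∈ A) ∧ (∀ j, θ a (c j)) ∧
      ∀ b ∈ A₀, ∃ j, ∀ x, θ x (c j) → φ x b := by
  classical
  -- for every ultrafilter a good set
  have key : ∀ U : Ultrafilter Y, A ∈ U → ∃ D ∈ U, ∀ A₀ : Finset Y, (∀ b ∈ A₀, b ∈ D) →
      ∃ c : Fin (2 * n + 1) → Y, (∀ k, c k ∈ A) ∧ θ a c ∧ ∀ b ∈ A₀, ∀ x, θ x c → φ x b := by
    intro U hU
    have ha' : ∀ᶠ b in (U : Filter Y), φ a b := Filter.mem_of_superset hU ha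
    have H := ((h2 U).and ((h3 U a ha').and (upow_mem U A hU (2 * n + 1))))
    have e : upow U (2 * n + 1) = upow U (n + (n + 1)) := by congr 1; ring
    rw [e, upow_add] at H
    obtain ⟨J, hJ⟩ := H.exists
    rw [upow_succ] at hJ
    obtain ⟨b', hb'⟩ := hJ.exists
    refine ⟨{b | ∀ᶠ I in (upow U n : Filter (ℕ → Y)), ∀ x,
      η x (fun k : Fin (2 * n + 1) => napp n J (ncons b I) k)}, ?_, ?_⟩
    · filter_upwards [hJ] with b hb
      filter_upwards [hb] with I hI
      exact hI.1
    · intro A₀ hA₀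
      have h4 : ∀ᶠ I in (upow U n : Filter (ℕ → Y)), ∀ b ∈ A₀, ∀ x,
          η x (fun k : Fin (2 * n + 1) => napp n J (ncons b I) k) :=
        (Filter.eventually_all_finset A₀).2 hA₀
      obtain ⟨I, hI, hI'⟩ := (h4.and hb').exists
      refine ⟨fun k => napp n J (ncons b' I) k, fun k => hI'.2.2 k (by omega), hI'.2.1, ?_⟩
      · intro b hb x hx
        have := h1 x _ _ (fun k hk => ?_) (hI b hb x) hx ⟨n, by omega⟩ rfl
        · simpa [napp, ncons] using this
        · simp only [napp]
          split_ifs with hlt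
          · rfl
          · obtain ⟨l, hl⟩ : ∃ l, (k : ℕ) - n = l + 1 := ⟨k - n - 1, by omega⟩
            rw [hl]; rfl
  choose! D hD hc using key
  -- finitely many of the good sets cover A
  have fin : ∃ t : Finset (Ultrafilter Y), (∀ U ∈ t, A ∈ U) ∧ A ⊆ ⋃ U ∈ t, D U := by
    by_contra hcon
    push Not at hcon
    let S : Set (Set Y) := insert A {s | ∃ U : Ultrafilter Y, A ∈ U ∧ s = (D U)ᶜ}
    have hS : (Filter.generate S).NeBot := by
      rw [Filter.generate_neBot_iff]
      intro t htS htf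
      let t' := htf.toFinset
      have hch : ∀ s : Set Y, ∃ U : Ultrafilter Y, s ∈ t → s ≠ A → A ∈ U ∧ s = (D U)ᶜ := by
        intro s
        by_cases hs : s ∈ t ∧ s ≠ A
        · rcases htS hs.1 with h | ⟨U, hU⟩
          · exact absurd h hs.2
          · exact ⟨U, fun _ _ => hU⟩
        · by_cases hY : Nonempty (Ultrafilter Y)
          · exact ⟨hY.some, fun h h' => absurd ⟨h, h'⟩ hs⟩
          · exact absurd ⟨pure (Classical.arbitrary Y)⟩ hY
      choose G hG using hch
      have := hcon ((t'.filter (· ≠ A)).image G) (by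
        intro U hU
        obtain ⟨s, hs, rfl⟩ := Finset.mem_image.1 hU
        rw [Finset.mem_filter, Set.Finite.mem_toFinset] at hs
        exact (hG s hs.1 hs.2).1)
      rw [Set.not_subset] at this
      obtain ⟨y, hyA, hy⟩ := this
      refine ⟨y, fun s hs => ?_⟩
      by_cases hsA : s = A
      · rw [hsA]; exact hyA
      · rw [(hG s hs hsA).2]
        intro hys
        refine hy (Set.mem_iUnion₂.2 ⟨G s, Finset.mem_image.2 ⟨s, ?_, rfl⟩, hys⟩)
        rw [Finset.mem_filter, Set.Finite.mem_toFinset]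
        exact ⟨hs, hsA⟩
    let U : Ultrafilter Y := Ultrafilter.of (Filter.generate S)
    have hU : ∀ s ∈ S, s ∈ U := fun s hs =>
      Ultrafilter.of_le (Filter.generate S) (Filter.mem_generate_of_mem hs)
    have hA : A ∈ U := hU A (Set.mem_insert _ _)
    have hn : (D U)ᶜ ∈ U := hU _ (Set.mem_insert_of_mem _ ⟨U, hA, rfl⟩)
    exact (Ultrafilter.compl_mem_iff_notMem.1 hn) (hD U hA)
  obtain ⟨t, htA, htc⟩ := fin
  refine ⟨t.card, fun A₀ hA₀ => ?_⟩
  let f := t.equivFin.symm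
  have : ∀ j : Fin t.card, ∃ c : Fin (2 * n + 1) → Y, (∀ k, c k ∈ A) ∧ θ a c ∧
      ∀ b ∈ A₀.filter (· ∈ D (f j)), ∀ x, θ x c → φ x b := fun j =>
    hc (f j) (htA _ (f j).2) _ (fun b hb => (Finset.mem_filter.1 hb).2)
  choose c hc1 hc2 hc3 using this
  refine ⟨c, hc1, hc2, fun b hb => ?_⟩
  obtain ⟨U, hUt, hbU⟩ := Set.mem_iUnion₂.1 (htc (hA₀ b hb))
  refine ⟨t.equivFin ⟨U, hUt⟩, hc3 _ b (Finset.mem_filter.2 ⟨hb, ?_⟩)⟩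
  simpa [f] using hbU

end PowPart
section DistalPart

variable {L}

structure Cond (L : FirstOrder.Language.{u, v}) (na ny : ℕ) : Type max u v where
  m : ℕ
  p : ℕ
  ψ : L.Formula ((Fin m × Fin ny) ⊕ Fin p)
  i : Fin m → ℤ
  j : Fin m → ℤ
  t : Fin p → Fin na
  hi : StrictMono i
  hj : StrictMono j
  hz : p = 0 ∨ ∀ q, i q ≠ 0 ∧ j q ≠ 0

def Cond.F {na ny : ℕ} (c : Cond L na ny) : L.Formula (Fin na ⊕ (ℤ × Fin ny)) :=
  (c.ψ.relabel (Sum.elim (fun q => Sum.inr (c.i q.1, q.2)) (fun k => Sum.inl (c.t k)))).iff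
    (c.ψ.relabel (Sum.elim (fun q => Sum.inr (c.j q.1, q.2)) (fun k => Sum.inl (c.t k))))

theorem Cond.realize_F {na ny : ℕ} (c : Cond L na ny) {M : Type*} [L.Structure M]
    (x : Fin na → M) (b : ℤ → Fin ny → M) :
    c.F.Realize (Sum.elim x (fun q => b q.1 q.2)) ↔
      (c.ψ.Realize (Sum.elim (fun q => b (c.i q.1) q.2) (fun k => x (c.t k))) ↔
       c.ψ.Realize (Sum.elim (fun q => b (c.j q.1) q.2) (fun k => x (c.t k)))) := by
  rw [Cond.F, Formula.realize_iff, Formula.realize_relabel, Formula.realize_relabel]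
  rw [Sum.comp_elim, Sum.comp_elim]
  rfl

def cl (n : ℕ) (z : ℤ) : Fin (2 * n + 1) := ⟨min (z + n).toNat (2 * n), by omega⟩

theorem distal_finite {N : Type w} [L.Structure N] [Nonempty N] (hN : IsDistal L N)
    {na ny : ℕ} (φ : L.Formula (Fin na ⊕ Fin ny)) :
    ∃ s : Finset (Cond L na ny), ∀ (x : Fin na → N) (b : ℤ → Fin ny → N),
      (∀ c ∈ s, c.F.Realize (Sum.elim x (fun q => b q.1 q.2))) →
      φ.Realize (Sum.elim x (b 1)) → φ.Realize (Sum.elim x (b 0)) := by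
  classical
  by_contra hcon
  push Not at hcon
  let φ1 : L.Formula (Fin na ⊕ (ℤ × Fin ny)) :=
    φ.relabel (Sum.elim Sum.inl (fun k => Sum.inr (1, k)))
  let φ0 : L.Formula (Fin na ⊕ (ℤ × Fin ny)) :=
    φ.relabel (Sum.elim Sum.inl (fun k => Sum.inr (0, k)))
  have e1 : ∀ (v : Fin na ⊕ (ℤ × Fin ny) → N), φ1.Realize v ↔
      φ.Realize (Sum.elim (fun k => v (Sum.inl k)) (fun k => v (Sum.inr (1, k)))) := by
    intro v
    rw [Formula.realize_relabel, Sum.comp_elim]; rfl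
  have e0 : ∀ (v : Fin na ⊕ (ℤ × Fin ny) → N), φ0.Realize v ↔
      φ.Realize (Sum.elim (fun k => v (Sum.inl k)) (fun k => v (Sum.inr (0, k)))) := by
    intro v
    rw [Formula.realize_relabel, Sum.comp_elim]; rfl
  obtain ⟨E, v, hv⟩ := compact_ext (N := N) (ι := Option (Cond L na ny))
    (fun o => o.elim (φ1 ⊓ φ0.not) Cond.F) (by
      intro s
      obtain ⟨x, b, h1, h2, h3⟩ := hcon s.eraseNone
      refine ⟨Sum.elim x (fun q => b q.1 q.2), fun o ho => ?_⟩
      cases o with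
      | none =>
        simp only [Option.elim]
        rw [Formula.realize_inf, Formula.realize_not, e1, e0]
        exact ⟨h2, h3⟩
      | some c => exact h1 c (Finset.mem_eraseNone.2 ho))
  let x : Fin na → E.Carrier := fun k => v (Sum.inl k)
  let b : ℤ → Fin ny → E.Carrier := fun z k => v (Sum.inr (z, k))
  have hvv : v = Sum.elim x (fun q => b q.1 q.2) := by
    funext g; cases g <;> rfl
  have hc : ∀ c : Cond L na ny,
      (c.ψ.Realize (Sum.elim (fun q => b (c.i q.1) q.2) (fun k => x (c.t k))) ↔
       c.ψ.Realize (Sum.elim (fun q => b (c.j q.1) q.2) (fun k => x (c.t k)))) := by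
    intro c
    rw [← Cond.realize_F, ← hvv]
    exact hv (some c)
  have hI := hN.2 E ny b (Set.range x) (by
      intro m i j hi hj p ψ mm hmm
      cases p with
      | zero =>
        have := hc ⟨m, 0, ψ, i, j, Fin.elim0, hi, hj, Or.inl rfl⟩
        simp only at this
        have e : mm = fun k => x (Fin.elim0 k) := Subsingleton.elim _ _
        rw [e]; exact this
      | succ p => exact absurd (hmm 0) (Set.notMem_empty _)) (by
      intro m i j hi hj p ψ mm hmm
      choose t ht using hmm
      have := hc ⟨m, p, ψ, fun q => i q, fun q => j q, t, fun _ _ h => hi h, fun _ _ h => hj h,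
        Or.inr fun q => ⟨(i q).2, (j q).2⟩⟩
      simp only [ht] at this
      exact this)
  have h := hI 1 (fun _ => 1) (fun _ => 0) (Subsingleton.strictMono _) (Subsingleton.strictMono _)
    na (φ.relabel (Sum.elim Sum.inr (fun k => Sum.inl (0, k)))) x (fun k => ⟨k, rfl⟩)
  rw [Formula.realize_relabel, Formula.realize_relabel, Sum.comp_elim, Sum.comp_elim] at h
  have h' := hv none
  simp only [Option.elim] at h'
  rw [Formula.realize_inf, Formula.realize_not, Formula.realize_relabel,
    Formula.realize_relabel, Sum.comp_elim, Sum.comp_elim] at h'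
  exact h'.2 (h.1 h'.1)

theorem distal_formulas {N : Type w} [L.Structure N] [Nonempty N] (hN : IsDistal L N)
    {na ny : ℕ} (φ : L.Formula (Fin na ⊕ Fin ny)) :
    ∃ (n : ℕ) (θ η : L.Formula (Fin na ⊕ (Fin (2 * n + 1) × Fin ny))),
      (∀ (x : Fin na → N) (s s' : Fin (2 * n + 1) → Fin ny → N),
        (∀ k : Fin (2 * n + 1), (k : ℕ) ≠ n → s k = s' k) →
        η.Realize (Sum.elim x (fun q => s q.1 q.2)) →
        θ.Realize (Sum.elim x (fun q => s' q.1 q.2)) →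
        ∀ k : Fin (2 * n + 1), (k : ℕ) = n → φ.Realize (Sum.elim x (s k))) ∧
      (∀ (M : Type w) [L.Structure M] [Nonempty M] (U : Ultrafilter (Fin ny → M)),
        ∀ᶠ s in (upow U (2 * n + 1) : Filter (ℕ → Fin ny → M)),
          ∀ x : Fin na → M, η.Realize (Sum.elim x (fun q => s q.1 q.2))) ∧
      (∀ (M : Type w) [L.Structure M] [Nonempty M] (U : Ultrafilter (Fin ny → M))
        (x : Fin na → M), (∀ᶠ b in (U : Filter (Fin ny → M)), φ.Realize (Sum.elim x b)) →
        ∀ᶠ s in (upow U (2 * n + 1) : Filter (ℕ → Fin ny → M)),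
          θ.Realize (Sum.elim x (fun q => s q.1 q.2))) := by
  classical
  obtain ⟨S, hS⟩ := distal_finite hN φ
  obtain ⟨n, hn1, hn⟩ : ∃ n : ℕ, 1 ≤ n ∧ ∀ c ∈ S, ∀ q, (c.i q).natAbs ≤ n ∧ (c.j q).natAbs ≤ n := by
    let g : Cond L na ny → ℕ := fun c =>
      Finset.univ.sup (fun q => (c.i q).natAbs) ⊔ Finset.univ.sup (fun q => (c.j q).natAbs)
    refine ⟨S.sup g + 1, by omega, fun c hc q => ?_⟩
    have h1 : g c ≤ S.sup g := Finset.le_sup hc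
    have h2 : (c.i q).natAbs ≤ Finset.univ.sup (fun q => (c.i q).natAbs) :=
      Finset.le_sup (f := fun q => (c.i q).natAbs) (Finset.mem_univ q)
    have h3 : (c.j q).natAbs ≤ Finset.univ.sup (fun q => (c.j q).natAbs) :=
      Finset.le_sup (f := fun q => (c.j q).natAbs) (Finset.mem_univ q)
    have h4 : Finset.univ.sup (fun q => (c.i q).natAbs) ≤ g c := le_sup_left
    have h5 : Finset.univ.sup (fun q => (c.j q).natAbs) ≤ g c := le_sup_right
    omega
  let ρ : Fin na ⊕ (ℤ × Fin ny) → Fin na ⊕ (Fin (2 * n + 1) × Fin ny) :=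
    Sum.map id (fun q => (cl n q.1, q.2))
  have hρ : ∀ (M : Type w) [L.Structure M] (χ : L.Formula (Fin na ⊕ (ℤ × Fin ny)))
      (x : Fin na → M) (s : Fin (2 * n + 1) → Fin ny → M),
      (χ.relabel ρ).Realize (Sum.elim x (fun q => s q.1 q.2)) ↔
      χ.Realize (Sum.elim x (fun q => (fun z => s (cl n z)) q.1 q.2)) := by
    intro M _ χ x s
    rw [Formula.realize_relabel]
    refine iff_of_eq (congrArg χ.Realize ?_)
    funext g; cases g <;> rfl
  let φ1 : L.Formula (Fin na ⊕ (Fin (2 * n + 1) × Fin ny)) :=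
    φ.relabel (Sum.map id (fun k => (cl n 1, k)))
  have hφ1 : ∀ (M : Type w) [L.Structure M]
      (x : Fin na → M) (s : Fin (2 * n + 1) → Fin ny → M),
      φ1.Realize (Sum.elim x (fun q => s q.1 q.2)) ↔ φ.Realize (Sum.elim x (s (cl n 1))) := by
    intro M _ x s
    rw [Formula.realize_relabel]
    refine iff_of_eq (congrArg φ.Realize ?_)
    funext g; cases g <;> rfl
  -- generic truth of one condition
  have hgen : ∀ (M : Type w) [L.Structure M] [Nonempty M] (U : Ultrafilter (Fin ny → M))
      (c : Cond L na ny), c ∈ S → ∀ x : Fin na → M,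
      ∀ᶠ s in (upow U (2 * n + 1) : Filter (ℕ → Fin ny → M)),
        (c.F.relabel ρ).Realize (Sum.elim x (fun q => s q.1 q.2)) := by
    intro M _ _ U c hc x
    have hcl : ∀ z : ℤ, z.natAbs ≤ n → ((cl n z : Fin (2 * n + 1)) : ℤ) = z + n := by
      intro z hz
      simp only [cl]
      push_cast
      omega
    have hmono : ∀ i : Fin c.m → ℤ, StrictMono i → (∀ q, (i q).natAbs ≤ n) →
        StrictMono (fun q => ((cl n (i q) : Fin (2 * n + 1)) : ℕ)) := by
      intro i hi hin a b hab
      have h1 := hcl _ (hin a)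
      have h2 := hcl _ (hin b)
      have h3 := hi hab
      show ((cl n (i a) : Fin (2 * n + 1)) : ℕ) < ((cl n (i b) : Fin (2 * n + 1)) : ℕ)
      omega
    have := upow_indisc U (2 * n + 1) c.m (fun q => cl n (c.i q)) (fun q => cl n (c.j q))
      (hmono _ c.hi fun q => (hn c hc q).1) (hmono _ c.hj fun q => (hn c hc q).2)
      (fun q => (cl n (c.i q)).2) (fun q => (cl n (c.j q)).2)
      (fun g => c.ψ.Realize (Sum.elim (fun q => g q.1 q.2) (fun k => x (c.t k))))
    filter_upwards [this] with s hs
    have h1 := (hρ M c.F x (fun k => s k)).2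
    refine h1 ?_
    exact (Cond.realize_F c x (fun z => s (cl n z))).2 hs
  refine ⟨n, φ1 ⊓ Formula.iInf (fun c : {c : Cond L na ny // c ∈ S.filter (fun c : Cond L na ny => ¬ c.p = 0)} => c.1.F.relabel ρ),
    Formula.iInf (fun c : {c : Cond L na ny // c ∈ S.filter (fun c : Cond L na ny => c.p = 0)} => c.1.F.relabel ρ), ?_, ?_, ?_⟩
  · intro x s s' hss hη hθ k hk
    rw [Formula.realize_inf, hφ1] at hθ
    rw [Formula.realize_iInf] at hη
    have hθ2 := Formula.realize_iInf.1 hθ.2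
    have hcl : ∀ z : ℤ, z.natAbs ≤ n → z ≠ 0 → s (cl n z) = s' (cl n z) := by
      intro z hz hz0
      refine hss _ ?_
      simp only [cl]
      omega
    have hk' : k = cl n 0 := by
      ext; simp only [cl]; omega
    rw [hk']
    refine hS x (fun z => s (cl n z)) (fun c hc => ?_) ?_
    · by_cases hp : c.p = 0
      · exact (hρ N c.F x s).1 (hη ⟨c, Finset.mem_filter.2 ⟨hc, hp⟩⟩)
      · have h := (hρ N c.F x s').1 (hθ2 ⟨c, Finset.mem_filter.2 ⟨hc, hp⟩⟩)
        have hz := c.hz.resolve_left hp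
        have h1 := (Cond.realize_F c x (fun z => s' (cl n z))).1 h
        refine (Cond.realize_F c x (fun z => s (cl n z))).2 ?_
        have a1 : ∀ q, s' (cl n (c.i q)) = s (cl n (c.i q)) := fun q =>
          (hcl _ (hn c hc q).1 (hz q).1).symm
        have a2 : ∀ q, s' (cl n (c.j q)) = s (cl n (c.j q)) := fun q =>
          (hcl _ (hn c hc q).2 (hz q).2).symm
        simp only [a1, a2] at h1
        exact h1
    · rw [hcl 1 (by simpa using hn1) one_ne_zero]
      exact hθ.1
  · intro M _ _ U
    have x0 : Fin na → M := fun _ => Classical.arbitrary M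
    have h1 : ∀ᶠ s in (upow U (2 * n + 1) : Filter (ℕ → Fin ny → M)),
        ∀ c ∈ S, (c.F.relabel ρ).Realize (Sum.elim x0 (fun q => s q.1 q.2)) :=
      (Filter.eventually_all_finset S).2 fun c hc => hgen M U c hc x0
    filter_upwards [h1] with s hs x
    rw [Formula.realize_iInf]
    rintro ⟨c, hc⟩
    obtain ⟨hcS, hcp⟩ := Finset.mem_filter.1 hc
    have h2 := (Cond.realize_F c x0 (fun z => s (cl n z))).1 ((hρ M c.F x0 (fun k => s k)).1 (hs c hcS))
    refine (hρ M c.F x (fun k => s k)).2 ((Cond.realize_F c x (fun z => s (cl n z))).2 ?_)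
    have : IsEmpty (Fin c.p) := by rw [hcp]; infer_instance
    have e : (fun k => x (c.t k)) = (fun k => x0 (c.t k)) := Subsingleton.elim _ _
    rw [e]; exact h2
  · intro M _ _ U x hx
    have h1 : ∀ᶠ s in (upow U (2 * n + 1) : Filter (ℕ → Fin ny → M)),
        ∀ c ∈ S, (c.F.relabel ρ).Realize (Sum.elim x (fun q => s q.1 q.2)) :=
      (Filter.eventually_all_finset S).2 fun c hc => hgen M U c hc x
    have h2 := upow_one U (2 * n + 1) (cl n 1) (cl n 1).2 _ hx
    filter_upwards [h1, h2] with s hs hs2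
    rw [Formula.realize_inf]
    refine ⟨(hφ1 M x (fun k => s k)).2 hs2, ?_⟩
    rw [Formula.realize_iInf]
    rintro ⟨c, hc⟩
    exact hs c (Finset.mem_filter.1 hc).1

end DistalPart
section UniformPart

variable {L}

theorem ultrapower_exists (L : FirstOrder.Language.{u, v}) (N : Type w) [L.Structure N]
    [Nonempty N] : ∃ (M : Type w) (_ : L.Structure M) (out : M → ℕ → N) (mk : (ℕ → N) → M),
      (∀ f, ∀ᶠ R in (Filter.hyperfilter ℕ : Filter ℕ), out (mk f) R = f R) ∧
      ∀ (β : Type) (φ : L.Formula β) (v : β → M), φ.Realize v ↔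
        ∀ᶠ R in (Filter.hyperfilter ℕ : Filter ℕ), φ.Realize (fun i => out (v i) R) := by
  let V : Ultrafilter ℕ := Filter.hyperfilter ℕ
  let P : Type w := (V : Filter ℕ).Product fun _ => N
  let mk : (ℕ → N) → P := fun f => (f : (V : Filter ℕ).Product fun _ => N)
  let out : P → ℕ → N := Quotient.out
  have hmo : ∀ y : P, mk (out y) = y := fun y => Quotient.out_eq y
  refine ⟨P, inferInstanceAs (L.Structure ((V : Filter ℕ).Product fun _ => N)), out, mk, ?_, ?_⟩
  · intro f
    have : mk (out (mk f)) = mk f := hmo _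
    exact Quotient.exact this
  · intro β φ v
    have := Ultraproduct.realize_formula_cast (u := V) (M := fun _ : ℕ => N) φ (fun i => out (v i))
    refine Iff.trans ?_ this
    refine iff_of_eq (congrArg _ ?_)
    funext i
    exact (hmo (v i)).symm

/-- The formula `∀ x, θ(x, z) → φ(x, y)`. -/
noncomputable def chi {α β γ : Type} [Finite α] (θ : L.Formula (α ⊕ β)) (φ : L.Formula (α ⊕ γ)) :
    L.Formula (β ⊕ γ) :=
  Formula.iAlls α ((θ.relabel (Sum.elim Sum.inr (fun b => Sum.inl (Sum.inl b)))).imp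
    (φ.relabel (Sum.elim Sum.inr (fun c => Sum.inl (Sum.inr c)))))

theorem realize_chi {α β γ : Type} [Finite α] (θ : L.Formula (α ⊕ β)) (φ : L.Formula (α ⊕ γ))
    {M : Type*} [L.Structure M] (z : β → M) (y : γ → M) :
    (chi θ φ).Realize (Sum.elim z y) ↔
      ∀ x : α → M, θ.Realize (Sum.elim x z) → φ.Realize (Sum.elim x y) := by
  rw [chi, Formula.realize_iAlls]
  refine forall_congr' fun x => ?_
  rw [Formula.realize_imp, Formula.realize_relabel, Formula.realize_relabel, Sum.comp_elim,
    Sum.comp_elim]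
  rfl

theorem uniform_cover {N : Type w} [L.Structure N] [Nonempty N] {na ny n : ℕ}
    (φ : L.Formula (Fin na ⊕ Fin ny))
    (θ η : L.Formula (Fin na ⊕ (Fin (2 * n + 1) × Fin ny)))
    (h1 : ∀ (x : Fin na → N) (s s' : Fin (2 * n + 1) → Fin ny → N),
        (∀ k : Fin (2 * n + 1), (k : ℕ) ≠ n → s k = s' k) →
        η.Realize (Sum.elim x (fun q => s q.1 q.2)) →
        θ.Realize (Sum.elim x (fun q => s' q.1 q.2)) →
        ∀ k : Fin (2 * n + 1), (k : ℕ) = n → φ.Realize (Sum.elim x (s k)))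
    (h2 : ∀ (M : Type w) [L.Structure M] [Nonempty M] (U : Ultrafilter (Fin ny → M)),
        ∀ᶠ s in (upow U (2 * n + 1) : Filter (ℕ → Fin ny → M)),
          ∀ x : Fin na → M, η.Realize (Sum.elim x (fun q => s q.1 q.2)))
    (h3 : ∀ (M : Type w) [L.Structure M] [Nonempty M] (U : Ultrafilter (Fin ny → M))
        (x : Fin na → M), (∀ᶠ b in (U : Filter (Fin ny → M)), φ.Realize (Sum.elim x b)) →
        ∀ᶠ s in (upow U (2 * n + 1) : Filter (ℕ → Fin ny → M)),
          θ.Realize (Sum.elim x (fun q => s q.1 q.2)))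
    (nn : ℕ → ℕ) :
    ∃ R : ℕ, ∀ (B : Set (Fin ny → N)) (a : Fin na → N),
      (∀ b ∈ B, φ.Realize (Sum.elim a b)) → ∃ r ≤ R, ∀ x : Fin (nn r) → Fin ny → N,
        (∀ i, x i ∈ B) → ∃ c : Fin r → Fin (2 * n + 1) → Fin ny → N,
          (∀ j k, c j k ∈ B) ∧ (∀ j, θ.Realize (Sum.elim a (fun q => c j q.1 q.2))) ∧
          ∀ i, ∃ j, ∀ x' : Fin na → N, θ.Realize (Sum.elim x' (fun q => c j q.1 q.2)) →
            φ.Realize (Sum.elim x' (x i)) := by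
  classical
  by_contra hcon
  push Not at hcon
  choose B a hBa bad using hcon
  have bad' : ∀ R r : ℕ, ∃ x : Fin (nn r) → Fin ny → N, r ≤ R → (∀ i, x i ∈ B R) ∧
      ∀ c : Fin r → Fin (2 * n + 1) → Fin ny → N,
        (∀ j k, c j k ∈ B R) → (∀ j, θ.Realize (Sum.elim (a R) (fun q => c j q.1 q.2))) →
        ∃ i, ∀ j, ∃ x' : Fin na → N, θ.Realize (Sum.elim x' (fun q => c j q.1 q.2)) ∧
          ¬ φ.Realize (Sum.elim x' (x i)) := by
    intro R r
    by_cases hr : r ≤ R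
    · obtain ⟨x, hx1, hx2⟩ := bad R r hr
      exact ⟨x, fun _ => ⟨hx1, hx2⟩⟩
    · exact ⟨fun _ _ => Classical.arbitrary N, fun h => absurd h hr⟩
  choose x hx using bad'
  obtain ⟨M, iM, out, mk, hmk, los⟩ := ultrapower_exists L N
  have : Nonempty M := ⟨mk fun _ => Classical.arbitrary N⟩
  have los2 : ∀ {α β : Type} (χ : L.Formula (α ⊕ β)) (v : α → M) (t : β → M),
      χ.Realize (Sum.elim v t) ↔ ∀ᶠ R in (Filter.hyperfilter ℕ : Filter ℕ),
        χ.Realize (Sum.elim (fun i => out (v i) R) (fun i => out (t i) R)) := by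
    intro α β χ v t
    rw [los]
    refine Filter.eventually_congr (Filter.Eventually.of_forall fun R => ?_)
    refine iff_of_eq (congrArg χ.Realize ?_)
    funext g; cases g <;> rfl
  -- the tuples of classes
  have htup : ∀ {γ : Type} [Finite γ] (f : ℕ → γ → N),
      ∀ᶠ R in (Filter.hyperfilter ℕ : Filter ℕ),
        (fun k => out (mk fun R => f R k) R) = f R := by
    intro γ _ f
    have : ∀ᶠ R in (Filter.hyperfilter ℕ : Filter ℕ), ∀ k,
        out (mk fun R => f R k) R = f R k := Filter.eventually_all.2 fun k => hmk _
    filter_upwards [this] with R hR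
    funext k; exact hR k
  let aM : Fin na → M := fun k => mk fun R => a R k
  let A : Set (Fin ny → M) :=
    {y | ∀ᶠ R in (Filter.hyperfilter ℕ : Filter ℕ), (fun k => out (y k) R) ∈ B R}
  obtain ⟨r, hr⟩ := local_cover (Y := Fin ny → M) (X := Fin na → M) n
    (fun x b => φ.Realize (Sum.elim x b))
    (fun x s => θ.Realize (Sum.elim x (fun q => s q.1 q.2)))
    (fun x s => η.Realize (Sum.elim x (fun q => s q.1 q.2)))
    (by
      intro x s s' hss hη hθ k hk
      rw [los2] at hη hθ ⊢
      filter_upwards [hη, hθ] with R hη hθ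
      refine h1 (fun i => out (x i) R) (fun k i => out (s k i) R) (fun k i => out (s' k i) R)
        (fun k hk => ?_) hη hθ k hk
      rw [hss k hk])
    (fun U => h2 M U) (fun U x hx => h3 M U x hx) A aM (by
      intro b hb
      show φ.Realize (Sum.elim aM b)
      rw [los2]
      have hb' : ∀ᶠ R in (Filter.hyperfilter ℕ : Filter ℕ), (fun k => out (b k) R) ∈ B R := hb
      filter_upwards [hb', htup a] with R h4 h5
      have := hBa R _ h4
      rw [← h5] at this
      exact this)
  let X : Fin (nn r) → Fin ny → M := fun i k => mk fun R => x R r i k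
  have hge : ∀ᶠ R in (Filter.hyperfilter ℕ : Filter ℕ), r ≤ R :=
    Nat.hyperfilter_le_atTop (Filter.eventually_ge_atTop r)
  have hX : ∀ᶠ R in (Filter.hyperfilter ℕ : Filter ℕ),
      ∀ i, (fun k => out (X i k) R) = x R r i :=
    Filter.eventually_all.2 fun i => htup (fun R => x R r i)
  obtain ⟨c, hcA, hcθ, hcov⟩ := hr (Finset.univ.image X) (by
    intro b hb
    obtain ⟨i, -, rfl⟩ := Finset.mem_image.1 hb
    show ∀ᶠ R in (Filter.hyperfilter ℕ : Filter ℕ), (fun k => out (X i k) R) ∈ B R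
    filter_upwards [hge, hX] with R h4 h5
    rw [h5 i]
    exact (hx R r h4).1 i)
  have e1 : ∀ᶠ R in (Filter.hyperfilter ℕ : Filter ℕ), ∀ j k,
      (fun l => out (c j k l) R) ∈ B R :=
    Filter.eventually_all.2 fun j => Filter.eventually_all.2 fun k => hcA j k
  have e2 : ∀ᶠ R in (Filter.hyperfilter ℕ : Filter ℕ), ∀ j,
      θ.Realize (Sum.elim (a R) (fun q => out (c j q.1 q.2) R)) := by
    refine Filter.eventually_all.2 fun j => ?_
    have := (los2 _ _ _).1 (hcθ j)
    filter_upwards [this, htup a] with R h4 h5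
    rw [← h5]
    exact h4
  have e3 : ∀ᶠ R in (Filter.hyperfilter ℕ : Filter ℕ), ∀ i, ∃ j, ∀ x' : Fin na → N,
      θ.Realize (Sum.elim x' (fun q => out (c j q.1 q.2) R)) →
        φ.Realize (Sum.elim x' (x R r i)) := by
    refine Filter.eventually_all.2 fun i => ?_
    obtain ⟨j, hj⟩ := hcov (X i) (Finset.mem_image_of_mem _ (Finset.mem_univ i))
    have h4 := (realize_chi θ φ (fun q => c j q.1 q.2) (X i)).2 hj
    rw [los2] at h4
    filter_upwards [h4, hX] with R h5 h6
    refine ⟨j, ?_⟩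
    rw [h6 i] at h5
    exact (realize_chi θ φ (fun q => out (c j q.1 q.2) R) (x R r i)).1 h5
  obtain ⟨R, h4, h5, h6, h7⟩ := (hge.and (e1.and (e2.and e3))).exists
  obtain ⟨i, hi⟩ := (hx R r h4).2 (fun j k l => out (c j k l) R) h5 h6
  obtain ⟨j, hj⟩ := h7 i
  obtain ⟨x', hx1, hx2⟩ := hi j
  exact hx2 (hj x' hx1)

theorem main_cover {N : Type w} [L.Structure N] [Nonempty N] (hN : IsDistal L N)
    {na ny : ℕ} (φ : L.Formula (Fin na ⊕ Fin ny)) :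
    ∃ (n T : ℕ) (θ : L.Formula (Fin na ⊕ (Fin n × Fin ny))),
      ∀ (B : Set (Fin ny → N)) (a : Fin na → N), B.Finite → B.Nonempty →
        (∀ b ∈ B, φ.Realize (Sum.elim a b)) →
        ∃ c : Fin T → Fin n → Fin ny → N,
          (∀ j k, c j k ∈ B) ∧ (∀ j, θ.Realize (Sum.elim a (fun q => c j q.1 q.2))) ∧
          ∀ b ∈ B, ∃ j, ∀ x' : Fin na → N, θ.Realize (Sum.elim x' (fun q => c j q.1 q.2)) →
            φ.Realize (Sum.elim x' b) := by
  classical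
  obtain ⟨n, θ, η, h1, h2, h3⟩ := distal_formulas hN φ
  -- NIP bounds
  have hd : ∀ r : ℕ, ∃ d, ¬ ShatTuple (fun z : (Fin r × (Fin (2 * n + 1) × Fin ny)) → N =>
      {y : Fin ny → N | ∃ j : Fin r, ∀ x' : Fin na → N,
        θ.Realize (Sum.elim x' (fun q => z (j, q))) → φ.Realize (Sum.elim x' y)}) d := by
    intro r
    obtain ⟨d, hd⟩ := nip_bound hN.1 (α := Fin ny) (β := Fin r × (Fin (2 * n + 1) × Fin ny))
      (Formula.iSup (fun j : Fin r => (chi θ φ).relabel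
        (Sum.elim (fun q => Sum.inr (j, q)) Sum.inl)))
    refine ⟨d, ?_⟩
    convert hd using 4 with z
    ext y
    show _ ↔ Formula.Realize _ _
    rw [Formula.realize_iSup]
    refine exists_congr fun j => ?_
    rw [Formula.realize_relabel, Sum.comp_elim]
    exact (realize_chi θ φ _ _).symm
  choose d hd using hd
  obtain ⟨e, he⟩ := nip_bound hN.1 (chi θ φ)
  choose nn hnn using fun r => cover_lemma (d r) r
  choose T hT using fun r => hnn r e
  obtain ⟨R, hR⟩ := uniform_cover φ θ η h1 h2 h3 (fun r => nn r + 1)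
  refine ⟨2 * n + 1, (Finset.range (R + 1)).sup T, θ, fun B a hBf hBn hBa => ?_⟩
  obtain ⟨r, hrR, hr⟩ := hR B a hBa
  have hTr : (Finset.range (R + 1)).sup T ≥ T r :=
    Finset.le_sup (f := T) (Finset.mem_range.2 (by omega))
  obtain ⟨b0, hb0⟩ := hBn
  have : Finite B := hBf
  have : Nonempty B := ⟨⟨b0, hb0⟩⟩
  let F : Type w := {c : Fin (2 * n + 1) → B //
    θ.Realize (Sum.elim a (fun q => (c q.1 : Fin ny → N) q.2))}
  have hF : Nonempty F := by
    obtain ⟨c, hc1, hc2, hc3⟩ := hr (fun _ => b0) (fun _ => hb0)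
    obtain ⟨j, -⟩ := hc3 0
    exact ⟨⟨fun k => ⟨c j k, hc1 j k⟩, hc2 j⟩⟩
  obtain ⟨c, hc⟩ := hT r F B (fun c b => ∀ x' : Fin na → N,
      θ.Realize (Sum.elim x' (fun q => (c.1 q.1 : Fin ny → N) q.2)) →
        φ.Realize (Sum.elim x' b)) (by
      rintro ⟨y, hy⟩
      refine hd r ⟨fun k => y k, fun S => ?_⟩
      obtain ⟨z, hz⟩ := hy S
      exact ⟨fun q => ((z q.1).1 q.2.1 : Fin ny → N) q.2.2, hz⟩) (by
      rintro ⟨y, hy⟩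
      refine he ⟨fun k q => ((y k).1 q.1 : Fin ny → N) q.2, fun S => ?_⟩
      obtain ⟨z, hz⟩ := hy S
      refine ⟨z, fun k => ?_⟩
      exact Iff.trans (realize_chi θ φ _ _) (hz k)) (by
      intro y
      obtain ⟨c, hc1, hc2, hc3⟩ := hr (Fin.cons b0 (fun i => (y i : Fin ny → N))) (by
        intro i
        refine Fin.cases ?_ (fun i => ?_) i
        · simpa using hb0
        · simp)
      refine ⟨fun j => ⟨fun k => ⟨c j k, hc1 j k⟩, hc2 j⟩, fun i => ?_⟩
      obtain ⟨j, hj⟩ := hc3 i.succ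
      exact ⟨j, by simpa using hj⟩) _ hTr
  exact ⟨fun j k => (c j).1 k, fun j k => ((c j).1 k).2, fun j => (c j).2,
    fun b hb => hc ⟨b, hb⟩⟩

end UniformPart

/-- Proposition 2.4 of the paper; distal "honest definitions". Let `N` be
a distal structure. For every `L`-formula `φ(x, y)` with parameters `e` from `N` there are
an `L`-formula `θ(x, z)` with parameters `f` from `N` and a natural number `k` with
`|z| = k·|y|` (the `z`-variables are indexed by `Fin k × Fin ny`) such that: for all sets
`B ⊆ C` of `|y|`-tuples from `N` and every `|x|`-tuple `a`, if `C` has at least two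
elements, `B` is finite and `N ⊨ φ(a, b)` for all `b ∈ B`, then there is `c ∈ C^k` with
`N ⊨ θ(a, c)` and `N ⊨ ∀x (θ(x, c) → φ(x, b))` for all `b ∈ B`. -/
theorem statement3 {L : FirstOrder.Language.{u, v}} {N : Type w} [L.Structure N]
    (hdistal : IsDistal L N)
    (nx ny np : ℕ) (φ : L.Formula ((Fin nx ⊕ Fin ny) ⊕ Fin np)) (e : Fin np → N) :
    ∃ (k nq : ℕ) (θ : L.Formula ((Fin nx ⊕ (Fin k × Fin ny)) ⊕ Fin nq)) (f : Fin nq → N),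
      ∀ (B C : Set (Fin ny → N)) (a : Fin nx → N),
        C.Nontrivial → B ⊆ C → B.Finite →
        (∀ b ∈ B, φ.Realize (Sum.elim (Sum.elim a b) e)) →
        ∃ g : Fin k → Fin ny → N, (∀ i, g i ∈ C) ∧
          θ.Realize (Sum.elim (Sum.elim a fun p => g p.1 p.2) f) ∧
          ∀ b ∈ B, ∀ a' : Fin nx → N,
            θ.Realize (Sum.elim (Sum.elim a' fun p => g p.1 p.2) f) →
            φ.Realize (Sum.elim (Sum.elim a' b) e) := by
  classical
  by_cases hne : Nonempty N
  swap
  · refine ⟨0, 0, ⊥, Fin.elim0, fun B C a hC => ?_⟩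
    obtain ⟨x, _, y, _, hxy⟩ := hC
    obtain ⟨k, _⟩ := Function.ne_iff.1 hxy
    exact absurd ⟨x k⟩ hne
  let φ' : L.Formula (Fin (nx + np) ⊕ Fin ny) :=
    φ.relabel (Sum.elim (Sum.elim (fun i => Sum.inl (Fin.castAdd np i)) Sum.inr)
      (fun i => Sum.inl (Fin.natAdd nx i)))
  have hφ' : ∀ (a : Fin nx → N) (b : Fin ny → N),
      φ'.Realize (Sum.elim (Fin.append a e) b) ↔ φ.Realize (Sum.elim (Sum.elim a b) e) := by
    intro a b
    rw [Formula.realize_relabel]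
    refine iff_of_eq (congrArg φ.Realize ?_)
    funext g
    rcases g with (g | g) | g <;> simp
  obtain ⟨n, T, θ, hθ⟩ := main_cover hdistal φ'
  obtain ⟨k, ⟨eK⟩⟩ := Finite.exists_equiv_fin ((Fin T × Fin n) ⊕ Fin 2)
  let θ₁ : Fin T → L.Formula ((Fin nx ⊕ (Fin k × Fin ny)) ⊕ Fin np) := fun j =>
    θ.relabel (Sum.elim (Fin.append (fun i => Sum.inl (Sum.inl i)) Sum.inr)
      (fun q => Sum.inl (Sum.inr (eK (Sum.inl (j, q.1)), q.2))))
  have hθ₁ : ∀ j (a : Fin nx → N) (g : Fin k → Fin ny → N),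
      (θ₁ j).Realize (Sum.elim (Sum.elim a fun p => g p.1 p.2) e) ↔
      θ.Realize (Sum.elim (Fin.append a e) (fun q => g (eK (Sum.inl (j, q.1))) q.2)) := by
    intro j a g
    rw [Formula.realize_relabel]
    refine iff_of_eq (congrArg θ.Realize ?_)
    funext h
    rcases h with h | h
    · refine Fin.addCases (fun i => ?_) (fun i => ?_) h <;> simp
    · simp
  let θ₂ : L.Formula ((Fin nx ⊕ (Fin k × Fin ny)) ⊕ Fin np) :=
    (Formula.iInf (fun l : Fin ny =>
      Term.equal (Term.var (Sum.inl (Sum.inr (eK (Sum.inr 0), l))))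
        (Term.var (Sum.inl (Sum.inr (eK (Sum.inr 1), l)))))).not
  have hθ₂ : ∀ (a : Fin nx → N) (g : Fin k → Fin ny → N),
      θ₂.Realize (Sum.elim (Sum.elim a fun p => g p.1 p.2) e) ↔
      ¬ g (eK (Sum.inr 0)) = g (eK (Sum.inr 1)) := by
    intro a g
    rw [Formula.realize_not, Formula.realize_iInf, funext_iff]
    refine not_congr (forall_congr' fun l => ?_)
    rw [Formula.realize_equal]
    rfl
  refine ⟨k, np, Formula.iInf θ₁ ⊔ θ₂, e, fun B C a hC hBC hBf hBa => ?_⟩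
  rcases B.eq_empty_or_nonempty with rfl | hBn
  · obtain ⟨c₀, hc₀, c₁, hc₁, hne'⟩ := hC
    refine ⟨fun i => if eK.symm i = Sum.inr 0 then c₀ else c₁, fun i => ?_, ?_, ?_⟩
    · simp only
      split_ifs
      · exact hc₀
      · exact hc₁
    · rw [Formula.realize_sup]
      right
      refine (hθ₂ a (fun i => if eK.symm i = Sum.inr 0 then c₀ else c₁)).2 ?_
      simpa using hne'
    · intro b hb
      exact absurd hb (Set.notMem_empty b)
  · obtain ⟨c, hc1, hc2, hc3⟩ := hθ B (Fin.append a e) hBf hBn (fun b hb => (hφ' a b).2 (hBa b hb))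
    obtain ⟨b₀, hb₀⟩ := hBn
    let g : Fin k → Fin ny → N := fun i =>
      Sum.elim (fun q : Fin T × Fin n => c q.1 q.2) (fun _ => b₀) (eK.symm i)
    have hg : ∀ q, g (eK (Sum.inl q)) = c q.1 q.2 := fun q => by simp [g]
    have hg' : ∀ q, g (eK (Sum.inr q)) = b₀ := fun q => by simp [g]
    refine ⟨g, fun i => hBC ?_, ?_, ?_⟩
    · simp only [g]
      cases eK.symm i with
      | inl q => exact hc1 _ _
      | inr q => exact hb₀
    · rw [Formula.realize_sup]
      left
      rw [Formula.realize_iInf]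
      intro j
      rw [hθ₁]
      simp only [hg]
      exact hc2 j
    · intro b hb a' ha'
      rw [Formula.realize_sup] at ha'
      rcases ha' with h | h
      · obtain ⟨j, hj⟩ := hc3 b hb
        rw [← hφ']
        refine hj _ ?_
        have h' := Formula.realize_iInf.1 h j
        rw [hθ₁] at h'
        simp only [hg] at h'
        exact h'
      · rw [hθ₂, hg', hg'] at h
        exact absurd rfl h

end DistalPaper
end

section
/- Let M ⪯ N be models of a complete NIP first-order L-theory, with N sufficiently saturated. Let q(y) be a complete type over M and let (b_n)_{n∈ℕ} be a strict Morley sequence in N for q(y). Then: (b_n)_{n∈ℕ} is indiscernible over M; b_0 realizes q(y); and for each n ∈ ℕ: (1) tp(b_{n+1}/M b_0 ... b_n) extends to a complete type over N which is M-invariant, and (2) tp(b_0 ... b_n / M b_{n+1}) extends to a complete type over N which is M-invariant. -/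
open FirstOrder FirstOrder.Language

universe u v w

namespace DistalPaper

variable (L : FirstOrder.Language.{u, v})

section Helpers

variable {L}

theorem sto_relabel {N : Type*} [L.Structure N] {A : Set N} {γ γ' : Type*} {b b' : γ → N}
    (h : SameTypeOver L A b b') (f : γ' → γ) : SameTypeOver L A (b ∘ f) (b' ∘ f) := by
  intro p φ m hm
  have := h p (φ.relabel (Sum.map f id)) m hm
  simpa [Formula.realize_relabel, Sum.elim_comp_map] using this

theorem compactness {K : Type w} [L.Structure K] [Nonempty K] {δ : Type*} {ι : Type (max u v w)}
    (φ : ι → L.Formula (K ⊕ δ))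
    (h : ∀ s : Finset ι, ∃ v : δ → K, ∀ i ∈ s, (φ i).Realize (Sum.elim id v)) :
    ∃ (E : ElemExt.{u, v, w} L K) (v : δ → E.Carrier),
      ∀ i, (φ i).Realize (Sum.elim (⇑E.emb) v) := by
  classical
  choose v hv using h
  let U : Ultrafilter (Finset ι) := Ultrafilter.of Filter.atTop
  have hU : (U : Filter (Finset ι)) ≤ Filter.atTop := Ultrafilter.of_le _
  let P : Type (max u v w) := (U : Filter (Finset ι)).Product (fun _ => K)
  let d : K → P := fun x => ((fun _ => x : Finset ι → K) : (U : Filter (Finset ι)).Product (fun _ => K))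
  let e : K ↪ₑ[L] P :=
    { toFun := d
      map_formula' := by
        intro n ψ x
        have := Ultraproduct.realize_formula_cast (M := fun _ : Finset ι => K) (u := U) ψ
          (fun i _ => x i)
        refine this.trans ?_
        simp }
  refine ⟨⟨P, e⟩, fun j => ((fun s => v s j : Finset ι → K) : (U : Filter (Finset ι)).Product (fun _ => K)), ?_⟩
  intro i
  have := (Ultraproduct.realize_formula_cast (M := fun _ : Finset ι => K) (u := U) (φ i)
    (Sum.elim (fun x _ => x) (fun j s => v s j))).2 ?_
  · have heq : (fun i => (((Sum.elim (fun x _ => x) (fun j s => v s j) : K ⊕ δ → Finset ι → K) i :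
        (U : Filter (Finset ι)).Product (fun _ => K)))) = Sum.elim (⇑e)
        (fun j => ((fun s => v s j : Finset ι → K) : (U : Filter (Finset ι)).Product (fun _ => K))) := by
      funext x
      cases x <;> rfl
    rw [heq] at this
    exact this
  · refine Filter.Eventually.filter_mono hU ?_
    filter_upwards [Filter.eventually_ge_atTop {i}] with s hs
    have := hv s i (hs (Finset.mem_singleton_self i))
    convert this using 1
    funext x
    cases x <;> rfl

theorem finpart {α γ : Type*} (φ : L.Formula (α ⊕ γ)) :
    ∃ (k : ℕ) (t : Fin k → γ) (φ' : L.Formula (α ⊕ Fin k)),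
      ∀ (K : Type w) [L.Structure K] (a : α → K) (c : γ → K),
        φ.Realize (Sum.elim a c) ↔ φ'.Realize (Sum.elim a (c ∘ t)) := by
  classical
  let T : Type _ := {x : γ // Sum.inr x ∈ φ.freeVarFinset}
  have : Finite T := by
    refine Finite.of_injective (fun x : T => (⟨Sum.inr x.1, x.2⟩ : φ.freeVarFinset)) ?_
    intro x y hxy
    have h1 : (x : γ) = y := by simpa [Subtype.ext_iff] using hxy
    exact Subtype.ext h1
  obtain ⟨k, ⟨e⟩⟩ := Finite.exists_equiv_fin T
  refine ⟨k, fun i => (e.symm i).1, φ.restrictFreeVar (fun x => Sum.casesOn x.1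
        (fun x _ => Sum.inl x) (fun x hx => Sum.inr (e ⟨x, hx⟩)) x.2), ?_⟩
  intro K _ a c
  refine iff_comm.1 <| BoundedFormula.realize_restrictFreeVar _ ?_
  rintro ⟨x | x, hx⟩ <;> simp

theorem sto_gen {N : Type*} [L.Structure N] {A : Set N} {γ γ' : Type*} {b b' : γ → N}
    (h : SameTypeOver L A b b') (φ : L.Formula (γ ⊕ γ')) (m : γ' → N) (hm : ∀ i, m i ∈ A) :
    φ.Realize (Sum.elim b m) ↔ φ.Realize (Sum.elim b' m) := by
  obtain ⟨k, t, φ', h'⟩ := finpart φ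
  rw [h' N, h' N]
  exact h k φ' _ (fun i => hm _)

theorem tdnf_gen {N : Type (max u v w)} [L.Structure N] {A P : Set N} {β γ : Type*} {bs : β → N}
    (h : TypeDoesNotForkOver.{u, v, max u v w} L A P bs) (φ : L.Formula (β ⊕ γ)) (c : γ → N) (hc : ∀ i, c i ∈ P)
    (hφ : φ.Realize (Sum.elim bs c)) : ¬ Forks.{u, v, max u v w} L A φ c := by
  obtain ⟨k, t, φ', h'⟩ := finpart φ
  rintro ⟨E, n, m, ψ, d, hd, hd'⟩
  refine h k φ' (c ∘ t) (fun i => hc _) ((h' N _ _).1 hφ) ⟨E, n, m, ψ, d, hd, ?_⟩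
  intro a ha
  exact hd' a ((h' E.Carrier _ _).2 ha)

theorem amalgam {F : Type (max u v w)} [L.Structure F] [Nonempty F] {N : Type w} [L.Structure N]
    {γ : Type w} (f1 : γ → F) (f2 : γ → N)
    (h : ∀ φ : L.Formula γ, φ.Realize f1 ↔ φ.Realize f2) :
    ∃ (G : ElemExt.{u, v, max u v w} L F) (e : N ↪ₑ[L] G.Carrier), ∀ x, G.emb (f1 x) = e (f2 x) := by
  classical
  let ι₁ := Σ n : ℕ, {q : L.Formula (Fin n) × (Fin n → N) // q.1.Realize q.2}
  let Φ : (ι₁ ⊕ ULift.{max u v, w} γ) → L.Formula (F ⊕ N) := Sum.elim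
    (fun i => i.2.1.1.relabel (fun k => Sum.inr (i.2.1.2 k)))
    (fun x => Term.equal (Term.var (Sum.inl (f1 x.down))) (Term.var (Sum.inr (f2 x.down))))
  obtain ⟨G, v, hv⟩ := compactness Φ (by
    intro s
    let V : Finset N := (s.toLeft.biUnion (fun i => Finset.univ.image i.2.1.2)) ∪
      s.toRight.image (fun x => f2 x.down)
    have hV1 : ∀ (i : s.toLeft) (k), i.1.2.1.2 k ∈ V := by
      intro i k
      refine Finset.mem_union_left _ (Finset.mem_biUnion.2 ⟨i.1, i.2, ?_⟩)
      exact Finset.mem_image_of_mem _ (Finset.mem_univ _)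
    have hV2 : ∀ x : s.toRight, f2 x.1.down ∈ V := fun x =>
      Finset.mem_union_right _ (Finset.mem_image_of_mem (fun x : ULift.{max u v, w} γ => f2 x.down) x.2)
    let X : L.Formula (γ ⊕ V) :=
      (Formula.iInf (fun i : s.toLeft => i.1.2.1.1.relabel
        (fun k => (Sum.inr ⟨i.1.2.1.2 k, hV1 i k⟩ : γ ⊕ V)))) ⊓
      (Formula.iInf (fun x : s.toRight => Term.equal (Term.var (Sum.inl x.1.down))
        (Term.var (Sum.inr ⟨f2 x.1.down, hV2 x⟩))))
    have hX : (X.iExs V).Realize f2 := by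
      rw [Formula.realize_iExs]
      refine ⟨fun y => y.1, ?_⟩
      simp only [X, Formula.realize_inf, Formula.realize_iInf, Formula.realize_relabel,
        Formula.realize_equal, Term.realize_var]
      refine ⟨fun i => ?_, fun x => rfl⟩
      exact i.1.2.2
    rw [← h, Formula.realize_iExs] at hX
    obtain ⟨v, hv⟩ := hX
    simp only [X, Formula.realize_inf, Formula.realize_iInf, Formula.realize_relabel,
        Formula.realize_equal, Term.realize_var] at hv
    refine ⟨fun y => if hy : y ∈ V then v ⟨y, hy⟩ else Classical.arbitrary F, ?_⟩
    rintro (i | x) hi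
    · have h1 := hv.1 ⟨i, by simpa using hi⟩
      simp only [Φ, Sum.elim_inl, Formula.realize_relabel]
      convert h1 using 1
      funext k
      have := hV1 ⟨i, by simpa using hi⟩ k
      simp only [Function.comp, Sum.elim_inr]
      rw [dif_pos this]
    · have h1 := hv.2 ⟨x, by simpa using hi⟩
      simp only [Φ, Sum.elim_inr, Formula.realize_equal, Term.realize_var, Sum.elim_inl] at h1 ⊢
      have := hV2 ⟨x, by simpa using hi⟩
      rw [dif_pos this]
      exact h1)
  have key : ∀ (n) (φ : L.Formula (Fin n)) (x : Fin n → N), φ.Realize x → φ.Realize (v ∘ x) := by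
    intro n φ x hx
    have := hv (Sum.inl ⟨n, ⟨(φ, x), hx⟩⟩)
    simp only [Φ, Sum.elim_inl, Formula.realize_relabel] at this
    exact this
  refine ⟨G, ⟨v, ?_⟩, ?_⟩
  · intro n φ x
    refine ⟨fun h => ?_, key n φ x⟩
    by_contra hx
    exact key n φ.not x hx h
  · intro x
    have := hv (Sum.inr ⟨x⟩)
    simp only [Φ, Sum.elim_inr, Formula.realize_equal, Term.realize_var, Sum.elim_inl] at this
    exact this

def pairT {K : Type*} {P : ℕ} (c d : Fin P → K) : Fin (P + P) → K :=
  Sum.elim c d ∘ finSumFinEquiv.symm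

def xorF {α : Type*} {P : ℕ} (φ : L.Formula (α ⊕ Fin P)) : L.Formula (α ⊕ Fin (P + P)) :=
  ((φ.relabel (Sum.map id (finSumFinEquiv ∘ Sum.inl))).iff
    (φ.relabel (Sum.map id (finSumFinEquiv ∘ Sum.inr)))).not

theorem realize_xorF {K : Type*} [L.Structure K] {α : Type*} {P : ℕ} (φ : L.Formula (α ⊕ Fin P))
    (a : α → K) (c d : Fin P → K) :
    (xorF φ).Realize (Sum.elim a (pairT c d)) ↔
      ¬ (φ.Realize (Sum.elim a c) ↔ φ.Realize (Sum.elim a d)) := by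
  have h1 : pairT c d ∘ finSumFinEquiv ∘ Sum.inl = c := by
    funext i; simp only [pairT, Function.comp_apply, Equiv.symm_apply_apply, Sum.elim_inl]
  have h2 : pairT c d ∘ finSumFinEquiv ∘ Sum.inr = d := by
    funext i; simp only [pairT, Function.comp_apply, Equiv.symm_apply_apply, Sum.elim_inr]
  simp only [xorF, Formula.realize_not, Formula.realize_iff, Formula.realize_relabel,
    Sum.elim_comp_map, h1, h2, Function.comp_id]

theorem comp_pairT {K K' : Type*} {P : ℕ} (h : K → K') (c d : Fin P → K) :
    h ∘ pairT c d = pairT (h ∘ c) (h ∘ d) := by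
  rw [pairT, pairT, ← Function.comp_assoc, Sum.comp_elim]

theorem pair_indisc {K : Type*} [L.Structure K] {A : Set K} {P : ℕ} (s : ℕ → Fin P → K)
    (hs : IsIndiscernibleOver L A s) :
    IsIndiscernibleOver L A (fun i => pairT (s (2 * i)) (s (2 * i + 1))) := by
  intro m i j hi hj
  let D : (Fin m → ℕ) → Fin (2 * m) → ℕ := fun i k => 2 * i ⟨k / 2, by omega⟩ + k % 2
  have hD : ∀ i : Fin m → ℕ, StrictMono i → StrictMono (D i) := by
    intro i hi x y hxy
    simp only [D]
    have hxy' : (x : ℕ) < y := hxy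
    rcases Nat.lt_or_ge ((x : ℕ) / 2) ((y : ℕ) / 2) with h | h
    · have := @hi ⟨x / 2, by omega⟩ ⟨y / 2, by omega⟩ h
      omega
    · have h' : (x : ℕ) / 2 = (y : ℕ) / 2 := by omega
      have h2 : (⟨(x : ℕ) / 2, by omega⟩ : Fin m) = ⟨(y : ℕ) / 2, by omega⟩ := Fin.ext h'
      rw [h2]
      omega
  let f : Fin m × Fin (P + P) → Fin (2 * m) × Fin P := fun q =>
    Sum.elim (fun y => (⟨2 * q.1, by omega⟩, y)) (fun y => (⟨2 * q.1 + 1, by omega⟩, y))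
      (finSumFinEquiv.symm q.2)
  have hf : ∀ i : Fin m → ℕ,
      (fun q : Fin (2 * m) × Fin P => s (D i q.1) q.2) ∘ f =
      fun q : Fin m × Fin (P + P) => pairT (s (2 * i q.1)) (s (2 * i q.1 + 1)) q.2 := by
    intro i
    funext q
    obtain ⟨k, x⟩ := q
    obtain ⟨x, rfl⟩ := finSumFinEquiv.surjective x
    have e1 : (2 * (k : ℕ)) / 2 = k := by omega
    have e2 : (2 * (k : ℕ) + 1) / 2 = k := by omega
    have e3 : (2 * (k : ℕ) + 1) % 2 = 1 := by omega
    rcases x with x | x <;> simp [f, D, pairT, e2, e3, -finSumFinEquiv_apply_right, -finSumFinEquiv_apply_left]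
  have := sto_relabel (hs (2 * m) (D i) (D j) (hD i hi) (hD j hj)) f
  rw [hf, hf] at this
  exact this

theorem nip_divides {N : Type w} [L.Structure N] [Nonempty N] (hNIP : IsNIP L N)
    {K : Type (max u v w)} [L.Structure K] (h : N ↪ₑ[L] K) (A : Set K) {α : Type*} [Finite α]
    {P : ℕ} (φ : L.Formula (α ⊕ Fin P)) (s : ℕ → Fin P → K) (hs : IsIndiscernibleOver L A s) :
    Divides.{u, v, max u v w} L A (xorF φ) (pairT (s 0) (s 1)) := by
  classical
  have : Nonempty K := ⟨h (Classical.arbitrary N)⟩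
  refine ⟨⟨K, ElementaryEmbedding.refl L K⟩, fun i => pairT (s (2 * i)) (s (2 * i + 1)), ?_, ?_, ?_⟩
  · have e : ⇑(ElementaryEmbedding.refl L K) '' A = A := by ext; simp
    rw [e]
    exact pair_indisc s hs
  · intro p φ m hm
    exact Iff.rfl
  intro hcons
  have hfin : ∀ (n : ℕ) (S : Set ℕ), ∃ a : α → K, ∀ i : Fin n,
      (φ.Realize (Sum.elim a (s i)) ↔ (i : ℕ) ∈ S) := by
    intro n S
    obtain ⟨a, ha⟩ := hcons (Finset.range n)
    replace ha : ∀ i < n, ¬ (φ.Realize (Sum.elim a (s (2 * i))) ↔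
        φ.Realize (Sum.elim a (s (2 * i + 1)))) := by
      intro i hi
      exact (realize_xorF φ a _ _).1 (ha i (Finset.mem_range.2 hi))
    have hc : ∀ i : Fin n, ∃ k : ℕ, 2 * (i : ℕ) ≤ k ∧ k ≤ 2 * (i : ℕ) + 1 ∧
        (φ.Realize (Sum.elim a (s k)) ↔ (i : ℕ) ∈ S) := by
      intro i
      have := ha i i.2
      by_cases h1 : φ.Realize (Sum.elim a (s (2 * (i : ℕ)))) ↔ (i : ℕ) ∈ S
      · exact ⟨_, le_rfl, by omega, h1⟩
      · exact ⟨2 * i + 1, by omega, le_rfl, by tauto⟩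
    choose σ h1 h2 h3 using hc
    have hσ : StrictMono σ := by
      intro x y hxy
      have := h2 x
      have := h1 y
      have : (x : ℕ) < y := hxy
      omega
    let X : L.Formula ((Fin n × Fin P) ⊕ α) := Formula.iInf (fun i : Fin n =>
      if (i : ℕ) ∈ S then φ.relabel (Sum.elim Sum.inr (fun k => Sum.inl (i, k)))
      else (φ.relabel (Sum.elim Sum.inr (fun k => Sum.inl (i, k)))).not)
    have hX : ∀ (τ : Fin n → ℕ) (a : α → K),
        X.Realize (Sum.elim (fun q : Fin n × Fin P => s (τ q.1) q.2) a) ↔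
        ∀ i, (φ.Realize (Sum.elim a (s (τ i))) ↔ (i : ℕ) ∈ S) := by
      intro τ a
      simp only [X, Formula.realize_iInf]
      refine forall_congr' fun i => ?_
      have e : (Sum.elim (fun q : Fin n × Fin P => s (τ q.1) q.2) a) ∘
          (Sum.elim Sum.inr (fun k => Sum.inl (i, k))) = Sum.elim a (s (τ i)) := by
        funext x; cases x <;> rfl
      split_ifs with hi
      · rw [Formula.realize_relabel, e]; simp [hi]
      · rw [Formula.realize_not, Formula.realize_relabel, e]; simp [hi]
    have hE := hs n σ (fun i => (i : ℕ)) hσ (fun _ _ h => h) 0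
      ((X.iExs α).relabel Sum.inl) Fin.elim0 (fun i => i.elim0)
    simp only [Formula.realize_relabel, Sum.elim_comp_inl, Formula.realize_iExs] at hE
    obtain ⟨a', ha'⟩ := hE.1 ⟨a, (hX σ a).2 h3⟩
    exact ⟨a', (hX _ a').1 ha'⟩
  obtain ⟨k, ⟨e⟩⟩ := Finite.exists_equiv_fin α
  let Ψ : ULift.{max u v w} (Set ℕ × ℕ) → L.Formula (K ⊕ (Set ℕ × α)) := fun q =>
    if q.down.2 ∈ q.down.1 then
      φ.relabel (Sum.elim (fun x => Sum.inr (q.down.1, x)) (fun i => Sum.inl (s q.down.2 i)))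
    else (φ.relabel (Sum.elim (fun x => Sum.inr (q.down.1, x))
      (fun i => Sum.inl (s q.down.2 i)))).not
  have hΨ : ∀ (q : ULift.{max u v w} (Set ℕ × ℕ)) (K' : Type (max u v w)) [L.Structure K']
      (f : K → K') (v : Set ℕ × α → K'),
      (Ψ q).Realize (Sum.elim f v) ↔
      (φ.Realize (Sum.elim (fun x => v (q.down.1, x)) (f ∘ s q.down.2)) ↔
        q.down.2 ∈ q.down.1) := by
    intro q K' _ f v
    have e : (Sum.elim f v) ∘
        (Sum.elim (fun x => Sum.inr (q.down.1, x)) (fun i => Sum.inl (s q.down.2 i))) =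
        Sum.elim (fun x => v (q.down.1, x)) (f ∘ s q.down.2) := by
      funext x; cases x <;> rfl
    simp only [Ψ]
    split_ifs with hi
    · rw [Formula.realize_relabel, e]; simp [hi]
    · rw [Formula.realize_not, Formula.realize_relabel, e]; simp [hi]
  obtain ⟨E, v, hv⟩ := compactness.{u, v, max u v w} Ψ (by
    intro t
    obtain ⟨n, hn⟩ : ∃ n : ℕ, ∀ q ∈ t, q.down.2 < n := by
      refine ⟨t.sup (fun q => q.down.2) + 1, fun q hq => ?_⟩
      have := Finset.le_sup (f := fun q : ULift.{max u v w} (Set ℕ × ℕ) => q.down.2) hq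
      omega
    choose a ha using hfin n
    refine ⟨fun q => a q.1 q.2, fun q hq => ?_⟩
    rw [hΨ]
    exact ha q.down.1 ⟨q.down.2, hn q hq⟩)
  have hm : E.Carrier ⊨ L.completeTheory N := by
    refine (ElementaryEmbedding.theory_model_iff (E.emb.comp h) _).1 inferInstance
  have : Nonempty E.Carrier := ⟨E.emb (Classical.arbitrary K)⟩
  refine hNIP P k (φ.relabel (Sum.elim (Sum.inr ∘ e) Sum.inl))
    ⟨Theory.ModelType.of _ E.Carrier, fun i => E.emb ∘ s i, fun S x => v (S, e.symm x), ?_⟩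
  intro i S
  have := (hΨ ⟨(S, i)⟩ E.Carrier E.emb v).1 (hv ⟨(S, i)⟩)
  refine Iff.trans ?_ this
  rw [Formula.realize_relabel]
  apply iff_of_eq
  congr 1
  funext x
  rcases x with x | x
  · simp
  · rfl

/-- `d` realizes the coheir given by the ultrafilter `U` (on tuples of `M`) over the set `A`. -/
def RealizesUlt {N : Type w} [L.Structure N] (M : Set N) {p : ℕ} (U : Ultrafilter (Fin p → M))
    (A : Set N) (d : Fin p → N) : Prop :=
  ∀ (k : ℕ) (ψ : L.Formula (Fin p ⊕ Fin k)) (c : Fin k → N), (∀ i, c i ∈ A) →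
    (∀ᶠ e in (U : Filter (Fin p → M)), ψ.Realize (Sum.elim (fun i => (e i : N)) c)) →
    ψ.Realize (Sum.elim d c)

theorem RealizesUlt.mono {N : Type w} [L.Structure N] {M : Set N} {p : ℕ}
    {U : Ultrafilter (Fin p → M)} {A B : Set N} {d : Fin p → N}
    (h : RealizesUlt (L := L) M U B d) (hAB : A ⊆ B) : RealizesUlt (L := L) M U A d :=
  fun k ψ c hc hU => h k ψ c (fun i => hAB (hc i)) hU

theorem RealizesUlt.gen {N : Type w} [L.Structure N] {M : Set N} {p : ℕ}
    {U : Ultrafilter (Fin p → M)} {A : Set N} {d : Fin p → N}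
    (h : RealizesUlt (L := L) M U A d) {γ : Type*} (ψ : L.Formula (Fin p ⊕ γ)) (c : γ → N)
    (hc : ∀ i, c i ∈ A) :
    (∀ᶠ e in (U : Filter (Fin p → M)), ψ.Realize (Sum.elim (fun i => (e i : N)) c)) ↔
    ψ.Realize (Sum.elim d c) := by
  obtain ⟨k, t, φ', h'⟩ := finpart.{u, v, w} ψ
  simp only [h' N]
  constructor
  · exact h k φ' _ (fun i => hc _)
  · intro hr
    by_contra hn
    rw [← Ultrafilter.eventually_not] at hn
    exact h k φ'.not _ (fun i => hc _) hn hr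

theorem exists_realizesUlt {N : Type w} [L.Structure N] (M : Set N)
    (hsat : IsSaturated L (Order.succ (Cardinal.mk M)) N) {p : ℕ} (U : Ultrafilter (Fin p → M))
    (B : Set N) (hB : B.Finite) : ∃ d, RealizesUlt (L := L) M U (M ∪ B) d := by
  by_cases hM : Finite M
  · obtain ⟨e, he⟩ := Ultrafilter.eq_pure_of_finite U
    refine ⟨fun i => e i, fun k ψ c _ h => ?_⟩
    rw [he] at h
    exact h
  · have hinf : Infinite M := not_finite_iff_infinite.1 hM
    have hcard : Cardinal.mk ↥(M ∪ B) < Order.succ (Cardinal.mk M) := by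
      rw [Order.lt_succ_iff]
      refine (Cardinal.mk_union_le _ _).trans ?_
      refine Cardinal.add_le_of_le (Cardinal.aleph0_le_mk M) le_rfl ?_
      exact ((Cardinal.lt_aleph0_iff_set_finite.2 hB).le).trans (Cardinal.aleph0_le_mk M)
    let ι : Type (max u v w) := Σ k : ℕ, {q : L.Formula (Fin p ⊕ Fin k) × (Fin k → N) //
      (∀ i, q.2 i ∈ M ∪ B) ∧
      ∀ᶠ e in (U : Filter (Fin p → M)), q.1.Realize (Sum.elim (fun i => (e i : N)) q.2)}
    obtain ⟨d, hd⟩ := hsat (M ∪ B) hcard p ι (fun i => i.1) (fun i => i.2.1.1) (fun i => i.2.1.2)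
      (fun i => i.2.2.1) (by
        intro s
        have : ∀ᶠ e in (U : Filter (Fin p → M)), ∀ i ∈ s,
            i.2.1.1.Realize (Sum.elim (fun i => (e i : N)) i.2.1.2) :=
          (Filter.eventually_all_finset s).2 (fun i _ => i.2.2.2)
        obtain ⟨e, he⟩ := this.exists
        exact ⟨_, he⟩)
    exact ⟨d, fun k ψ c hc h => hd ⟨k, ⟨(ψ, c), hc, h⟩⟩⟩

theorem ult_indisc {N : Type w} [L.Structure N] {M : Set N} {p : ℕ}
    {U : Ultrafilter (Fin p → M)} (s : ℕ → Fin p → N)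
    (h : ∀ n, RealizesUlt (L := L) M U (M ∪ ⋃ k : Fin n, Set.range (s k)) (s n)) :
    IsIndiscernibleOver L M s := by
  intro m
  induction m with
  | zero =>
    intro i j _ _ k φ a _
    have : (fun q : Fin 0 × Fin p => s (i q.1) q.2) = fun q => s (j q.1) q.2 := by
      funext q; exact q.1.elim0
    rw [this]
  | succ m ih =>
    intro i j hi hj k φ a ha
    let r : (Fin (m + 1) × Fin p) ⊕ Fin k → Fin p ⊕ ((Fin m × Fin p) ⊕ Fin k) :=
      Sum.elim (fun q => Fin.lastCases (motive := fun _ => Fin p ⊕ ((Fin m × Fin p) ⊕ Fin k))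
        (Sum.inl q.2) (fun x => Sum.inr (Sum.inl (x, q.2))) q.1) (fun x => Sum.inr (Sum.inr x))
    have main : ∀ i : Fin (m + 1) → ℕ, StrictMono i →
        (φ.Realize (Sum.elim (fun q : Fin (m + 1) × Fin p => s (i q.1) q.2) a) ↔
        ∀ᶠ e in (U : Filter (Fin p → M)), (φ.relabel r).Realize (Sum.elim (fun x => (e x : N))
          (Sum.elim (fun q : Fin m × Fin p => s (i q.1.castSucc) q.2) a))) := by
      intro i hi
      rw [RealizesUlt.gen (h (i (Fin.last m)))]
      · rw [Formula.realize_relabel]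
        apply iff_of_eq
        congr 1
        funext x
        rcases x with ⟨x, y⟩ | x
        · induction x using Fin.lastCases <;> simp [r]
        · rfl
      · rintro (⟨x, y⟩ | x)
        · refine Or.inr (Set.mem_iUnion.2 ⟨⟨i x.castSucc, hi (Fin.castSucc_lt_last x)⟩, ?_⟩)
          exact ⟨y, rfl⟩
        · exact Or.inl (ha x)
    rw [main i hi, main j hj]
    refine Filter.eventually_congr (Filter.Eventually.of_forall fun e => ?_)
    let r' : Fin p ⊕ ((Fin m × Fin p) ⊕ Fin k) → (Fin m × Fin p) ⊕ (Fin p ⊕ Fin k) :=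
      Sum.elim (fun x => Sum.inr (Sum.inl x)) (Sum.elim Sum.inl (fun x => Sum.inr (Sum.inr x)))
    have := sto_gen (ih (fun x => i x.castSucc) (fun x => j x.castSucc)
      (hi.comp (Fin.strictMono_castSucc)) (hj.comp (Fin.strictMono_castSucc)))
      ((φ.relabel r).relabel r') (Sum.elim (fun x => (e x : N)) a) (by
        rintro (x | x)
        · exact (e x).2
        · exact ha x)
    rw [Formula.realize_relabel, Formula.realize_relabel (g := r')] at this
    convert this using 2
    · funext x; rcases x with x | x | x <;> rfl
    · funext x; rcases x with x | x | x <;> rfl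

theorem exists_coheir {N : Type w} [L.Structure N] (M : L.ElementarySubstructure N) {p : ℕ}
    (c : Fin p → N) :
    ∃ U : Ultrafilter (Fin p → (M : Set N)), RealizesUlt (L := L) (M : Set N) U M c := by
  let ι := Σ k : ℕ, {q : L.Formula (Fin p ⊕ Fin k) × (Fin k → M) //
    q.1.Realize (Sum.elim c (fun i => (q.2 i : N)))}
  let S : ι → Set (Fin p → (M : Set N)) := fun i =>
    {e | i.2.1.1.Realize (Sum.elim (fun x => (e x : N)) (fun x => (i.2.1.2 x : N)))}
  have hne : ∀ t : Finset ι, ∃ e, ∀ i ∈ t, e ∈ S i := by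
    intro t
    let X : L.Formula ((M : Set N) ⊕ Fin p) := Formula.iInf (fun i : t =>
      i.1.2.1.1.relabel (Sum.elim Sum.inr (fun x => Sum.inl (i.1.2.1.2 x))))
    have h1 : (X.iExs (Fin p)).Realize (fun x : (M : Set N) => (x : N)) := by
      rw [Formula.realize_iExs]
      refine ⟨c, ?_⟩
      simp only [X, Formula.realize_iInf, Formula.realize_relabel]
      intro i
      convert i.1.2.2 using 1
      funext x; cases x <;> rfl
    have h2 : (X.iExs (Fin p)).Realize (id : M → M) :=
      (M.subtype.map_formula (X.iExs (Fin p)) id).1 h1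
    rw [Formula.realize_iExs] at h2
    obtain ⟨e, he⟩ := h2
    refine ⟨e, fun i hi => ?_⟩
    simp only [X, Formula.realize_iInf, Formula.realize_relabel] at he
    have h3 := he ⟨i, hi⟩
    have h4 := (M.subtype.map_formula _ _).2 h3
    simp only [S, Set.mem_ofPred_eq]
    convert h4 using 1
    funext x; cases x <;> rfl
  choose g hg using hne
  classical
  let U : Ultrafilter (Fin p → (M : Set N)) :=
    (Ultrafilter.of (Filter.atTop : Filter (Finset ι))).map g
  have hS : ∀ i, ∀ᶠ e in (U : Filter (Fin p → (M : Set N))), e ∈ S i := by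
    intro i
    have h1 : ∀ᶠ t in (Filter.atTop : Filter (Finset ι)), g t ∈ S i := by
      filter_upwards [Filter.eventually_ge_atTop {i}] with t ht
      exact hg t i (ht (Finset.mem_singleton_self i))
    exact h1.filter_mono (Ultrafilter.of_le _)
  refine ⟨U, ?_⟩
  intro k ψ a ha hU
  by_contra hn
  obtain ⟨e, he1, he2⟩ := (hU.and (hS ⟨k, ⟨(ψ.not, fun i => ⟨a i, ha i⟩), hn⟩⟩)).exists
  exact he2 he1

theorem exists_mid {N : Type w} [L.Structure N] (M : L.ElementarySubstructure N)
    (hsat : IsSaturated L (Order.succ (Cardinal.mk M)) N) {p : ℕ} (c c' : Fin p → N)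
    (hcc : SameTypeOver L (M : Set N) c c') :
    ∃ s s' : ℕ → Fin p → N, s 0 = c ∧ s' 0 = c' ∧ s 1 = s' 1 ∧
      IsIndiscernibleOver L (M : Set N) s ∧ IsIndiscernibleOver L (M : Set N) s' := by
  classical
  obtain ⟨U, hU⟩ := exists_coheir M c
  have hU' : RealizesUlt (L := L) (M : Set N) U M c' := by
    intro k ψ a ha h
    exact (hcc k ψ a ha).1 (hU k ψ a ha h)
  have hex : ∀ B : {B : Set N // B.Finite}, ∃ d, RealizesUlt (L := L) (M : Set N) U (M ∪ B.1) d :=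
    fun B => exists_realizesUlt (M : Set N) hsat U B.1 B.2
  choose f hf using hex
  let st : ℕ → {B : Set N // B.Finite} := fun n => Nat.rec
    ⟨Set.range c ∪ Set.range c', (Set.finite_range c).union (Set.finite_range c')⟩
    (fun _ B => ⟨B.1 ∪ Set.range (f B), B.2.union (Set.finite_range _)⟩) n
  have hst : ∀ n, (st (n + 1)).1 = (st n).1 ∪ Set.range (f (st n)) := fun n => rfl
  have hmono : Monotone (fun n => (st n).1) :=
    monotone_nat_of_le_succ (fun n => by rw [hst]; exact Set.subset_union_left)
  have aux : ∀ c0 : Fin p → N, RealizesUlt (L := L) (M : Set N) U M c0 →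
      Set.range c0 ⊆ (st 0).1 →
      IsIndiscernibleOver L (M : Set N)
        (fun n => Nat.casesOn n c0 (fun n => f (st n)) : ℕ → Fin p → N) := by
    intro c0 h0 hr
    refine ult_indisc (U := U) _ ?_
    rintro (_ | n)
    · refine RealizesUlt.mono h0 ?_
      simp
    · refine RealizesUlt.mono (hf (st n)) ?_
      refine Set.union_subset_union_right _ (Set.iUnion_subset ?_)
      rintro ⟨_ | k, hk⟩
      · exact hr.trans (hmono (Nat.zero_le n))
      · refine Set.Subset.trans ?_ (hmono (show k + 1 ≤ n by omega))
        simp only [hst]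
        exact Set.subset_union_right
  exact ⟨fun n => Nat.casesOn n c (fun n => f (st n)), fun n => Nat.casesOn n c' (fun n => f (st n)),
    rfl, rfl, rfl, aux c hU Set.subset_union_left, aux c' hU' Set.subset_union_right⟩

theorem indisc_map {N : Type*} [L.Structure N] {K : Type*} [L.Structure K] (h : N ↪ₑ[L] K)
    {A : Set N} {γ : Type*} {s : ℕ → γ → N} (hs : IsIndiscernibleOver L A s) :
    IsIndiscernibleOver L (⇑h '' A) (fun i => ⇑h ∘ s i) := by
  intro m i j hi hj p φ a ha
  choose a' ha' ha'' using ha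
  obtain rfl : (⇑h ∘ a') = a := funext ha''
  have := hs m i j hi hj p φ a' ha'
  rw [← h.map_formula, ← h.map_formula φ (Sum.elim (fun q => s (j q.1) q.2) a')] at this
  rw [Sum.comp_elim, Sum.comp_elim] at this
  exact this

def padT {N : Type*} {p : ℕ} (P : ℕ) (e : N) (c : Fin p → N) : Fin P → N :=
  fun k => if h : (k : ℕ) < p then c ⟨k, h⟩ else e

theorem sto_pad {N : Type*} [L.Structure N] {A : Set N} {p : ℕ} (P : ℕ) {e : N} (he : e ∈ A)
    {c c' : Fin p → N} (h : SameTypeOver L A c c') :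
    SameTypeOver L A (padT P e c) (padT P e c') := by
  intro k φ m hm
  let r : Fin P ⊕ Fin k → Fin p ⊕ Option (Fin k) :=
    Sum.elim (fun x => if h : (x : ℕ) < p then Sum.inl ⟨x, h⟩ else Sum.inr none)
      (fun x => Sum.inr (some x))
  have hr : ∀ c : Fin p → N,
      Sum.elim c (fun o : Option (Fin k) => o.elim e m) ∘ r = Sum.elim (padT P e c) m := by
    intro c
    funext x
    rcases x with x | x
    · simp only [r, padT, Function.comp_apply, Sum.elim_inl]
      split_ifs <;> rfl
    · rfl
  have := sto_gen h (φ.relabel r) (fun o : Option (Fin k) => o.elim e m) (by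
    rintro (_ | x)
    · exact he
    · exact hm x)
  rw [Formula.realize_relabel, Formula.realize_relabel, hr, hr] at this
  exact this

theorem padT_castLE {N : Type*} {p P : ℕ} (hp : p ≤ P) (e : N) (c : Fin p → N) :
    padT P e c ∘ Fin.castLE hp = c := by
  funext x
  simp [padT]

theorem forks_of_divides {K : Type (max u v w)} [L.Structure K] {A : Set K} {α : Type*} {m : ℕ}
    {φ : L.Formula (α ⊕ Fin m)} {c : Fin m → K} (h : Divides.{u, v, max u v w} L A φ c) :
    Forks.{u, v, max u v w} L A φ c := by
  refine ⟨⟨K, ElementaryEmbedding.refl L K⟩, 1, m, fun _ => φ, fun _ => c, ?_, ?_⟩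
  · intro _
    have e : ⇑(ElementaryEmbedding.refl L K) '' A = A := by ext; simp
    rw [e]
    exact h
  · intro a ha
    exact ⟨0, ha⟩

theorem inv_of_nonforking {N : Type w} [L.Structure N] [Nonempty N] (hNIP : IsNIP L N)
    (M : L.ElementarySubstructure N)
    (hsat : IsSaturated L (Order.succ (Cardinal.mk M)) N)
    {K : Type (max u v w)} [L.Structure K] (g : N ↪ₑ[L] K) (P : Set K) (hP : ∀ x, g x ∈ P)
    {α : Type*} [Finite α] (a' : α → K)
    (h2 : TypeDoesNotForkOver.{u, v, max u v w} L (⇑g '' (M : Set N)) P a')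
    (p : ℕ) (φ : L.Formula (α ⊕ Fin p)) (c c' : Fin p → N)
    (hcc : SameTypeOver L (M : Set N) c c') :
    φ.Realize (Sum.elim a' (⇑g ∘ c)) ↔ φ.Realize (Sum.elim a' (⇑g ∘ c')) := by
  obtain ⟨s, s', hs0, hs0', hs1, hs, hs'⟩ := exists_mid M hsat c c' hcc
  have key : ∀ s : ℕ → Fin p → N, IsIndiscernibleOver L (M : Set N) s →
      (φ.Realize (Sum.elim a' (⇑g ∘ s 0)) ↔ φ.Realize (Sum.elim a' (⇑g ∘ s 1))) := by
    intro s hs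
    by_contra hn
    have hd := nip_divides hNIP g (⇑g '' (M : Set N)) φ (fun i => ⇑g ∘ s i) (indisc_map g hs)
    refine h2 _ (xorF φ) _ ?_ ((realize_xorF φ a' _ _).2 hn) (forks_of_divides hd)
    intro i
    rw [← comp_pairT]
    exact hP _
  rw [← hs0, ← hs0', key s hs, key s' hs', hs1]

theorem core2 {N : Type w} [L.Structure N] [Nonempty N] (hNIP : IsNIP L N)
    (M : L.ElementarySubstructure N)
    {K : Type (max u v w)} [L.Structure K] (g : N ↪ₑ[L] K) {ny : ℕ} (b : Fin ny → N)
    {δ : Type*} [Finite δ] (bs : δ → N) (a' : Fin ny → K)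
    (h1 : SameTypeOver L (⇑g '' ((M : Set N) ∪ Set.range bs)) a' (⇑g ∘ b))
    (h3 : TypeDoesNotForkOver.{u, v, max u v w} L (⇑g '' (M : Set N))
      ((⇑g '' (M : Set N)) ∪ Set.range a') (⇑g ∘ bs))
    (Θ : L.Formula (δ ⊕ (M ⊕ Fin ny)))
    (hΘ : Θ.Realize (Sum.elim bs (Sum.elim (fun x : M => (x : N)) b)))
    {J : Type} [Finite J] (P : ℕ) (φ : J → L.Formula (δ ⊕ Fin P)) (c d : J → Fin P → N)
    (hcd : ∀ j, ∃ s : ℕ → Fin P → N, s 0 = c j ∧ s 1 = d j ∧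
      IsIndiscernibleOver L (M : Set N) s) :
    ∃ x : δ → N, Θ.Realize (Sum.elim x (Sum.elim (fun x : M => (x : N)) b)) ∧
      ∀ j, ((φ j).Realize (Sum.elim x (c j)) ↔ (φ j).Realize (Sum.elim x (d j))) := by
  have hK : Nonempty K := ⟨g (Classical.arbitrary N)⟩
  obtain ⟨G, e, he⟩ := amalgam.{u, v, w} (L := L) (γ := M ⊕ Fin ny)
    (Sum.elim (fun x : M => g x) a') (Sum.elim (fun x : M => (x : N)) b) (by
      intro ψ
      have := sto_gen h1 (ψ.relabel Sum.swap) (fun x : M => g x) (fun x => ⟨x, Or.inl x.2, rfl⟩)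
      rw [Formula.realize_relabel, Formula.realize_relabel] at this
      rw [← g.map_formula]
      convert this using 2
      · funext x; rcases x with x | x <;> rfl
      · funext x; rcases x with x | x <;> rfl)
  have heM : ∀ x ∈ (M : Set N), G.emb (g x) = e x := fun x hx => he (Sum.inl ⟨x, hx⟩)
  have hA : ⇑G.emb '' (⇑g '' (M : Set N)) = ⇑e '' (M : Set N) := by
    rw [Set.image_image]
    exact Set.image_congr heM
  have hΘ' : Θ.Realize (Sum.elim (⇑g ∘ bs) (Sum.elim (fun x : M => g x) a')) := by
    let r : δ ⊕ (M ⊕ Fin ny) → Fin ny ⊕ (δ ⊕ M) :=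
      Sum.elim (fun x => Sum.inr (Sum.inl x)) (Sum.elim (fun x => Sum.inr (Sum.inr x)) Sum.inl)
    have := sto_gen h1 (Θ.relabel r) (Sum.elim (⇑g ∘ bs) (fun x : M => g x)) (by
      rintro (x | x)
      · exact ⟨bs x, Or.inr ⟨x, rfl⟩, rfl⟩
      · exact ⟨x, Or.inl x.2, rfl⟩)
    rw [Formula.realize_relabel, Formula.realize_relabel] at this
    rw [← g.map_formula] at hΘ
    have e1 : (Sum.elim a' (Sum.elim (⇑g ∘ bs) (fun x : M => g x))) ∘ r =
        Sum.elim (⇑g ∘ bs) (Sum.elim (fun x : M => g x) a') := by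
      funext x; rcases x with x | x | x <;> rfl
    have e2 : (Sum.elim (⇑g ∘ b) (Sum.elim (⇑g ∘ bs) (fun x : M => g x))) ∘ r =
        ⇑g ∘ (Sum.elim bs (Sum.elim (fun x : M => (x : N)) b)) := by
      funext x; rcases x with x | x | x <;> rfl
    rw [e1, e2] at this
    exact this.2 hΘ
  have hnf := tdnf_gen h3 Θ (Sum.elim (fun x : M => g x) a') (by
    rintro (x | x)
    · exact Or.inl ⟨x, x.2, rfl⟩
    · exact Or.inr ⟨x, rfl⟩) hΘ'
  have hc : ⇑G.emb ∘ (Sum.elim (fun x : M => g x) a') =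
      ⇑e ∘ (Sum.elim (fun x : M => (x : N)) b) := funext he
  have hG : ∃ x : δ → G.Carrier, Θ.Realize
      (Sum.elim x (⇑e ∘ (Sum.elim (fun x : M => (x : N)) b))) ∧
      ∀ j, ((φ j).Realize (Sum.elim x (⇑e ∘ c j)) ↔ (φ j).Realize (Sum.elim x (⇑e ∘ d j))) := by
    by_contra hno
    push Not at hno
    obtain ⟨k, ⟨ε⟩⟩ := Finite.exists_equiv_fin J
    apply hnf
    refine ⟨G, k, P + P, fun i => xorF (φ (ε.symm i)),
      fun i => pairT (⇑e ∘ c (ε.symm i)) (⇑e ∘ d (ε.symm i)), ?_, ?_⟩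
    · intro i
      obtain ⟨s, hs0, hs1, hs⟩ := hcd (ε.symm i)
      beta_reduce
      rw [hA, ← hs0, ← hs1]
      exact nip_divides hNIP e _ _ (fun i => ⇑e ∘ s i) (indisc_map e hs)
    · intro a ha
      rw [hc] at ha
      obtain ⟨j, hj⟩ := hno a ha
      refine ⟨ε j, ?_⟩
      rw [realize_xorF, Equiv.symm_apply_apply]
      tauto
  let X : L.Formula (N ⊕ δ) :=
    (Θ.relabel (Sum.elim Sum.inr (fun y => Sum.inl (Sum.elim (fun x : M => (x : N)) b y)))) ⊓
    Formula.iInf (fun j =>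
      ((φ j).relabel (Sum.elim Sum.inr (fun y => Sum.inl (c j y)))).iff
      ((φ j).relabel (Sum.elim Sum.inr (fun y => Sum.inl (d j y)))))
  have hX : ∀ (K' : Type (max u v w)) [L.Structure K'] (f : N → K') (x : δ → K'),
      X.Realize (Sum.elim f x) ↔ Θ.Realize
      (Sum.elim x (f ∘ (Sum.elim (fun x : M => (x : N)) b))) ∧
      ∀ j, ((φ j).Realize (Sum.elim x (f ∘ c j)) ↔ (φ j).Realize (Sum.elim x (f ∘ d j))) := by
    intro K' _ f x
    have e1 : ∀ (q : M ⊕ Fin ny → N), (Sum.elim f x) ∘ (Sum.elim Sum.inr (fun y => Sum.inl (q y))) =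
        Sum.elim x (f ∘ q) := by
      intro q
      funext z; cases z <;> rfl
    have e2 : ∀ (q : Fin P → N), (Sum.elim f x) ∘ (Sum.elim Sum.inr (fun y => Sum.inl (q y))) =
        Sum.elim x (f ∘ q) := by
      intro q
      funext z; cases z <;> rfl
    simp only [X, Formula.realize_inf, Formula.realize_iInf, Formula.realize_iff,
      Formula.realize_relabel, e1, e2]
  have hX0 : ∀ (x : δ → N),
      X.Realize (Sum.elim id x) ↔ Θ.Realize
      (Sum.elim x (Sum.elim (fun x : M => (x : N)) b)) ∧
      ∀ j, ((φ j).Realize (Sum.elim x (c j)) ↔ (φ j).Realize (Sum.elim x (d j))) := by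
    intro x
    have e1 : ∀ (q : M ⊕ Fin ny → N), (Sum.elim id x) ∘ (Sum.elim Sum.inr (fun y => Sum.inl (q y))) =
        Sum.elim x q := by
      intro q
      funext z; cases z <;> rfl
    have e2 : ∀ (q : Fin P → N), (Sum.elim id x) ∘ (Sum.elim Sum.inr (fun y => Sum.inl (q y))) =
        Sum.elim x q := by
      intro q
      funext z; cases z <;> rfl
    simp only [X, Formula.realize_inf, Formula.realize_iInf, Formula.realize_iff,
      Formula.realize_relabel, e1, e2]
  obtain ⟨x, hx⟩ := hG
  have h5 : (X.iExs δ).Realize (⇑e ∘ id) := by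
    rw [Formula.realize_iExs]
    exact ⟨x, (hX _ _ _).2 hx⟩
  rw [e.map_formula, Formula.realize_iExs] at h5
  obtain ⟨x, hx⟩ := h5
  exact ⟨x, (hX0 x).1 hx⟩

theorem part2 {N : Type w} [L.Structure N] [Nonempty N] (hNIP : IsNIP L N)
    (M : L.ElementarySubstructure N)
    (hsat : IsSaturated L (Order.succ (Cardinal.mk M)) N)
    {K : Type (max u v w)} [L.Structure K] (g : N ↪ₑ[L] K) {ny : ℕ} (b : Fin ny → N)
    {δ : Type} [Finite δ] (bs : δ → N) (a' : Fin ny → K)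
    (h1 : SameTypeOver L (⇑g '' ((M : Set N) ∪ Set.range bs)) a' (⇑g ∘ b))
    (h3 : TypeDoesNotForkOver.{u, v, max u v w} L (⇑g '' (M : Set N))
      ((⇑g '' (M : Set N)) ∪ Set.range a') (⇑g ∘ bs)) :
    ExtendsToInvariantType L (M : Set N) ((M : Set N) ∪ Set.range b) bs := by
  classical
  have hMne : Nonempty M := inferInstance
  obtain ⟨e0⟩ := hMne
  let pr : M ⊕ Fin ny → N := Sum.elim (fun x : M => (x : N)) b
  let ι₁ := {θ : L.Formula (δ ⊕ (M ⊕ Fin ny)) // θ.Realize (Sum.elim bs pr)}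
  let ι₂ := Σ p : ℕ, {q : L.Formula (δ ⊕ Fin p) × (Fin p → N) × (Fin p → N) //
    SameTypeOver L (M : Set N) q.2.1 q.2.2}
  let Φ : ι₁ ⊕ ι₂ → L.Formula (N ⊕ δ) := Sum.elim
    (fun θ => θ.1.relabel (Sum.elim Sum.inr (fun y => Sum.inl (pr y))))
    (fun q => (q.2.1.1.relabel (Sum.elim Sum.inr (fun y => Sum.inl (q.2.1.2.1 y)))).iff
      (q.2.1.1.relabel (Sum.elim Sum.inr (fun y => Sum.inl (q.2.1.2.2 y)))))
  obtain ⟨E, v, hv⟩ := compactness Φ (by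
    intro t
    obtain ⟨P, hP⟩ : ∃ P : ℕ, ∀ q ∈ t.toRight, q.1 ≤ P :=
      ⟨t.toRight.sup (fun q => q.1), fun q hq => Finset.le_sup (f := fun q : ι₂ => q.1) hq⟩
    obtain ⟨k, ⟨ε⟩⟩ := Finite.exists_equiv_fin t.toRight
    let Q : Fin k → ι₂ := fun i => (ε.symm i).1
    have hQ : ∀ i, (Q i).1 ≤ P := fun i => hP _ (ε.symm i).2
    let pc : Fin k → Fin P → N := fun i => padT P (e0 : N) (Q i).2.1.2.1
    let pc' : Fin k → Fin P → N := fun i => padT P (e0 : N) (Q i).2.1.2.2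
    have hmid := fun i => exists_mid M hsat (pc i) (pc' i) (sto_pad P e0.2 (Q i).2.2)
    choose s s' hs0 hs0' hs1 hs hs' using hmid
    let ψ : Fin k → L.Formula (δ ⊕ Fin P) := fun i =>
      (Q i).2.1.1.relabel (Sum.map id (Fin.castLE (hQ i)))
    obtain ⟨x, hx1, hx2⟩ := core2 hNIP M g b bs a' h1 h3
      (Formula.iInf (fun θ : t.toLeft => θ.1.1))
      (by
        rw [Formula.realize_iInf]
        exact fun θ => θ.1.2)
      (J := Fin k × Bool) P (fun j => ψ j.1)
      (fun j => if j.2 then pc j.1 else pc' j.1) (fun j => s j.1 1) (by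
        rintro ⟨i, _ | _⟩
        · exact ⟨s' i, by simp [hs0'], (hs1 i).symm, hs' i⟩
        · exact ⟨s i, by simp [hs0], rfl, hs i⟩)
    rw [Formula.realize_iInf] at hx1
    refine ⟨x, ?_⟩
    rintro (θ | q) hmem
    · have := hx1 ⟨θ, by simpa using hmem⟩
      simp only [Φ, Sum.elim_inl, Formula.realize_relabel]
      convert this using 1
      funext z; rcases z with z | z <;> rfl
    · have hq : q ∈ t.toRight := by simpa using hmem
      have hQq : Q (ε ⟨q, hq⟩) = q := by simp [Q]
      have ha := hx2 (ε ⟨q, hq⟩, true)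
      have hb := hx2 (ε ⟨q, hq⟩, false)
      simp only [if_true, Bool.false_eq_true, if_false] at ha hb
      have hab := ha.trans hb.symm
      generalize ε ⟨q, hq⟩ = i at hQq hab
      subst hQq
      simp only [ψ, pc, pc', Formula.realize_relabel, Sum.elim_comp_map, padT_castLE,
        Function.comp_id] at hab
      simp only [Φ, Sum.elim_inr, Formula.realize_iff, Formula.realize_relabel]
      have e2 : ∀ {p : ℕ} (q : Fin p → N),
          (Sum.elim id x) ∘ (Sum.elim Sum.inr (fun y => Sum.inl (q y))) = Sum.elim x q := by
        intro p q
        funext z; cases z <;> rfl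
      rw [e2, e2]
      exact hab)
  refine ⟨E, v, ?_, ?_⟩
  · have key : ∀ θ : L.Formula (δ ⊕ (M ⊕ Fin ny)), θ.Realize (Sum.elim bs pr) →
        θ.Realize (Sum.elim v (⇑E.emb ∘ pr)) := by
      intro θ hθ
      have := hv (Sum.inl ⟨θ, hθ⟩)
      simp only [Φ, Sum.elim_inl, Formula.realize_relabel] at this
      convert this using 1
      funext z; rcases z with z | z <;> rfl
    have key2 : ∀ θ : L.Formula (δ ⊕ (M ⊕ Fin ny)), θ.Realize (Sum.elim v (⇑E.emb ∘ pr)) ↔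
        θ.Realize (Sum.elim bs pr) := by
      intro θ
      refine ⟨fun h => ?_, key θ⟩
      by_contra hn
      exact key θ.not hn h
    intro p φ m hm
    have hm' : ∀ i, ∃ y, E.emb (pr y) = m i := by
      intro i
      obtain ⟨z, hz | ⟨y, rfl⟩, hz'⟩ := hm i
      · exact ⟨Sum.inl ⟨z, hz⟩, hz'⟩
      · exact ⟨Sum.inr y, hz'⟩
    choose y hy using hm'
    obtain rfl : ⇑E.emb ∘ pr ∘ y = m := funext hy
    have := key2 (φ.relabel (Sum.map id y))
    rw [Formula.realize_relabel, Formula.realize_relabel, Sum.elim_comp_map, Sum.elim_comp_map,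
      ← E.emb.map_formula] at this
    have e3 : ⇑E.emb ∘ Sum.elim (bs ∘ id) (pr ∘ y) =
        Sum.elim (⇑E.emb ∘ bs) (⇑E.emb ∘ pr ∘ y) := by
      funext z; cases z <;> rfl
    rw [e3] at this
    exact this
  · intro p φ c c' hcc
    have := hv (Sum.inr ⟨p, ⟨(φ, c, c'), hcc⟩⟩)
    simp only [Φ, Sum.elim_inr, Formula.realize_iff, Formula.realize_relabel] at this
    have e2 : ∀ {p : ℕ} (q : Fin p → N),
          (Sum.elim (⇑E.emb) v) ∘ (Sum.elim Sum.inr (fun y => Sum.inl (q y))) =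
          Sum.elim v (⇑E.emb ∘ q) := by
      intro p q
      funext z; cases z <;> rfl
    rw [e2, e2] at this
    exact this

theorem ext_of_isEmpty {N : Type w} [L.Structure N] [IsEmpty N] (A P : Set N) {α : Type*}
    (a : α → N) : ExtendsToInvariantType L A P a := by
  let eq : N ≃ ULift.{max u v, w} N := Equiv.ulift.symm
  let _ : L.Structure (ULift.{max u v, w} N) := eq.inducedStructure
  let E : ElemExt.{u, v, w} L N :=
    ⟨ULift.{max u v, w} N, (eq.inducedStructureEquiv (L := L)).toElementaryEmbedding⟩
  refine ⟨E, ⇑E.emb ∘ a, fun p φ m hm => Iff.rfl, ?_⟩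
  intro p φ c c' _
  have : c = c' := funext fun i => isEmptyElim (c i)
  rw [this]

end Helpers

/-- Fact 2.5 of the paper. Let `M ⪯ N` be models of a complete NIP theory
with `N` sufficiently saturated (`|M|⁺`-saturated). Let `q(y)` be a complete type over `M`
(encoded by a realization `q` in `N`; all such types are realized in `N` by saturation) and
let `b` be a strict Morley sequence in `N` for `q(y)`. Then `b` is indiscernible over `M`,
`b 0` realizes `q`, and for each `n`: (1) `tp(b (n+1) / M, b 0, ..., b n)` extends to a
complete type over `N` which is `M`-invariant, and (2) `tp(b 0, ..., b n / M, b (n+1))`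
extends to a complete type over `N` which is `M`-invariant. -/
theorem statement4 {L : FirstOrder.Language.{u, v}} {N : Type w} [L.Structure N]
    (M : L.ElementarySubstructure N) (hNIP : IsNIP L N)
    (hsat : IsSaturated L (Order.succ (Cardinal.mk M)) N)
    (ny : ℕ) (q : Fin ny → N) (b : ℕ → Fin ny → N)
    (hb : IsStrictMorleySequence L (M : Set N) q b) :
    IsIndiscernibleOver L (M : Set N) b ∧
    SameTypeOver L (M : Set N) (b 0) q ∧
    ∀ n : ℕ,
      ExtendsToInvariantType L (M : Set N)
        ((M : Set N) ∪ ⋃ i : Fin (n + 1), Set.range (b ↑i)) (b (n + 1)) ∧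
      ExtendsToInvariantType L (M : Set N)
        ((M : Set N) ∪ Set.range (b (n + 1)))
        (fun p : Fin (n + 1) × Fin ny => b ↑p.1 p.2) := by
  obtain ⟨hb1, hb2, hb3⟩ := hb
  refine ⟨hb1, hb2 0, fun n => ?_⟩
  rcases isEmpty_or_nonempty N with hN | hN
  · exact ⟨ext_of_isEmpty _ _ _, ext_of_isEmpty _ _ _⟩
  obtain ⟨E, F, a', h1, h2, h3⟩ := hb3 n
  have hg : ⇑F.emb ∘ ⇑E.emb = ⇑(F.emb.comp E.emb) := rfl
  have hP : (M : Set N) ∪ Set.range (fun p : Fin (n + 1) × Fin ny => b ↑p.1 p.2) =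
      (M : Set N) ∪ ⋃ i : Fin (n + 1), Set.range (b ↑i) := by
    congr 1
    ext x
    simp
  constructor
  · refine ⟨⟨F.Carrier, F.emb.comp E.emb⟩, a', ?_, ?_⟩
    · rw [← hP]
      exact h1
    · intro p φ c c' hcc
      exact inv_of_nonforking hNIP M hsat (F.emb.comp E.emb) (Set.range ⇑F.emb)
        (fun x => ⟨E.emb x, rfl⟩) a' h2 p φ c c' hcc
  · exact part2 hNIP M hsat (F.emb.comp E.emb) (b (n + 1)) _ a' h1 h3

end DistalPaper
end
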